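/- Let G be a finite group whose character graph Δ(G) is K₄-free with exactly seven vertices, and let M be a normal subgroup of G with R(G) < M such that S := M/R(G) ≅ PSL₂(q) for an odd prime power q, the centralizer of M/R(G) in G/R(G) is trivial, and the complement of the induced subgraph of Δ(G) on π(S) is not bipartite. Then it is impossible that π(q − 1) \ {2} and π(q + 1) \ {2} are both nonempty with sizes (1,2), (2,1) or (2,2) (i.e. Δ(S) is isomorphic neither to ((K₁ ∪ K₂) ⋆ K₁) ∪ K₁ nor to ((K₂ ∪ K₂) ⋆ K₁) ∪ K₁). -/

import Mathlib

open CategoryTheory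

/-- `cd(G)`: the set of character degrees of `G`, i.e. the dimensions of the simple
finite-dimensional complex representations of `G`. -/
def charDegrees (G : Type) [Group G] : Set ℕ :=
  { n | ∃ V : FDRep ℂ G, Simple V ∧ Module.finrank ℂ V = n }

/-- `ρ(G)`: the set of primes dividing some character degree of `G`. -/
def charPrimes (G : Type) [Group G] : Set ℕ :=
  { p | p.Prime ∧ ∃ n ∈ charDegrees G, p ∣ n }

/-- The character graph `Δ(G)`, on vertex set `ρ(G)`: two distinct primes `p`, `q`
are adjacent iff `p * q` divides some character degree of `G`. -/
def charGraph (G : Type) [Group G] : SimpleGraph (charPrimes G) where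
  Adj p q := (p : ℕ) ≠ (q : ℕ) ∧ ∃ n ∈ charDegrees G, (p : ℕ) * (q : ℕ) ∣ n
  symm := by
    constructor
    rintro p q ⟨h, n, hn, hd⟩
    exact ⟨fun e => h e.symm, n, hn, by rwa [mul_comm]⟩
  loopless := by constructor; rintro p ⟨h, -⟩; exact h rfl

/-- The solvable radical `R(G)` of `G`: the largest solvable normal subgroup of `G`
(realized as the join of all solvable normal subgroups). -/
def solvableRadical (G : Type*) [Group G] : Subgroup G :=
  ⨆ N : { N : Subgroup G // N.Normal ∧ IsSolvable ↥N }, (N : Subgroup G)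

instance solvableRadical_normal (G : Type*) [Group G] : (solvableRadical G).Normal := by
  constructor
  intro n hn g
  refine Subgroup.iSup_induction (C := fun x => g * x * g⁻¹ ∈ solvableRadical G)
    (fun N : { N : Subgroup G // N.Normal ∧ IsSolvable ↥N } => (N : Subgroup G)) hn ?_ ?_ ?_
  · intro N x hx
    exact Subgroup.mem_iSup_of_mem N (N.2.1.conj_mem x hx g)
  · simpa using Subgroup.one_mem _
  · intro x y hx hy
    have h : g * (x * y) * g⁻¹ = (g * x * g⁻¹) * (g * y * g⁻¹) := by group
    rw [h]; exact Subgroup.mul_mem _ hx hy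

/-- `PSL₂(F)`: the special linear group `SL₂(F)` modulo its center. -/
abbrev PSL2 (F : Type) [Field F] :=
  Matrix.SpecialLinearGroup (Fin 2) F ⧸
    Subgroup.center (Matrix.SpecialLinearGroup (Fin 2) F)

/-- The join `Γ ⋆ Δ` of two simple graphs: the disjoint union together with all
edges between the two vertex sets. -/
def graphJoin {α β : Type*} (G : SimpleGraph α) (H : SimpleGraph β) :
    SimpleGraph (α ⊕ β) :=
  (G ⊕g H) ⊔
    { Adj := fun u v => u.isLeft ≠ v.isLeft
      symm := ⟨fun _ _ h => h.symm⟩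
      loopless := ⟨fun _ h => h rfl⟩ }

/-- The image of a subgroup `M` of `G` in `G/R(G)`; when `R(G) ≤ M` this is `M/R(G)`. -/
def radicalQuotImage {G : Type*} [Group G] (M : Subgroup G) :
    Subgroup (G ⧸ solvableRadical G) :=
  M.map (QuotientGroup.mk' (solvableRadical G))

open scoped TensorProduct
open Function (Bijective Surjective)
open LinearMap (ker ker_eq_bot trace_one trace_mul_comm smulRight_apply IsProj finrank_range_of_inj det det_smul)
open Module (finrank finrank_pos Basis finBasis finrank_tensorProduct nontrivial_of_finrank_pos)
open Finset (sum_congr sum_comm sum_smul smul_sum sum_eq_zero sum_add_distrib univ sum_const mem_filter sum_filter sum_range_succ mul_sum sum_mul card_range mem_range sum_mul_sum card_univ mem_coe card_filter sum_eq_single sum_bij' sum_sub_distrib sum_filter_of_ne sum_le_sum sum_nonneg add_sum_erase mem_erase card_erase_of_mem sum_le_sum_of_subset_of_nonneg filter_subset card_nsmul_le_sum)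
open LinearEquiv (ofBijective coe_coe)
open Submodule (span smul_mem subset_span span_induction nontrivial_iff_ne_bot finrank_map_subtype_eq eq_top_of_finrank_eq finrank_le ne_bot_iff subtype_apply)
open Or (inl inr)
open TensorProduct (lid sum_tmul smul_tmul tmul_add map_add_left map_smul_left ext' smul_tmul')
open Subgroup (coe_subtype relIndex_mul_index mem_comap mem_centralizer_singleton_iff zpowers zpowers_le)
open Nat (card_eq_fintype_card cast_smul_eq_nsmul eq_of_mul_eq_mul_left card_zpowers cast_sub Coprime coprime_two_right le_of_dvd one_le_iff_ne_zero dvd_of_mul_dvd_mul_left)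
open Complex (isPrimitiveRoot_exp mul_conj' conj_natCast)
open QuotientGroup (mk_mul_of_mem out_eq' quotientKerEquivOfSurjective mk')
open Fintype (sum_prod_type ofFinite)
open Units (val_mul)
open MonoidHom (fst)
open MonoidAlgebra (basis)
open Matrix (toLinAlgEquiv' stdBasis det_fin_two)
local notation "NC" => Nat.card
local notation "EC" => Module.End ℂ
local notation "FR" => Module.finrank ℂ
local notation "UV" => Finset.univ
set_option linter.unusedSectionVars false
set_option linter.unusedVariables false
def IrrR {G V : Type*} [Group G] [AddCommGroup V] [Module ℂ V] (ρ : G →* EC V) : Prop :=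
  Nontrivial V ∧ ∀ P : Submodule ℂ V, (∀ g, ∀ v ∈ P, ρ g v ∈ P) → P = ⊥ ∨ P = ⊤

section Basics

variable {G V W : Type*} [Group G] [AddCommGroup V] [Module ℂ V] [AddCommGroup W] [Module ℂ W]

lemma IrrR.scalar [FiniteDimensional ℂ V] {ρ : G →* EC V} (h : IrrR ρ)
    (f : EC V) (hf : ∀ g, f * ρ g = ρ g * f) : ∃ c : ℂ, f = c • 1 := by
  have := h.1
  obtain ⟨c, hc⟩ := Module.End.exists_eigenvalue f
  refine ⟨c, ?_⟩
  have h2 := h.2 (Module.End.eigenspace f c) (by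
    intro g v hv
    rw [Module.End.mem_eigenspace_iff] at hv ⊢
    have := LinearMap.congr_fun (hf g) v
    simp only [Module.End.mul_apply] at this
    rw [this, hv, map_smul])
  rcases h2 with h2 | h2
  · exact absurd h2 hc
  · ext v
    have : v ∈ Module.End.eigenspace f c := by rw [h2]; trivial
    rw [Module.End.mem_eigenspace_iff] at this
    simpa using this

lemma IrrR.hom_zero_or_bij {ρ : G →* EC V} (h : IrrR ρ) {σ : G →* EC W}
    (h' : IrrR σ)
    (f : V →ₗ[ℂ] W) (hf : ∀ g v, f (ρ g v) = σ g (f v)) : f = 0 ∨ Bijective f := by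
  rcases h.2 (ker f) (by intro g v hv; rw [LinearMap.mem_ker] at *; rw [hf, hv, map_zero])
    with h1 | h1
  · rcases h'.2 (LinearMap.range f) (by
      rintro g _ ⟨v, rfl⟩; exact ⟨ρ g v, hf g v⟩) with h2 | h2
    · left; exact LinearMap.range_eq_bot.1 h2
    · right; exact ⟨ker_eq_bot.1 h1, LinearMap.range_eq_top.1 h2⟩
  · left; exact LinearMap.ker_eq_top.1 h1

lemma charDegrees_of_irrR {G V : Type} [Group G] [Finite G] [AddCommGroup V] [Module ℂ V]
    [FiniteDimensional ℂ V] (ρ : G →* EC V) (h : IrrR ρ) :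
    finrank ℂ V ∈ charDegrees G := by
  refine ⟨FDRep.of ρ, ?_, rfl⟩
  have := h.1
  have : NeZero (NC G : ℂ) := ⟨by exact_mod_cast Nat.card_pos.ne'⟩
  rw [FDRep.simple_iff_end_is_rank_one]
  have hone : (𝟙 (FDRep.of ρ)) ≠ 0 := by
    intro h0
    obtain ⟨v, hv⟩ := exists_ne (0 : V)
    apply hv
    have h1 : ((𝟙 (FDRep.of ρ) : FDRep.of ρ ⟶ FDRep.of ρ)).hom.hom.hom v
      = ((0 : FDRep.of ρ ⟶ FDRep.of ρ)).hom.hom.hom v := by rw [h0]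
    exact h1
  refine (finrank_eq_one_iff_of_nonzero' _ hone).2 ?_
  intro f
  obtain ⟨c, hc⟩ := h.scalar f.hom.hom.hom (by
    intro g
    have := f.comm g
    have h2 := congrArg (fun z => z.hom.hom) this
    exact h2)
  refine ⟨c, ?_⟩
  ext v
  have := LinearMap.congr_fun hc v
  exact this.symm

lemma irrR_of_charDegrees {G : Type} [Group G] [Finite G] {n : ℕ} (hn : n ∈ charDegrees G) :
    ∃ (V : Type) (_ : AddCommGroup V) (_ : Module ℂ V) (_ : FiniteDimensional ℂ V)
      (ρ : G →* EC V), IrrR ρ ∧ finrank ℂ V = n := by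
  obtain ⟨V, hV, rfl⟩ := hn
  refine ⟨V, inferInstance, inferInstance, inferInstance, V.ρ, ⟨?_, ?_⟩, rfl⟩
  · by_contra hnt
    rw [not_nontrivial_iff_subsingleton] at hnt
    apply id_nonzero V
    ext v
    exact Subsingleton.elim (α := V) _ _
  · intro P hP
    by_cases hb : P = ⊥
    · left; exact hb
    right
    let ρP : G →* EC P :=
      { toFun := fun g => (V.ρ g).restrict (hP g)
        map_one' := by ext v; simp
        map_mul' := by intro a b; ext v; simp }
    let f : FDRep.of ρP ⟶ V := ⟨InducedCategory.homMk (ModuleCat.ofHom P.subtype), fun g ↦ by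
      ext v
      rfl⟩
    have hmono : Mono f := by
      constructor
      intro Z a b hab
      ext v
      have h2 := congrArg (fun z => z.hom.hom.hom v) hab
      exact h2
    have hf : f ≠ 0 := by
      intro h0
      apply hb
      rw [eq_bot_iff]
      intro v hv
      have h2 := congrArg (fun z => z.hom.hom.hom (⟨v, hv⟩ : P)) h0
      exact h2
    have hiso : IsIso f := isIso_of_mono_of_nonzero hf
    rw [eq_top_iff]
    intro v _
    have h3 := congrArg (fun z => z.hom.hom.hom v) (IsIso.inv_hom_id f)
    have h4 : ((inv f).hom.hom.hom v : P).1 = v := h3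
    rw [← h4]
    exact Subtype.property _
end Basics

section Avg
variable {G V W : Type*} [Group G] [Fintype G] [AddCommGroup V] [Module ℂ V] [AddCommGroup W]
  [Module ℂ W]

lemma avg_comm (ρ : G →* EC V) (σ : G →* EC W) (X : W →ₗ[ℂ] V) (h : G) (w : W) :
    (∑ g, ρ g ∘ₗ X ∘ₗ σ g⁻¹) (σ h w) = ρ h ((∑ g, ρ g ∘ₗ X ∘ₗ σ g⁻¹) w) := by
  simp only [LinearMap.sum_apply, LinearMap.comp_apply, map_sum]
  rw [← Equiv.sum_comp (Equiv.mulLeft h)]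
  refine sum_congr rfl fun g _ => ?_
  simp [← Module.End.mul_apply (σ _) (σ _), ← Module.End.mul_apply (ρ _) (ρ _), ← map_mul]

variable [FiniteDimensional ℂ V] [FiniteDimensional ℂ W]

lemma IrrR.finrank_ne {ρ : G →* EC V} (h : IrrR ρ) : (finrank ℂ V : ℂ) ≠ 0 := by
  have := h.1
  exact_mod_cast finrank_pos.ne'

lemma IrrR.avg {ρ : G →* EC V} (h : IrrR ρ) (X : EC V) :
    ∑ g, ρ g ∘ₗ X ∘ₗ ρ g⁻¹
      = ((Fintype.card G : ℂ) * LinearMap.trace ℂ V X / finrank ℂ V) • 1 := by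
  obtain ⟨c, hc⟩ := h.scalar (∑ g, ρ g ∘ₗ X ∘ₗ ρ g⁻¹) (by
    intro g; ext v; exact avg_comm ρ ρ X g v)
  rw [hc]
  congr 1
  rw [eq_div_iff h.finrank_ne]
  have h2 := congrArg (LinearMap.trace ℂ V) hc
  rw [map_sum, map_smul, trace_one, smul_eq_mul] at h2
  rw [← h2]
  rw [sum_congr rfl (g := fun _ => LinearMap.trace ℂ V X)]
  · simp
  · intro g _
    have : ρ g ∘ₗ X ∘ₗ ρ g⁻¹ = ρ g * (X * ρ g⁻¹) := rfl
    rw [this, trace_mul_comm, mul_assoc, ← map_mul]; simp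

lemma trace_eq_sum_coord {ι : Type*} [Fintype ι] (b : Basis ι ℂ V) (f : EC V) :
    LinearMap.trace ℂ V f = ∑ i, b.coord i (f (b i)) := by
  classical
  rw [LinearMap.trace_eq_matrix_trace ℂ b, Matrix.trace]
  simp [LinearMap.toMatrix_apply]

lemma key_aux {ι : Type*} [Fintype ι] (b : Basis ι ℂ W)
    (ρ : G →* EC V) (σ : G →* EC W) (Y : EC W) (v : V) :
    (∑ g, LinearMap.trace ℂ W (Y * σ g⁻¹) • ρ g) v =
      ∑ i, (∑ g, ρ g ∘ₗ ((b.coord i ∘ₗ Y).smulRight v) ∘ₗ σ g⁻¹) (b i) := by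
  simp only [LinearMap.sum_apply, LinearMap.comp_apply, smulRight_apply,
    LinearMap.smul_apply, map_smul]
  rw [sum_comm]
  refine sum_congr rfl fun g _ => ?_
  rw [trace_eq_sum_coord b, sum_smul]
  rfl

lemma IrrR.key {ρ : G →* EC V} (h : IrrR ρ) (Y : EC V) :
    ∑ g, LinearMap.trace ℂ V (Y * ρ g⁻¹) • ρ g
      = ((Fintype.card G : ℂ) / finrank ℂ V) • Y := by
  ext v
  let b := finBasis ℂ V
  rw [key_aux b]
  simp only [h.avg, LinearMap.trace_smulRight, LinearMap.smul_apply, Module.End.one_apply]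
  rw [← b.sum_repr (Y v)]
  rw [smul_sum]
  refine sum_congr rfl fun i _ => ?_
  rw [smul_smul]; congr 1; simp; ring

lemma IrrR.key_ne {ρ : G →* EC V} (h : IrrR ρ) {σ : G →* EC W} (h' : IrrR σ)
    (hne : ¬ ∃ f : W ≃ₗ[ℂ] V, ∀ g w, f (σ g w) = ρ g (f w)) (Y : EC W) :
    ∑ g, LinearMap.trace ℂ W (Y * σ g⁻¹) • ρ g = 0 := by
  ext v
  let b := finBasis ℂ W
  rw [key_aux b]
  refine sum_eq_zero fun i _ => ?_
  rcases h'.hom_zero_or_bij h (∑ g, ρ g ∘ₗ ((b.coord i ∘ₗ Y).smulRight v) ∘ₗ σ g⁻¹)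
    (fun g w => avg_comm ρ σ _ g w) with h0 | h0
  · rw [h0]; rfl
  · exact absurd ⟨ofBijective _ h0, fun g w => avg_comm ρ σ _ g w⟩ hne

lemma IrrR.span {ρ : G →* EC V} (h : IrrR ρ) : span ℂ (Set.range ρ) = ⊤ := by
  rw [eq_top_iff]
  intro Y _
  have h1 := h.key Y
  have hc : ((Fintype.card G : ℂ) / finrank ℂ V) ≠ 0 :=
    div_ne_zero (by exact_mod_cast Fintype.card_ne_zero) h.finrank_ne
  have : Y = ((Fintype.card G : ℂ) / finrank ℂ V)⁻¹ •
      ∑ g, LinearMap.trace ℂ V (Y * ρ g⁻¹) • ρ g := by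
    rw [h1, smul_smul, inv_mul_cancel₀ hc, one_smul]
  rw [this]
  refine smul_mem _ _ (Submodule.sum_mem _ fun g _ => smul_mem _ _ ?_)
  exact subset_span ⟨g, rfl⟩

omit [Fintype G] [FiniteDimensional ℂ V] in
lemma irrR_of_span [Nontrivial V] (ρ : G →* EC V)
    (h : span ℂ (Set.range ρ) = ⊤) : IrrR ρ := by
  refine ⟨inferInstance, fun P hP => ?_⟩
  have key : ∀ Y : EC V, ∀ v ∈ P, Y v ∈ P := by
    intro Y v hv
    have : Y ∈ span ℂ (Set.range ρ) := by rw [h]; trivial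
    induction this using span_induction with
    | mem x hx => obtain ⟨g, rfl⟩ := hx; exact hP g v hv
    | zero => exact P.zero_mem
    | add x y _ _ hx hy => exact P.add_mem hx hy
    | smul a x _ hx => exact P.smul_mem a hx
  by_cases hb : P = ⊥
  · exact inl hb
  right
  obtain ⟨v, hv, hv0⟩ := P.ne_bot_iff.1 hb
  rw [eq_top_iff]
  intro w _
  obtain ⟨f, hf⟩ := Module.Projective.exists_dual_ne_zero ℂ hv0
  have := key (f.smulRight ((f v)⁻¹ • w)) v hv
  simpa [smul_smul, hf] using this

lemma IrrR.norm {ρ : G →* EC V} (h : IrrR ρ) :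
    ∑ g, LinearMap.trace ℂ V (ρ g) * LinearMap.trace ℂ V (ρ g⁻¹) = Fintype.card G := by
  have h1 := congrArg (LinearMap.trace ℂ V) (h.key 1)
  rw [map_smul, trace_one, smul_eq_mul, div_mul_cancel₀ _ h.finrank_ne, map_sum] at h1
  rw [← h1]
  refine sum_congr rfl fun g _ => ?_
  rw [map_smul, smul_eq_mul, one_mul, mul_comm]

omit [Fintype G] in
lemma exists_irr_sub [Nontrivial V] (ρ : G →* EC V) :
    ∃ (P : Submodule ℂ V) (hP : ∀ g, ∀ v ∈ P, ρ g v ∈ P)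
      (τ : G →* EC P), (∀ g v, (τ g v : V) = ρ g v) ∧ IrrR τ := by
  have hex : ∃ n, ∃ P : Submodule ℂ V, P ≠ ⊥ ∧ (∀ g, ∀ v ∈ P, ρ g v ∈ P) ∧
    finrank ℂ P = n := ⟨_, ⊤, by simp, by simp, rfl⟩
  classical
  obtain ⟨P, hb, hP, hn⟩ := Nat.find_spec hex
  refine ⟨P, hP, { toFun := fun g => (ρ g).restrict (hP g)
                   map_one' := by ext v; simp
                   map_mul' := by intro a b; ext v; simp }, fun g v => rfl, ?_, ?_⟩
  · exact nontrivial_iff_ne_bot.2 hb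
  · intro Q hQ
    by_cases hq : Q = ⊥
    · exact inl hq
    right
    have h1 := Nat.find_min' hex ⟨Q.map P.subtype, by
      intro hm; apply hq; rw [eq_bot_iff]; intro v hv
      have h3 : (v : V) ∈ Q.map P.subtype := ⟨v, hv, rfl⟩
      rw [hm] at h3; simpa using h3, by
      rintro g _ ⟨v, hv, rfl⟩
      exact ⟨_, hQ g v hv, rfl⟩, rfl⟩
    rw [← hn, finrank_map_subtype_eq] at h1
    exact eq_top_of_finrank_eq (le_antisymm (finrank_le _) h1)
end Avg

section Tens
variable {N W E : Type*} [Group N] [Fintype N] [AddCommGroup W] [Module ℂ W] [FiniteDimensional ℂ W]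
  [AddCommGroup E] [Module ℂ E]

lemma tens_expand {ι : Type*} [Fintype ι] (b : Basis ι ℂ W) (z : W ⊗[ℂ] E) :
    z = ∑ i, b i ⊗ₜ[ℂ] lid ℂ E (TensorProduct.map (b.coord i) LinearMap.id z) := by
  induction z using TensorProduct.induction_on with
  | zero => simp
  | tmul w e =>
    conv_lhs => rw [← b.sum_repr w, sum_tmul]
    refine sum_congr rfl fun i _ => ?_
    simp [smul_tmul]
  | add x y hx hy =>
    conv_lhs => rw [hx, hy]
    simp only [map_add, tmul_add, sum_add_distrib]

lemma tens_rank_one (f : W →ₗ[ℂ] ℂ) (w : W) (z : W ⊗[ℂ] E) :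
    TensorProduct.map (f.smulRight w) LinearMap.id z
      = w ⊗ₜ[ℂ] lid ℂ E (TensorProduct.map f LinearMap.id z) := by
  induction z using TensorProduct.induction_on with
  | zero => simp
  | tmul w' e => simp [smul_tmul]
  | add x y hx hy => simp only [map_add, tmul_add, hx, hy]

lemma IrrR.tens {σ : N →* EC W} (h : IrrR σ) (Q : Submodule ℂ (W ⊗[ℂ] E))
    (hQ : ∀ n, ∀ z ∈ Q, TensorProduct.map (σ n) LinearMap.id z ∈ Q) (hb : Q ≠ ⊥) :
    ∃ e : E, e ≠ 0 ∧ ∀ w : W, w ⊗ₜ[ℂ] e ∈ Q := by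
  obtain ⟨z, hz, hz0⟩ := Q.ne_bot_iff.1 hb
  let b := finBasis ℂ W
  have key : ∀ Y : EC W, TensorProduct.map Y LinearMap.id z ∈ Q := by
    intro Y
    have : Y ∈ Submodule.span ℂ (Set.range σ) := by rw [h.span]; trivial
    induction this using span_induction with
    | mem x hx => obtain ⟨g, rfl⟩ := hx; exact hQ g z hz
    | zero => simp
    | add x y _ _ hx hy => rw [map_add_left]; exact Q.add_mem hx hy
    | smul a x _ hx => rw [map_smul_left]; exact Q.smul_mem a hx
  by_contra hcon
  push Not at hcon
  apply hz0
  rw [tens_expand b z]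
  refine sum_eq_zero fun i _ => ?_
  by_cases he : lid ℂ E (TensorProduct.map (b.coord i) LinearMap.id z) = 0
  · rw [he, TensorProduct.tmul_zero]
  · obtain ⟨w, hw⟩ := hcon _ he
    exact absurd (tens_rank_one (b.coord i) w z ▸ key _) hw
end Tens

section HomRep
variable {N V W W' : Type*} [Group N] [Fintype N] [AddCommGroup V] [Module ℂ V]
  [FiniteDimensional ℂ V]
  [AddCommGroup W] [Module ℂ W] [FiniteDimensional ℂ W]
  [AddCommGroup W'] [Module ℂ W'] [FiniteDimensional ℂ W']

def HomR (σ : N →* EC W) (ρ : N →* EC V) : Submodule ℂ (W →ₗ[ℂ] V) where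
  carrier := {f | ∀ n w, f (σ n w) = ρ n (f w)}
  add_mem' := by intro a b ha hb n w; simp [ha n w, hb n w]
  zero_mem' := by intro n w; simp
  smul_mem' := by intro c a ha n w; simp [ha n w]

noncomputable def epsR (σ : N →* EC W) (ρ : N →* EC V) : EC V :=
  ((finrank ℂ W : ℂ) / Fintype.card N) • ∑ x, LinearMap.trace ℂ W (σ x⁻¹) • ρ x

lemma eps_comm (σ : N →* EC W) (τ : N →* EC W') (ρ : N →* EC V)
    (f : W' →ₗ[ℂ] V) (hf : f ∈ HomR τ ρ) (w : W') : epsR σ ρ (f w) = f (epsR σ τ w) := by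
  simp only [epsR, LinearMap.smul_apply, LinearMap.sum_apply, map_smul, map_sum]
  congr 1
  refine sum_congr rfl fun x _ => ?_
  rw [hf x w]

lemma eps_self {σ : N →* EC W} (h : IrrR σ) : epsR σ σ = 1 := by
  have h1 := h.key 1
  simp only [one_mul] at h1
  have hc : (Fintype.card N : ℂ) ≠ 0 := by exact_mod_cast Fintype.card_ne_zero
  rw [epsR, h1, smul_smul, div_mul_div_cancel₀ hc, div_self h.finrank_ne, one_smul]

lemma eps_fix {σ : N →* EC W} (h : IrrR σ) {ρ : N →* EC V}
    {f : W →ₗ[ℂ] V} (hf : f ∈ HomR σ ρ) (w : W) : epsR σ ρ (f w) = f w := by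
  rw [eps_comm σ σ ρ f hf, eps_self h]; rfl

lemma eps_kill {σ : N →* EC W} (h : IrrR σ) {τ : N →* EC W'} (h' : IrrR τ)
    (hne : ¬ ∃ f : W ≃ₗ[ℂ] W', ∀ g w, f (σ g w) = τ g (f w)) {ρ : N →* EC V}
    {f : W' →ₗ[ℂ] V} (hf : f ∈ HomR τ ρ) (w : W') : epsR σ ρ (f w) = 0 := by
  rw [eps_comm σ τ ρ f hf]
  have h1 := h'.key_ne h hne 1
  simp only [one_mul] at h1
  rw [epsR, h1]; simp

noncomputable def evR (σ : N →* EC W) (ρ : N →* EC V)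
    (E1 : Submodule ℂ (W →ₗ[ℂ] V)) : W ⊗[ℂ] E1 →ₗ[ℂ] V :=
  TensorProduct.lift ((LinearMap.id (R := ℂ) (M := W →ₗ[ℂ] V)).flip.compr₂ₛₗ LinearMap.id |>.compl₂ E1.subtype)

@[simp] lemma evR_tmul (σ : N →* EC W) (ρ : N →* EC V)
    (E1 : Submodule ℂ (W →ₗ[ℂ] V)) (w : W) (f : E1) : evR σ ρ E1 (w ⊗ₜ f) = f.1 w := rfl

lemma evR_inj {σ : N →* EC W} (h : IrrR σ) (ρ : N →* EC V)
    (E1 : Submodule ℂ (W →ₗ[ℂ] V)) (hE : E1 ≤ HomR σ ρ) : Function.Injective (evR σ ρ E1) := by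
  rw [← ker_eq_bot]
  by_contra hb
  obtain ⟨e, he, hew⟩ := h.tens (ker (evR σ ρ E1)) (by
    intro n z hz
    rw [LinearMap.mem_ker] at hz ⊢
    have : evR σ ρ E1 (TensorProduct.map (σ n) LinearMap.id z) = ρ n (evR σ ρ E1 z) := by
      clear hz
      induction z using TensorProduct.induction_on with
      | zero => simp
      | tmul w e => simp; exact hE e.2 n w
      | add x y hx hy => simp only [map_add, hx, hy]
    rw [this, hz, map_zero]) hb
  apply he
  ext w
  exact hew w

lemma eps_mem (σ : N →* EC W) (ρ : N →* EC V) (v : V) :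
    epsR σ ρ v ∈ LinearMap.range (evR σ ρ (HomR σ ρ)) := by
  rw [epsR, LinearMap.smul_apply]
  refine smul_mem _ _ ?_
  have := key_aux (finBasis ℂ W) ρ σ 1 v
  simp only [one_mul] at this
  rw [this]
  refine Submodule.sum_mem _ fun i _ => ?_
  exact ⟨finBasis ℂ W i ⊗ₜ ⟨_, fun n w => avg_comm ρ σ _ n w⟩, rfl⟩

lemma eps_trace {σ : N →* EC W} (h : IrrR σ) (ρ : N →* EC V) :
    LinearMap.trace ℂ V (epsR σ ρ) = finrank ℂ W * finrank ℂ (HomR σ ρ) := by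
  have hp : IsProj (LinearMap.range (evR σ ρ (HomR σ ρ))) (epsR σ ρ) := by
    refine ⟨fun v => eps_mem σ ρ v, ?_⟩
    rintro _ ⟨z, rfl⟩
    induction z using TensorProduct.induction_on with
    | zero => simp
    | tmul w e => exact eps_fix h e.2 w
    | add x y hx hy => simp only [map_add, hx, hy]
  rw [hp.trace, finrank_range_of_inj (evR_inj h ρ _ le_rfl), finrank_tensorProduct]
  push_cast; rfl
end HomRep

section Cliff
variable {G V W : Type*} [Group G] [Fintype G] [AddCommGroup V] [Module ℂ V]
  [FiniteDimensional ℂ V]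
  [AddCommGroup W] [Module ℂ W] [FiniteDimensional ℂ W] (N : Subgroup G) [hN : N.Normal]
  [Fintype N]

noncomputable def cjN (g : G) : N →* N := (MulAut.conjNormal g : N ≃* N).toMonoidHom

@[simp] lemma cjN_coe (g : G) (n : N) : (cjN N g n : G) = g * n * g⁻¹ := by
  simp [cjN]

lemma cjN_mul (g h : G) (n : N) : cjN N (g * h) n = cjN N g (cjN N h n) := by
  ext; simp [mul_assoc]

lemma cjN_one (n : N) : cjN N 1 n = n := by
  ext; simp

lemma cjN_inv (g : G) (n : N) : cjN N g (cjN N g⁻¹ n) = n := by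
  ext; simp [mul_assoc]

variable (σ : N →* EC W)

def inertR : Subgroup G where
  carrier := {g | ∃ A : W ≃ₗ[ℂ] W, ∀ n w, A (σ n w) = σ (cjN N g n) (A w)}
  one_mem' := ⟨LinearEquiv.refl ℂ W, fun n w => by simp [cjN_one]⟩
  mul_mem' := by
    rintro g h ⟨A, hA⟩ ⟨B, hB⟩
    exact ⟨B.trans A, fun n w => by simp [cjN_mul, hA, hB]⟩
  inv_mem' := by
    rintro g ⟨A, hA⟩
    refine ⟨A.symm, fun n w => ?_⟩
    rw [A.symm_apply_eq, hA, cjN_inv, A.apply_symm_apply]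

variable {N σ}

lemma irr_cj (h : IrrR σ) (g : G) : IrrR (σ.comp (cjN N g)) := by
  refine ⟨h.1, fun P hP => h.2 P fun n v hv => ?_⟩
  have := hP (cjN N g⁻¹ n) v hv
  simpa [cjN_inv] using this

lemma hom_cj {ρ : G →* EC V} (g : G) {f : W →ₗ[ℂ] V}
    (hf : f ∈ HomR σ (ρ.comp N.subtype)) :
    (ρ g⁻¹ ∘ₗ f) ∈ HomR (σ.comp (cjN N g)) (ρ.comp N.subtype) := by
  intro n w
  have := hf (cjN N g n) w
  simp only [MonoidHom.comp_apply, LinearMap.comp_apply, coe_subtype, cjN_coe] at this ⊢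
  rw [this]
  simp only [← Module.End.mul_apply, ← map_mul]
  group

lemma eps_mem_T (h : IrrR σ) {ρ : G →* EC V} {f : W →ₗ[ℂ] V}
    (hf : f ∈ HomR σ (ρ.comp N.subtype)) {g : G} (hg : g ∈ inertR N σ) (w : W) :
    epsR σ (ρ.comp N.subtype) (ρ g⁻¹ (f w)) = ρ g⁻¹ (f w) := by
  obtain ⟨A, hA⟩ := hg
  have h2 : (ρ g⁻¹ ∘ₗ f ∘ₗ A.toLinearMap) ∈ HomR σ (ρ.comp N.subtype) := by
    intro n w
    have := hom_cj g hf n (A w)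
    simp only [LinearMap.comp_apply, coe_coe, hA] at this ⊢
    exact this
  have := eps_fix h h2 (A.symm w)
  simpa using this

lemma eps_not_mem_T (h : IrrR σ) {ρ : G →* EC V} {f : W →ₗ[ℂ] V}
    (hf : f ∈ HomR σ (ρ.comp N.subtype)) {g : G} (hg : g ∉ inertR N σ) (w : W) :
    epsR σ (ρ.comp N.subtype) (ρ g⁻¹ (f w)) = 0 := by
  refine eps_kill h (irr_cj h g) ?_ (hom_cj g hf) w
  rintro ⟨A, hA⟩
  exact hg ⟨A, hA⟩

lemma cliff_dim (h : IrrR σ) {ρ : G →* EC V} (hρ : IrrR ρ)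
    (hE : HomR σ (ρ.comp N.subtype) ≠ ⊥) :
    finrank ℂ V = (inertR N σ).index * finrank ℂ W *
      finrank ℂ (HomR σ (ρ.comp N.subtype)) := by
  classical
  obtain ⟨f, hf, hf0⟩ := ne_bot_iff _ |>.1 hE
  obtain ⟨w, hw⟩ : ∃ w, f w ≠ 0 := by
    by_contra hc; push Not at hc; exact hf0 (LinearMap.ext hc)
  have h1 := LinearMap.congr_fun (hρ.avg (epsR σ (ρ.comp N.subtype))) (f w)
  rw [eps_trace h] at h1
  have h2 : (∑ g, ρ g ∘ₗ epsR σ (ρ.comp N.subtype) ∘ₗ ρ g⁻¹) (f w)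
      = (NC (inertR N σ) : ℂ) • f w := by
    rw [LinearMap.sum_apply, card_eq_fintype_card, Fintype.card_subtype]
    rw [← Finset.sum_filter_add_sum_filter_not univ (fun g => g ∈ inertR N σ)]
    rw [sum_congr rfl (g := fun _ => f w), sum_eq_zero (s := Finset.filter (fun g => ¬ _) _)]
    · rw [sum_const, add_zero, cast_smul_eq_nsmul]
    · intro g hg
      rw [mem_filter] at hg
      simp only [LinearMap.comp_apply]
      rw [eps_not_mem_T h hf hg.2, map_zero]
    · intro g hg
      rw [mem_filter] at hg
      simp only [LinearMap.comp_apply]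
      rw [eps_mem_T h hf hg.2, ← Module.End.mul_apply, ← map_mul]
      simp
  rw [h2, LinearMap.smul_apply, Module.End.one_apply] at h1
  have h3 := smul_left_injective ℂ hw h1
  rw [eq_div_iff hρ.finrank_ne] at h3
  have h4 := (inertR N σ).index_mul_card
  have hc : NC (inertR N σ) ≠ 0 := Nat.card_pos.ne'
  apply eq_of_mul_eq_mul_left (Nat.pos_of_ne_zero hc)
  rw [← Nat.cast_inj (R := ℂ)]
  push_cast
  rw [h3, ← card_eq_fintype_card, ← h4]
  push_cast; ring

variable {Γ : Type*} [Group Γ]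

def multR (ρ : G →* EC V) (a : Γ →* G) (b : Γ →* EC W)
    (hb : ∀ γ n w, b γ (σ n w) = σ (cjN N (a γ) n) (b γ w)) :
    Γ →* EC (HomR σ (ρ.comp N.subtype)) where
  toFun γ :=
    { toFun := fun f => ⟨ρ (a γ) ∘ₗ f.1 ∘ₗ b γ⁻¹, by
        intro n w
        have := f.2 (cjN N (a γ⁻¹) n) (b γ⁻¹ w)
        simp only [LinearMap.comp_apply, hb]
        rw [this]
        simp only [MonoidHom.comp_apply, coe_subtype, cjN_coe,
          ← Module.End.mul_apply, ← map_mul]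
        simp [mul_assoc]⟩
      map_add' := by intro f g; ext w; simp
      map_smul' := by intro c f; ext w; simp }
  map_one' := by ext f w; simp
  map_mul' := by intro x y; ext f w; simp

@[simp] lemma multR_apply (ρ : G →* EC V) (a : Γ →* G) (b : Γ →* EC W)
    (hb : ∀ γ n w, b γ (σ n w) = σ (cjN N (a γ) n) (b γ w)) (γ : Γ)
    (f : HomR σ (ρ.comp N.subtype)) (w : W) :
    (multR ρ a b hb γ f).1 w = ρ (a γ) (f.1 (b γ⁻¹ w)) := rfl

lemma mult_irr (h : IrrR σ) {ρ : G →* EC V} (hρ : IrrR ρ) (a : Γ →* G)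
    (b : Γ →* EC W)
    (hb : ∀ γ n w, b γ (σ n w) = σ (cjN N (a γ) n) (b γ w))
    (ha : ∀ g ∈ inertR N σ, ∃ γ, a γ = g)
    (hE : HomR σ (ρ.comp N.subtype) ≠ ⊥) : IrrR (multR ρ a b hb) := by
  refine ⟨nontrivial_iff_ne_bot.2 hE, fun E1 hE1 => ?_⟩
  by_cases hbt : E1 = ⊥
  · exact inl hbt
  right
  obtain ⟨f0, hf0, hf00⟩ := ne_bot_iff _ |>.1 hbt
  obtain ⟨w0, hw0⟩ : ∃ w, f0.1 w ≠ 0 := by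
    by_contra hc; push Not at hc; exact hf00 (Subtype.ext (LinearMap.ext hc))
  set E2 : Submodule ℂ (W →ₗ[ℂ] V) := E1.map (Submodule.subtype _) with hE2
  have hE2le : E2 ≤ HomR σ (ρ.comp N.subtype) := by
    rintro _ ⟨f, hf, rfl⟩; exact f.2
  let V1 : Submodule ℂ V := span ℂ {v | ∃ g, ∃ f ∈ E1, ∃ w, v = ρ g (f.1 w)}
  have hV1 : V1 = ⊤ := by
    refine (hρ.2 V1 ?_).resolve_left ?_
    · intro g v hv
      induction hv using span_induction with
      | mem x hx =>
        obtain ⟨g', f, hf, w, rfl⟩ := hx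
        exact subset_span ⟨g * g', f, hf, w, by simp⟩
      | zero => simp
      | add x y _ _ hx hy => rw [map_add]; exact V1.add_mem hx hy
      | smul c x _ hx => rw [map_smul]; exact V1.smul_mem c hx
    · intro hb
      apply hw0
      have : f0.1 w0 ∈ V1 := subset_span ⟨1, f0, hf0, w0, by simp⟩
      rw [hb] at this
      simpa using this
  have key : ∀ v : V, epsR σ (ρ.comp N.subtype) v ∈ LinearMap.range (evR σ (ρ.comp N.subtype) E2) := by
    intro v
    have hv : v ∈ V1 := by rw [hV1]; trivial
    induction hv using span_induction with
    | mem x hx =>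
      obtain ⟨g, f, hf, w, rfl⟩ := hx
      by_cases hg : g⁻¹ ∈ inertR N σ
      · have := eps_mem_T h f.2 hg w
        rw [inv_inv] at this
        rw [this]
        obtain ⟨γ, hγ⟩ := ha _ ((inertR N σ).inv_mem hg)
        rw [inv_inv] at hγ
        refine ⟨b γ w ⊗ₜ ⟨(multR ρ a b hb γ f).1, ⟨_, hE1 γ f hf, rfl⟩⟩, ?_⟩
        simp only [evR_tmul, multR_apply, hγ, ← Module.End.mul_apply (b _) (b _), ← map_mul]
        simp
      · have := eps_not_mem_T h f.2 hg w
        rw [inv_inv] at this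
        rw [this]; exact Submodule.zero_mem _
    | zero => simp
    | add x y _ _ hx hy => rw [map_add]; exact Submodule.add_mem _ hx hy
    | smul c x _ hx => rw [map_smul]; exact smul_mem _ c hx
  have hle : LinearMap.range (evR σ (ρ.comp N.subtype) (HomR σ (ρ.comp N.subtype)))
      ≤ LinearMap.range (evR σ (ρ.comp N.subtype) E2) := by
    rintro _ ⟨z, rfl⟩
    induction z using TensorProduct.induction_on with
    | zero => simp
    | tmul w e => rw [evR_tmul, ← eps_fix h e.2 w]; exact key _
    | add x y hx hy => rw [map_add]; exact Submodule.add_mem _ hx hy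
  have h5 := Submodule.finrank_mono hle
  rw [finrank_range_of_inj (evR_inj h _ _ le_rfl),
    finrank_range_of_inj (evR_inj h _ _ hE2le), finrank_tensorProduct,
    finrank_tensorProduct] at h5
  have := h.1
  have h6 := Nat.le_of_mul_le_mul_left h5 finrank_pos
  rw [hE2, finrank_map_subtype_eq] at h6
  exact eq_top_of_finrank_eq (le_antisymm (finrank_le _) h6)

lemma exists_coind {G Γ Y : Type} [Group G] [Fintype G] [Group Γ] [Fintype Γ] [AddCommGroup Y]
    [Module ℂ Y] [FiniteDimensional ℂ Y] [Nontrivial Y] (a : Γ →* G) (τ : Γ →* EC Y)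
    (hk : ∀ γ, a γ = 1 → τ γ = 1) :
    ∃ (V : Type) (_ : AddCommGroup V) (_ : Module ℂ V) (_ : FiniteDimensional ℂ V)
      (ρ : G →* EC V) (f : V →ₗ[ℂ] Y), IrrR ρ ∧ f ≠ 0 ∧
      ∀ γ v, f (ρ (a γ) v) = τ γ (f v) := by
  classical
  let X : Submodule ℂ (G → Y) :=
    { carrier := {F | ∀ γ g, F (a γ * g) = τ γ (F g)}
      add_mem' := by intro x y hx hy γ g; simp [hx γ g, hy γ g]
      zero_mem' := by intro γ g; simp
      smul_mem' := by intro c x hx γ g; simp [hx γ g] }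
  let ρX : G →* EC X :=
    { toFun := fun h =>
        { toFun := fun F => ⟨fun g => F.1 (g * h), by
            intro γ g; have := F.2 γ (g * h); simpa [mul_assoc] using this⟩
          map_add' := by intro x y; rfl
          map_smul' := by intro c x; rfl }
      map_one' := by ext F g; simp
      map_mul' := by intro x y; ext F g; simp [mul_assoc] }
  obtain ⟨y, hy⟩ := exists_ne (0 : Y)
  have hnt : Nontrivial X := by
    let F : G → Y := fun g => ∑ γ : Γ, if a γ * g = 1 then τ γ⁻¹ y else 0
    have hF : F ∈ X := by
      intro γ g
      simp only [F, map_sum]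
      rw [← Equiv.sum_comp (Equiv.mulRight γ⁻¹)]
      refine sum_congr rfl fun δ _ => ?_
      by_cases h1 : a δ * g = 1 <;> simp [h1]
    have hF1 : F 1 ≠ 0 := by
      have : F 1 = ((univ.filter fun γ : Γ => a γ = 1).card : ℂ) • y := by
        simp only [F, mul_one]
        rw [← sum_filter, sum_congr rfl (g := fun _ => y), sum_const,
          cast_smul_eq_nsmul]
        intro γ hγ
        rw [mem_filter] at hγ
        rw [hk γ⁻¹ (by simp [hγ.2])]; rfl
      rw [this]
      refine smul_ne_zero ?_ hy
      rw [Nat.cast_ne_zero]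
      exact Finset.card_ne_zero.2 ⟨1, by simp⟩
    exact ⟨⟨⟨F, hF⟩, 0, fun h0 => hF1 (by rw [Subtype.mk_eq_mk.1 h0]; rfl)⟩⟩
  obtain ⟨P, hP, τP, hτ, hirr⟩ := exists_irr_sub ρX
  refine ⟨P, inferInstance, inferInstance, inferInstance, τP,
    (LinearMap.proj 1 ∘ₗ X.subtype) ∘ₗ P.subtype, hirr, ?_, ?_⟩
  · intro h0
    have := hirr.1
    obtain ⟨F, hF⟩ := exists_ne (0 : P)
    apply hF
    ext g
    have h1 := LinearMap.congr_fun h0 (τP g F)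
    simp only [LinearMap.comp_apply, subtype_apply, hτ] at h1
    simpa [ρX] using h1
  · intro γ F
    simp only [LinearMap.comp_apply, subtype_apply, hτ]
    have := F.1.2 γ 1
    simpa [ρX] using this
end Cliff

section DFT

noncomputable def zt (c : ℕ) : ℂ := Complex.exp (2 * Real.pi * Complex.I / c)

lemma zt_prim {c : ℕ} (hc : c ≠ 0) : IsPrimitiveRoot (zt c) c := isPrimitiveRoot_exp c hc

lemma zt_norm (c : ℕ) (hc : c ≠ 0) : ‖zt c‖ = 1 :=
  (zt_prim hc).norm'_eq_one hc

lemma zt_conj {c : ℕ} (hc : c ≠ 0) (j : ℕ) : (starRingEnd ℂ) (zt c ^ j) = (zt c ^ j)⁻¹ := by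
  rw [Complex.inv_eq_conj]
  rw [norm_pow, zt_norm c hc, one_pow]

lemma zt_orth {c : ℕ} (hc : c ≠ 0) {a b : ℕ} (ha : a < c) (hb : b < c) :
    ∑ j ∈ Finset.range c, (zt c ^ a) ^ j * ((zt c ^ b) ^ j)⁻¹ = if a = b then (c : ℂ) else 0 := by
  have hz := (zt_prim hc).ne_zero hc
  split_ifs with h
  · subst h
    rw [sum_congr rfl (g := fun _ => 1)]
    · simp
    · intro j _; exact mul_inv_cancel₀ (pow_ne_zero _ (pow_ne_zero _ hz))
  · set x := zt c ^ a * (zt c ^ b)⁻¹ with hx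
    have h1 : x ≠ 1 := by
      intro h1
      rw [hx, mul_inv_eq_one₀ (pow_ne_zero _ hz)] at h1
      exact h ((zt_prim hc).pow_inj ha hb h1)
    have h2 : x ^ c = 1 := by
      rw [hx, mul_pow, inv_pow, ← pow_mul, ← pow_mul, mul_comm a, mul_comm b, pow_mul, pow_mul,
        (zt_prim hc).pow_eq_one]; simp
    have h3 := mul_geom_sum x c
    rw [h2, sub_self, mul_eq_zero] at h3
    have h4 := h3.resolve_left (sub_ne_zero.2 h1)
    rw [← h4]
    refine sum_congr rfl fun j _ => ?_
    rw [hx, mul_pow, inv_pow]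

lemma dft_trace {V : Type*} [AddCommGroup V] [Module ℂ V] [FiniteDimensional ℂ V]
    (A : EC V) {c : ℕ} (hc : c ≠ 0) (hA : A ^ c = 1) :
    ∃ m : ℕ → ℕ, ∀ j, LinearMap.trace ℂ V (A ^ j) = ∑ i ∈ Finset.range c, (m i : ℂ) * (zt c ^ i) ^ j := by
  have hz := (zt_prim hc).ne_zero hc
  have hcc : (c : ℂ) ≠ 0 := by exact_mod_cast hc
  let P : ℕ → EC V := fun i => (c : ℂ)⁻¹ • ∑ j ∈ Finset.range c, ((zt c ^ i) ^ j)⁻¹ • A ^ j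
  have hzc : ∀ i, (zt c ^ i) ^ c = 1 := fun i => by
    rw [← pow_mul, mul_comm, pow_mul, (zt_prim hc).pow_eq_one, one_pow]
  have hAP : ∀ i, A * P i = (zt c ^ i) • P i := by
    intro i
    have h1 : ∀ j, ((zt c ^ i) ^ j)⁻¹ • (A * A ^ j) = (zt c ^ i) • ((zt c ^ i) ^ (j+1))⁻¹ • A ^ (j+1) := by
      intro j
      rw [smul_smul, pow_succ' A, pow_succ (zt c ^ i)]
      congr 1
      field_simp
    have e1 := Finset.sum_range_succ' (fun j => ((zt c ^ i) ^ j)⁻¹ • A ^ j) c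
    have e2 := sum_range_succ (fun j => ((zt c ^ i) ^ j)⁻¹ • A ^ j) c
    rw [e1] at e2
    simp only [hzc, hA, pow_zero] at e2
    simp only [P]
    rw [mul_smul_comm, mul_sum, smul_comm (zt c ^ i), ← add_right_cancel e2, smul_sum]
    rw [← smul_sum]
    congr 1
    rw [smul_sum]
    exact sum_congr rfl fun j _ => by rw [mul_smul_comm, h1]
  have hAPj : ∀ i j, A ^ j * P i = (zt c ^ i) ^ j • P i := by
    intro i j
    induction j with
    | zero => simp
    | succ j ih => rw [pow_succ', mul_assoc, ih, mul_smul_comm, hAP, smul_smul, pow_succ]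
  have hPP : ∀ i, P i * P i = P i := by
    intro i
    conv_lhs => enter [1]; simp only [P]
    rw [smul_mul_assoc, sum_mul]
    simp only [smul_mul_assoc, hAPj, smul_smul]
    rw [sum_congr rfl (g := fun _ => P i)]
    · rw [sum_const, card_range, ← cast_smul_eq_nsmul ℂ, smul_smul,
        inv_mul_cancel₀ hcc, one_smul]
    · intro j _; rw [inv_mul_cancel₀ (pow_ne_zero _ (pow_ne_zero _ hz)), one_smul]
  have hsum : ∑ i ∈ Finset.range c, P i = 1 := by
    simp only [P]
    rw [← smul_sum, sum_comm]
    have : ∀ j ∈ Finset.range c, ∑ i ∈ Finset.range c, ((zt c ^ i) ^ j)⁻¹ • A ^ j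
        = (if 0 = j then (c : ℂ) else 0) • A ^ j := by
      intro j hj
      rw [← sum_smul, ← zt_orth hc (Nat.pos_of_ne_zero hc) (mem_range.1 hj)]
      congr 1
      refine sum_congr rfl fun i _ => ?_
      simp [← pow_mul, mul_comm]
    rw [sum_congr rfl this, Finset.sum_eq_single_of_mem 0 (by simp; omega)]
    · simp [smul_smul, hcc]
    · intro j _ hj; simp [hj.symm]
  refine ⟨fun i => finrank ℂ (LinearMap.range (P i)), fun j => ?_⟩
  have hA' : A ^ j = ∑ i ∈ Finset.range c, (zt c ^ i) ^ j • P i := by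
    rw [← mul_one (A ^ j), ← hsum, mul_sum]
    exact sum_congr rfl fun i _ => hAPj i j
  rw [hA', map_sum]
  refine sum_congr rfl fun i _ => ?_
  rw [map_smul, smul_eq_mul, mul_comm]
  congr 1
  have hp : IsProj (LinearMap.range (P i)) (P i) := by
    refine ⟨fun v => ⟨v, rfl⟩, ?_⟩
    rintro _ ⟨v, rfl⟩
    exact LinearMap.congr_fun (hPP i) v
  exact hp.trace

lemma parseval {c : ℕ} (hc : c ≠ 0) (m : ℕ → ℕ) :
    ∑ j ∈ Finset.range c, ‖∑ i ∈ Finset.range c, (m i : ℂ) * (zt c ^ i) ^ j‖ ^ 2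
      = c * ∑ i ∈ Finset.range c, (m i : ℝ) ^ 2 := by
  rw [← Complex.ofReal_inj]
  push_cast
  have h1 : ∀ j, ((‖∑ i ∈ Finset.range c, (m i : ℂ) * (zt c ^ i) ^ j‖ : ℂ)) ^ 2
      = ∑ a ∈ Finset.range c, ∑ b ∈ Finset.range c, (m a : ℂ) * m b * ((zt c ^ a) ^ j * ((zt c ^ b) ^ j)⁻¹) := by
    intro j
    rw [← mul_conj', map_sum, sum_mul_sum]
    refine sum_congr rfl fun a _ => sum_congr rfl fun b _ => ?_
    rw [map_mul, ← pow_mul, ← pow_mul, zt_conj hc, conj_natCast]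
    ring
  simp only [h1]
  rw [sum_comm, mul_sum]
  refine sum_congr rfl fun a ha => ?_
  rw [sum_comm]
  simp only [← mul_sum]
  rw [sum_congr rfl (g := fun b => if a = b then (m a : ℂ) * m a * c else 0)]
  · rw [Finset.sum_ite_eq, if_pos ha]; ring
  · intro b hb
    rw [zt_orth hc (mem_range.1 ha) (mem_range.1 hb)]
    split_ifs with h
    · rw [h]
    · simp

end DFT

section Chars
variable {G V : Type*} [Group G] [Finite G] [AddCommGroup V] [Module ℂ V] [FiniteDimensional ℂ V]

lemma rep_pow_card (ρ : G →* EC V) (g : G) : ρ g ^ NC G = 1 := by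
  rw [← map_pow, pow_card_eq_one', map_one]

lemma tr_inv_conj (ρ : G →* EC V) (g : G) :
    LinearMap.trace ℂ V (ρ g⁻¹) = (starRingEnd ℂ) (LinearMap.trace ℂ V (ρ g)) := by
  have hc : NC G ≠ 0 := Nat.card_pos.ne'
  obtain ⟨m, hm⟩ := dft_trace (ρ g) hc (rep_pow_card ρ g)
  have h1 := hm 1
  have h2 := hm (NC G - 1)
  have h3 : ρ g ^ (NC G - 1) = ρ g⁻¹ := by
    rw [← map_pow]
    congr 1
    rw [eq_inv_iff_mul_eq_one, ← pow_succ, Nat.sub_add_cancel (Nat.pos_of_ne_zero hc), pow_card_eq_one']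
  rw [h3] at h2
  rw [pow_one] at h1
  rw [h1, h2, map_sum]
  refine sum_congr rfl fun i _ => ?_
  rw [map_mul, conj_natCast, pow_one, zt_conj hc]
  congr 1
  have hz := (zt_prim hc).ne_zero hc
  refine eq_inv_of_mul_eq_one_left ?_
  rw [← pow_succ, Nat.sub_add_cancel (Nat.pos_of_ne_zero hc),
    ← pow_mul, mul_comm, pow_mul, (zt_prim hc).pow_eq_one, one_pow]

lemma tr_mul_inv (ρ : G →* EC V) (g : G) :
    LinearMap.trace ℂ V (ρ g) * LinearMap.trace ℂ V (ρ g⁻¹) = ((‖LinearMap.trace ℂ V (ρ g)‖ ^ 2 : ℝ) : ℂ) := by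
  rw [tr_inv_conj, mul_conj']; push_cast; rfl

lemma tr_integral (ρ : G →* EC V) (g : G) : IsIntegral ℤ (LinearMap.trace ℂ V (ρ g)) := by
  have hc : NC G ≠ 0 := Nat.card_pos.ne'
  obtain ⟨m, hm⟩ := dft_trace (ρ g) hc (rep_pow_card ρ g)
  have h1 := hm 1
  rw [pow_one] at h1
  rw [h1]
  refine IsIntegral.sum _ fun i _ => ?_
  have h2 : IsIntegral ℤ (zt (NC G)) := (zt_prim hc).isIntegral (Nat.pos_of_ne_zero hc)
  have h3 : IsIntegral ℤ ((m i : ℕ) : ℂ) := by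
    have := isIntegral_algebraMap (R := ℤ) (A := ℂ) (x := (m i : ℤ))
    simpa using this
  exact h3.mul ((h2.pow _).pow _)
end Chars

section ClifEx
variable {G Γ W E : Type} [Group G] [Fintype G] (N : Subgroup G) [hN : N.Normal]
  [Fintype N] [Group Γ] [Fintype Γ] [AddCommGroup W] [Module ℂ W] [FiniteDimensional ℂ W]
  [AddCommGroup E] [Module ℂ E] [FiniteDimensional ℂ E]

lemma clif_exists {σ : N →* EC W} (h : IrrR σ) (a : Γ →* G) (b : Γ →* EC W)
    (hb : ∀ γ n w, b γ (σ n w) = σ (cjN N (a γ) n) (b γ w))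
    (ha : ∀ g ∈ inertR N σ, ∃ γ, a γ = g) (i : N → Γ) (hai : ∀ n, a (i n) = n)
    (hbi : ∀ n, b (i n) = σ n) (τ : Γ →* EC E) (hτ : IrrR τ) (hτi : ∀ n, τ (i n) = 1)
    (hk : ∀ γ, a γ = 1 → TensorProduct.map (b γ) (τ γ) = 1) :
    (inertR N σ).index * finrank ℂ W * finrank ℂ E ∈ charDegrees G := by
  classical
  have := h.1
  have := hτ.1
  let T : Γ →* EC (W ⊗[ℂ] E) :=
    { toFun := fun γ => TensorProduct.map (b γ) (τ γ)
      map_one' := by simp only [map_one]; exact TensorProduct.map_one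
      map_mul' := fun x y => by simp only [map_mul]; exact TensorProduct.map_mul _ _ _ _ }
  have : Nontrivial (W ⊗[ℂ] E) := by
    apply nontrivial_of_finrank_pos (R := ℂ)
    rw [finrank_tensorProduct]
    exact Nat.mul_pos finrank_pos finrank_pos
  obtain ⟨V, _, _, _, ρ, F, hρ, hF0, hF⟩ := exists_coind a T hk
  have hFn : ∀ (n : N) v, F (ρ n v) = TensorProduct.map (σ n) LinearMap.id (F v) := by
    intro n v
    rw [← hai n, hF]
    change TensorProduct.map (b (i n)) (τ (i n)) _ = _
    rw [hbi, hτi]; rfl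
  let T1 : N →* EC (W ⊗[ℂ] E) :=
    { toFun := fun n => TensorProduct.map (σ n) 1
      map_one' := by simp only [map_one]; exact TensorProduct.map_one
      map_mul' := fun x y => by
        rw [map_mul, ← TensorProduct.map_mul]; simp }
  have hFmem : F ∈ HomR (ρ.comp N.subtype) T1 := fun n v => hFn n v
  have heps1 : epsR σ T1 = 1 := by
    have h1 := eps_self h
    apply ext'
    intro w e
    have h2 : epsR σ T1 (w ⊗ₜ e) = (epsR σ σ w) ⊗ₜ e := by
      simp only [epsR, LinearMap.smul_apply, LinearMap.sum_apply]
      rw [← smul_tmul', sum_tmul]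
      simp only [← smul_tmul']
      rfl
    rw [h2, h1]; rfl
  obtain ⟨f0, hf0⟩ : ∃ f : HomR σ (ρ.comp N.subtype), F ∘ₗ f.1 ≠ 0 := by
    by_contra hc
    push Not at hc
    apply hF0
    ext v
    have h1 := eps_comm σ (ρ.comp N.subtype) T1 F hFmem v
    rw [heps1, Module.End.one_apply] at h1
    rw [h1]
    obtain ⟨z, hz⟩ := eps_mem σ (ρ.comp N.subtype) v
    rw [← hz]
    have : F ∘ₗ evR σ (ρ.comp N.subtype) (HomR σ (ρ.comp N.subtype)) = 0 := by
      apply ext'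
      intro w f
      exact LinearMap.congr_fun (hc f) w
    exact LinearMap.congr_fun this z
  obtain ⟨w1, hw1⟩ := exists_ne (0 : W)
  obtain ⟨φ, hφ⟩ : ∃ φ : W →ₗ[ℂ] ℂ, φ w1 = 1 := by
    obtain ⟨f, hf⟩ : ∃ f : Module.Dual ℂ W, f w1 ≠ 0 := by
      by_contra hc
      push Not at hc
      exact hw1 ((Module.forall_dual_apply_eq_zero_iff ℂ w1).1 hc)
    exact ⟨(f w1)⁻¹ • f, by simp [hf]⟩
  let Θ : HomR σ (ρ.comp N.subtype) →ₗ[ℂ] E :=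
    { toFun := fun f => lid ℂ E (TensorProduct.map φ LinearMap.id (F (f.1 w1)))
      map_add' := by intro x y; simp
      map_smul' := by intro x y; simp }
  have hΘ : ∀ (f : HomR σ (ρ.comp N.subtype)) w, F (f.1 w) = w ⊗ₜ Θ f := by
    intro f w
    have h1 : ∀ Y : EC W, F (f.1 (Y w1)) = TensorProduct.map Y LinearMap.id (F (f.1 w1)) := by
      intro Y
      have hY : Y ∈ span ℂ (Set.range σ) := by rw [h.span]; trivial
      induction hY using span_induction with
      | mem x hx =>
        obtain ⟨n, rfl⟩ := hx
        rw [f.2 n w1]; exact hFn n _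
      | zero => simp
      | add x y _ _ hx hy => simp [map_add_left, hx, hy]
      | smul c x _ hx => simp [map_smul_left, hx]
    have h2 := h1 (φ.smulRight w)
    rw [tens_rank_one] at h2
    simp only [smulRight_apply, hφ, one_smul] at h2
    exact h2
  have hE : HomR σ (ρ.comp N.subtype) ≠ ⊥ := by
    intro hc
    apply hf0
    have h1 : f0.1 = 0 := (Submodule.mem_bot ℂ).1 (hc ▸ f0.2)
    rw [h1]; simp
  have hirr := mult_irr h hρ a b hb ha hE
  have hcomm : ∀ γ f, Θ (multR ρ a b hb γ f) = τ γ (Θ f) := by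
    intro γ f
    have h1 := hΘ (multR ρ a b hb γ f) w1
    rw [multR_apply, hF, hΘ f] at h1
    change TensorProduct.map (b γ) (τ γ) _ = _ at h1
    rw [TensorProduct.map_tmul, ← Module.End.mul_apply, ← map_mul] at h1
    simp only [mul_inv_cancel, map_one, Module.End.one_apply] at h1
    have h2 := congrArg (fun z => lid ℂ E (TensorProduct.map φ LinearMap.id z)) h1
    simp [hφ] at h2
    exact h2.symm
  rcases hirr.hom_zero_or_bij hτ Θ hcomm with h0 | hbij
  · exfalso
    apply hf0
    ext w
    simp [hΘ, h0]
  · have h1 := (ofBijective Θ hbij).finrank_eq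
    rw [← h1, ← cliff_dim h hρ hE]
    exact charDegrees_of_irrR ρ hρ

lemma hom_ne_bot {V : Type} [AddCommGroup V] [Module ℂ V] [FiniteDimensional ℂ V]
    {σ : N →* EC W} (ρ : N →* EC V) (h : epsR σ ρ ≠ 0) : HomR σ ρ ≠ ⊥ := by
  intro hc
  apply h
  ext v
  obtain ⟨z, hz⟩ := eps_mem σ ρ v
  have : evR σ ρ (HomR σ ρ) = 0 := by
    apply ext'
    intro w f
    have h1 : f.1 = 0 := (Submodule.mem_bot ℂ).1 (hc ▸ f.2)
    rw [evR_tmul, h1]; rfl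
  rw [← hz, this]; rfl

lemma deg_up_irr {σ : N →* EC W} (hσ : IrrR σ) :
    ∃ n ∈ charDegrees G, (inertR N σ).index * finrank ℂ W ∣ n := by
  have := hσ.1
  obtain ⟨V, _, _, _, ρ, F, hρ, hF0, hF⟩ := exists_coind N.subtype σ (by
    intro γ hγ
    have : γ = 1 := Subtype.ext hγ
    rw [this, map_one])
  refine ⟨_, charDegrees_of_irrR ρ hρ, ?_⟩
  have hE : HomR σ (ρ.comp N.subtype) ≠ ⊥ := by
    apply hom_ne_bot
    intro hc
    apply hF0
    ext v
    have h1 := eps_comm σ (ρ.comp N.subtype) σ F (fun n v => hF n v) v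
    rw [eps_self hσ, hc] at h1
    simpa using h1
  rw [cliff_dim hσ hρ hE]
  exact Dvd.intro _ rfl

lemma deg_up {d : ℕ} (hd : d ∈ charDegrees N) : ∃ n ∈ charDegrees G, d ∣ n := by
  obtain ⟨W, _, _, _, σ, hσ, rfl⟩ := irrR_of_charDegrees hd
  obtain ⟨n, hn, h⟩ := deg_up_irr N hσ
  exact ⟨n, hn, (Dvd.intro_left _ rfl).trans h⟩

end ClifEx

section Integ
variable {Γ E : Type} [Group Γ] [Fintype Γ] [AddCommGroup E] [Module ℂ E] [FiniteDimensional ℂ E]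

lemma deg_dvd_index {ρ : Γ →* EC E} (h : IrrR ρ) (Z : Subgroup Γ)
    (hZ : ∀ z ∈ Z, ∃ c : ℂ, ρ z = c • 1) : finrank ℂ E ∣ Z.index := by
  classical
  have := h.1
  have hn := h.finrank_ne
  let f : Γ → EC E := fun g => LinearMap.trace ℂ E (ρ g⁻¹) • ρ g
  have hf : ∀ g, ∀ z ∈ Z, f (g * z) = f g := by
    intro g z hz
    obtain ⟨c, hc⟩ := hZ z hz
    obtain ⟨d, hd⟩ := hZ z⁻¹ (Z.inv_mem hz)
    have hcd : d * c = 1 := by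
      have h1 : ρ z⁻¹ * ρ z = 1 := by rw [← map_mul]; simp
      rw [hc, hd] at h1
      have h2 := congrArg (LinearMap.trace ℂ E) h1
      simp only [smul_mul_smul_comm, mul_one, map_smul, trace_one, smul_eq_mul] at h2
      exact mul_right_cancel₀ hn (by rw [h2, one_mul])
    simp only [f, mul_inv_rev, map_mul, hc, hd]
    simp only [smul_mul_assoc, one_mul, mul_smul_comm, mul_one, map_smul, smul_eq_mul, smul_smul]
    rw [mul_right_comm, hcd, one_mul]
  have h1 : ∑ g, f g = (NC Z : ℂ) • ∑ x : Γ ⧸ Z, f x.out := by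
    have hbij : Bijective (fun y : (Γ ⧸ Z) × Z => y.1.out * (y.2 : Γ)) := by
      constructor
      · rintro ⟨x, z⟩ ⟨x', z'⟩ hxz
        have h1 : (QuotientGroup.mk (x.out * (z : Γ)) : Γ ⧸ Z) = QuotientGroup.mk (x'.out * (z' : Γ)) :=
          congrArg _ hxz
        rw [mk_mul_of_mem _ z.2, mk_mul_of_mem _ z'.2,
          out_eq', out_eq'] at h1
        subst h1
        have := mul_left_cancel hxz
        exact Prod.ext rfl (Subtype.ext this)
      · intro g
        refine ⟨(QuotientGroup.mk g, ⟨(QuotientGroup.mk g : Γ ⧸ Z).out⁻¹ * g, ?_⟩), by simp⟩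
        rw [← QuotientGroup.eq, out_eq']
    rw [← Fintype.sum_bijective _ hbij (fun y => f (y.1.out * (y.2 : Γ))) f (fun _ => rfl),
      sum_prod_type, smul_sum]
    refine sum_congr rfl fun x _ => ?_
    rw [sum_congr rfl (g := fun _ => f x.out)]
    · rw [sum_const, card_univ, card_eq_fintype_card, cast_smul_eq_nsmul]
    · intro z _
      exact hf _ _ z.2
  have h2 : ∑ g, f g = ((Fintype.card Γ : ℂ) / finrank ℂ E) • 1 := by
    rw [← h.key 1]; simp only [one_mul, f]
  have hZc : (NC Z : ℂ) ≠ 0 := by exact_mod_cast Nat.card_pos.ne'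
  have h3 : ∑ x : Γ ⧸ Z, f x.out = ((Z.index : ℂ) / finrank ℂ E) • 1 := by
    rw [h1] at h2
    apply smul_right_injective _ hZc
    simp only [h2, smul_smul]
    congr 1
    rw [← card_eq_fintype_card, ← Z.index_mul_card]
    push_cast; ring
  let R := integralClosure ℤ ℂ
  let M : Submodule R (EC E) := span R (Set.range ρ)
  have h4 : IsIntegral R ((Z.index : ℂ) / finrank ℂ E) := by
    refine isIntegral_of_smul_mem_submodule M ?_ ?_ _ ?_
    · refine fun hc => ?_
      have h5 : (1 : EC E) ∈ M := subset_span ⟨1, map_one ρ⟩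
      rw [hc, Submodule.mem_bot] at h5
      exact one_ne_zero h5
    · exact Submodule.fg_span (Set.finite_range ρ)
    · intro Y hY
      induction hY using span_induction with
      | mem x hx =>
        obtain ⟨g, rfl⟩ := hx
        rw [← one_mul (ρ g), ← smul_mul_assoc, ← h3, sum_mul]
        refine Submodule.sum_mem _ fun x _ => ?_
        simp only [f, smul_mul_assoc, ← map_mul]
        exact M.smul_mem (⟨_, tr_integral ρ (x.out)⁻¹⟩ : R) (subset_span ⟨_, rfl⟩)
      | zero => simp
      | add x y _ _ hx hy => rw [smul_add]; exact M.add_mem hx hy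
      | smul c x _ hx => rw [smul_comm]; exact M.smul_mem _ hx
  have h5 : IsIntegral ℤ ((Z.index : ℂ) / finrank ℂ E) := isIntegral_trans _ h4
  have h6 : ((Z.index : ℂ) / finrank ℂ E)
      = algebraMap ℚ ℂ ((Z.index : ℚ) / finrank ℂ E) := by simp
  rw [h6, isIntegral_algebraMap_iff (algebraMap ℚ ℂ).injective] at h5
  obtain ⟨y, hy⟩ := (IsIntegrallyClosed.isIntegral_iff (R := ℤ)).1 h5
  have hn' : (finrank ℂ E : ℚ) ≠ 0 := by exact_mod_cast finrank_pos.ne'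
  rw [eq_div_iff hn'] at hy
  have h7 : y * (finrank ℂ E : ℤ) = Z.index := by
    have : ((y * (finrank ℂ E : ℤ) : ℤ) : ℚ) = ((Z.index : ℤ) : ℚ) := by
      push_cast; simpa using hy
    exact_mod_cast this
  exact Int.natCast_dvd_natCast.1 (Dvd.intro_left _ h7)

end Integ

section Gam
variable {G W : Type} [Group G] [Fintype G] (N : Subgroup G) [hN : N.Normal]
  [Fintype N] [AddCommGroup W] [Module ℂ W] [FiniteDimensional ℂ W]

lemma le_inertR (σ : N →* EC W) : N ≤ inertR N σ := by
  intro n hn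
  refine ⟨LinearMap.GeneralLinearGroup.toLinearEquiv (σ.toHomUnits ⟨n, hn⟩), fun m w => ?_⟩
  change σ ⟨n, hn⟩ (σ m w) = σ _ (σ ⟨n, hn⟩ w)
  simp only [← Module.End.mul_apply, ← map_mul]
  congr 2
  ext; simp

def gamSub (σ : N →* EC W) : Subgroup (G × (EC W)ˣ) where
  carrier := {x | (∀ n, (x.2 : EC W) * σ n = σ (cjN N x.1 n) * x.2) ∧
    det (x.2 : EC W) ^ Fintype.card N = 1}
  one_mem' := ⟨fun n => by simp [cjN_one], by simp⟩
  mul_mem' := by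
    rintro x y ⟨hx, hx'⟩ ⟨hy, hy'⟩
    refine ⟨fun n => ?_, ?_⟩
    · simp only [Prod.fst_mul, Prod.snd_mul, val_mul, cjN_mul, mul_assoc, hy]
      rw [← mul_assoc, hx, mul_assoc]
    · simp only [Prod.snd_mul, val_mul, map_mul, mul_pow, hx', hy', mul_one]
  inv_mem' := by
    rintro x ⟨hx, hx'⟩
    refine ⟨fun n => ?_, ?_⟩
    · have := hx (cjN N x.1⁻¹ n)
      rw [cjN_inv] at this
      simp only [Prod.fst_inv, Prod.snd_inv]
      rw [Units.inv_mul_eq_iff_eq_mul, ← mul_assoc, Units.eq_mul_inv_iff_mul_eq, this]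
    · have h1 : det ((x.2⁻¹ : (EC W)ˣ) : EC W) *
          det (x.2 : EC W) = 1 := by
        rw [← map_mul]; simp
      have h2 := congrArg (· ^ Fintype.card N) h1
      simpa [mul_pow, hx'] using h2

lemma exists_Gamma {σ : N →* EC W} (h : IrrR σ) :
    ∃ (Γ : Type) (_ : Group Γ) (_ : Fintype Γ) (a : Γ →* G) (b : Γ →* EC W) (i : N →* Γ),
      (∀ γ n w, b γ (σ n w) = σ (cjN N (a γ) n) (b γ w)) ∧ (∀ g, g ∈ inertR N σ ↔ ∃ γ, a γ = g) ∧
      (∀ n, a (i n) = n) ∧ (∀ n, b (i n) = σ n) ∧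
      (∀ γ, a γ = 1 → ∃ c : ℂ, b γ = c • 1) := by
  classical
  have := h.1
  have hsc : ∀ γ ∈ gamSub N σ, γ.1 = 1 → ∃ c : ℂ, (γ.2 : EC W) = c • 1 := by
    rintro γ ⟨h1, h2⟩ h3
    refine h.scalar _ fun n => ?_
    rw [h1, h3, cjN_one]
  have hfin : Finite (gamSub N σ) := by
    let f : gamSub N σ →* G := (fst G _).comp (gamSub N σ).subtype
    have h1 : Finite (gamSub N σ ⧸ f.ker) := Finite.of_injective _ (QuotientGroup.kerLift_injective f)
    have h2 : Finite f.ker := by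
      have hm : 0 < finrank ℂ W * Fintype.card N :=
        Nat.mul_pos finrank_pos Fintype.card_pos
      have : NeZero (finrank ℂ W * Fintype.card N) := ⟨hm.ne'⟩
      choose c hc using fun x : f.ker => hsc x.1.1 x.1.2 x.2
      have hc1 : ∀ x, c x ^ (finrank ℂ W * Fintype.card N) = 1 := by
        intro x
        have := x.1.2.2
        rw [hc, det_smul, map_one, mul_one, ← pow_mul] at this
        exact this
      have hcf : Finite {z : ℂ | z ^ (finrank ℂ W * Fintype.card N) = 1} := by
        have : {z : ℂ | z ^ (finrank ℂ W * Fintype.card N) = 1} ⊆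
            ↑(Polynomial.nthRoots (finrank ℂ W * Fintype.card N) (1 : ℂ)).toFinset := by
          intro z hz
          simp only [mem_coe, Multiset.mem_toFinset]
          exact (Polynomial.mem_nthRoots hm).2 hz
        exact (Finset.finite_toSet _).subset this
      refine Finite.of_injective (fun x => (⟨c x, hc1 x⟩ : {z : ℂ | z ^ (finrank ℂ W * Fintype.card N) = 1})) ?_
      intro x y hxy
      have hxy' : c x = c y := congrArg Subtype.val hxy
      apply Subtype.ext; apply Subtype.ext
      refine Prod.ext ?_ (Units.ext ?_)
      · exact (x.2 : x.1.1.1 = 1).trans (y.2 : y.1.1.1 = 1).symm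
      · rw [hc, hc, hxy']
    exact Finite.of_equiv _ (Subgroup.groupEquivQuotientProdSubgroup (s := f.ker)).symm
  refine ⟨gamSub N σ, inferInstance, ofFinite _, (fst G _).comp (gamSub N σ).subtype,
    (Units.coeHom _).comp ((MonoidHom.snd G _).comp (gamSub N σ).subtype),
    (N.subtype.prod σ.toHomUnits).codRestrict _ ?_, ?_, ?_, ?_, ?_, ?_⟩
  · intro n
    refine ⟨fun m => ?_, ?_⟩
    · change σ n * σ m = σ _ * σ n
      simp only [← map_mul]
      congr 1
      ext; simp
    · change det (σ n) ^ _ = 1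
      rw [← map_pow, ← map_pow, pow_card_eq_one, map_one, map_one]
  · intro γ n w
    exact LinearMap.congr_fun (γ.2.1 n) w
  · intro g
    constructor
    · rintro ⟨A, hA⟩
      have hd : det (A : W →ₗ[ℂ] W) ≠ 0 := (LinearEquiv.isUnit_det' A).ne_zero
      have hm : 0 < finrank ℂ W * Fintype.card N :=
        Nat.mul_pos finrank_pos Fintype.card_pos
      obtain ⟨c, hc⟩ := IsAlgClosed.exists_pow_nat_eq ((det (A : W →ₗ[ℂ] W))⁻¹ ^ Fintype.card N) hm
      have hc0 : c ≠ 0 := by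
        rintro rfl
        rw [zero_pow hm.ne'] at hc
        exact pow_ne_zero _ (inv_ne_zero hd) hc.symm
      refine ⟨⟨(g, LinearMap.GeneralLinearGroup.ofLinearEquiv (A.trans (LinearEquiv.smulOfNeZero ℂ W c hc0))), ?_, ?_⟩, rfl⟩
      · intro n
        ext w
        change c • A (σ n w) = σ (cjN N g n) (c • A w)
        rw [hA, map_smul]
      · change det (c • (A : W →ₗ[ℂ] W)) ^ _ = 1
        rw [det_smul, mul_pow, ← pow_mul, hc, ← mul_pow, inv_mul_cancel₀ hd, one_pow]
    · rintro ⟨γ, rfl⟩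
      exact ⟨LinearMap.GeneralLinearGroup.toLinearEquiv γ.1.2, fun n w => LinearMap.congr_fun (γ.2.1 n) w⟩
  · intro n; rfl
  · intro n; rfl
  · intro γ hγ; exact hsc _ γ.2 hγ

lemma F2 {n r : ℕ} (hr : r.Prime) (hri : ¬ r ∣ N.index) (hn : n ∈ charDegrees G) (hrn : r ∣ n) :
    ∃ d ∈ charDegrees N, r ∣ d := by
  classical
  obtain ⟨V, _, _, _, ρ, hρ, rfl⟩ := irrR_of_charDegrees hn
  have := hρ.1
  obtain ⟨P, hP, σ, hσ, hirr⟩ := exists_irr_sub (ρ.comp N.subtype)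
  obtain ⟨Γ, _, _, a, b, i, hb, hT, hai, hbi, hsc⟩ := exists_Gamma N hirr
  have hE : HomR σ (ρ.comp N.subtype) ≠ ⊥ := by
    intro hc
    have h1 : P.subtype ∈ HomR σ (ρ.comp N.subtype) := fun n v => hσ n v
    rw [hc, Submodule.mem_bot] at h1
    have := hirr.1
    obtain ⟨v, hv⟩ := exists_ne (0 : P)
    exact hv (Subtype.ext (LinearMap.congr_fun h1 v))
  have h1 := cliff_dim hirr hρ hE
  have h2 := mult_irr hirr hρ a b hb (fun g hg => (hT g).1 hg) hE
  have h3 := deg_dvd_index h2 (N.comap a) (by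
    intro z hz
    let m : N := ⟨a z, hz⟩
    have h4 : a (z * i m⁻¹) = 1 := by rw [map_mul, hai]; simp [m]
    obtain ⟨c, hc⟩ := hsc _ (show a (i m * z⁻¹) = 1 by rw [map_mul, hai, map_inv]; simp [m])
    refine ⟨c, ?_⟩
    ext f w
    rw [multR_apply]
    have h5 : b z⁻¹ w = c • σ m⁻¹ w := by
      have : b (z⁻¹) = b (i m⁻¹) * b (i m * z⁻¹) := by
        rw [← map_mul, map_inv i]; group
      rw [this, hc, hbi]; simp
    rw [h5, map_smul, map_smul, f.2]
    have h6 : ρ (a z) (ρ ((m⁻¹ : N) : G) (f.1 w)) = f.1 w := by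
      rw [← Module.End.mul_apply, ← map_mul]; simp [m]
    change c • ρ (a z) (ρ ((m⁻¹ : N) : G) (f.1 w)) = c • f.1 w
    rw [h6])
  rw [Subgroup.index_comap] at h3
  have h4 : a.range = inertR N σ := by ext g; rw [hT g]; rfl
  rw [h4] at h3
  have h5 := relIndex_mul_index (le_inertR N σ)
  refine ⟨_, charDegrees_of_irrR σ hirr, ?_⟩
  rw [h1] at hrn
  rcases (Nat.Prime.dvd_mul hr).1 hrn with h6 | h6
  · rcases (Nat.Prime.dvd_mul hr).1 h6 with h7 | h7
    · exact absurd (h7.trans (Dvd.intro_left _ h5)) hri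
    · exact h7
  · exact absurd ((h6.trans h3).trans (Dvd.intro _ h5)) hri

end Gam

lemma wedd (Γ : Type) [Group Γ] [Fintype Γ] [DecidableEq Γ] :
    ∃ (m : ℕ) (d : Fin m → ℕ) (ρ : ∀ i, Γ →* EC (Fin (d i) → ℂ)), (∀ i, IrrR (ρ i)) ∧
      ∀ g h, ∑ i, LinearMap.trace ℂ _ (ρ i g) * LinearMap.trace ℂ _ (ρ i h)
        = ((univ.filter fun x => g * x * h = x).card : ℂ) := by
  classical
  have : FiniteDimensional ℂ (MonoidAlgebra ℂ Γ) :=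
    Module.Finite.of_basis (basis Γ ℂ)
  obtain ⟨m, d, hd, ⟨e⟩⟩ := IsSemisimpleRing.exists_algEquiv_pi_matrix_of_isAlgClosed ℂ (MonoidAlgebra ℂ Γ)
  let pr : ∀ i, MonoidAlgebra ℂ Γ →ₐ[ℂ] EC (Fin (d i) → ℂ) := fun i =>
    (toLinAlgEquiv' : Matrix (Fin (d i)) (Fin (d i)) ℂ ≃ₐ[ℂ] _).toAlgHom.comp
      ((Pi.evalAlgHom ℂ _ i).comp e.toAlgHom)
  have hpr : ∀ i, Surjective (pr i) := by
    intro i Y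
    refine ⟨e.symm (Pi.single i (toLinAlgEquiv'.symm Y)), ?_⟩
    simp [pr]
  refine ⟨m, d, fun i => (pr i).toMonoidHom.comp (MonoidAlgebra.of ℂ Γ), ?_, ?_⟩
  · intro i
    have := hd i
    refine irrR_of_span _ ?_
    rw [eq_top_iff]
    intro Y _
    obtain ⟨x, rfl⟩ := hpr i Y
    induction x using MonoidAlgebra.induction_on with
    | of g => exact subset_span ⟨g, rfl⟩
    | add x y hx hy => rw [map_add]; exact Submodule.add_mem _ (hx trivial) (hy trivial)
    | smul c x hx => rw [map_smul]; exact smul_mem _ _ (hx trivial)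
  · intro g h
    let L : EC (MonoidAlgebra ℂ Γ) :=
      LinearMap.mulLeft ℂ (MonoidAlgebra.of ℂ Γ g) ∘ₗ LinearMap.mulRight ℂ (MonoidAlgebra.of ℂ Γ h)
    have h1 : LinearMap.trace ℂ _ L = ((univ.filter fun x => g * x * h = x).card : ℂ) := by
      rw [trace_eq_sum_coord (basis Γ ℂ), card_filter]
      push_cast
      refine sum_congr rfl fun x _ => ?_
      have h2 : L (basis Γ ℂ x) = MonoidAlgebra.single (g * x * h) 1 := by
        simp [L, MonoidAlgebra.single_mul_single, mul_assoc]
      rw [h2]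
      change (MonoidAlgebra.single (g * x * h) (1 : ℂ)).coeff x = _
      rw [MonoidAlgebra.coeff_single, Finsupp.single_apply]
    rw [← h1, ← LinearMap.trace_conj' L e.toLinearEquiv,
      trace_eq_sum_coord (Pi.basis fun i => stdBasis ℂ (Fin (d i)) (Fin (d i))),
      Fintype.sum_sigma]
    refine sum_congr rfl fun i _ => ?_
    rw [sum_prod_type]
    have h2 : ∀ g, LinearMap.trace ℂ _ ((pr i).toMonoidHom.comp (MonoidAlgebra.of ℂ Γ) g)
        = ∑ j, e (MonoidAlgebra.of ℂ Γ g) i j j := by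
      intro g
      change LinearMap.trace ℂ _ (Matrix.toLin' (e (MonoidAlgebra.of ℂ Γ g) i)) = _
      rw [Matrix.trace_toLin'_eq]; rfl
    rw [h2, h2, sum_mul_sum]
    refine sum_congr rfl fun j _ => sum_congr rfl fun j' _ => ?_
    have h3 : (e.toLinearEquiv.conj L) ((Pi.basis fun i => stdBasis ℂ (Fin (d i)) (Fin (d i))) ⟨i, (j, j')⟩)
        i = e (MonoidAlgebra.of ℂ Γ g) i * (Matrix.single j j' 1 * e (MonoidAlgebra.of ℂ Γ h) i) := by
      rw [LinearEquiv.conj_apply_apply, Pi.basis_apply, Matrix.stdBasis_eq_single]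
      simp [L]
    rw [Basis.coord_apply, Pi.basis_repr, h3]
    symm
    change ((e (MonoidAlgebra.of ℂ Γ g) i * (Matrix.single j j' 1 * e (MonoidAlgebra.of ℂ Γ h) i) :
      Matrix (Fin (d i)) (Fin (d i)) ℂ)) j j' = _
    rw [Matrix.mul_apply, sum_eq_single j]
    · simp
    · intro l _ hl; simp [hl]
    · simp

section FamS
variable {Γ S : Type} [Group Γ] [Fintype Γ] [Group S]

structure Fam (π : Γ →* S) where
  ι : Type
  fin : Fintype ι
  n : ι → ℕ
  ρ : ∀ i, Γ →* EC (Fin (n i) → ℂ)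
  irr : ∀ i, IrrR (ρ i)
  ν : Γ → ℂ
  ν1 : ν 1 = 1
  scal : ∀ z, π z = 1 → ∀ i, ρ i z = ν z • 1
  orth : ∀ g h, ∑ i, LinearMap.trace ℂ _ (ρ i g) * LinearMap.trace ℂ _ (ρ i h⁻¹)
    = (NC π.ker : ℂ)⁻¹ * ∑ x, open Classical in
      if π (x⁻¹ * g * x) = π h then ν (h⁻¹ * (x⁻¹ * g * x)) else 0

attribute [instance] Fam.fin

lemma exists_fam (π : Γ →* S) (ν : Γ → ℂ) (h1 : ν 1 = 1)
    (hm : ∀ z w, π z = 1 → π w = 1 → ν (z * w) = ν z * ν w)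
    (hc : ∀ g z, π z = 1 → ν (g * z * g⁻¹) = ν z) : ∃ F : Fam π, F.ν = ν := by
  classical
  obtain ⟨m, d, ρ, hirr, horth⟩ := wedd Γ
  let Z := univ.filter fun z : Γ => π z = 1
  have hZc : (NC π.ker : ℂ) ≠ 0 := by exact_mod_cast Nat.card_pos.ne'
  have hZ : (Z.card : ℂ) = NC π.ker := by
    norm_cast
    rw [card_eq_fintype_card, Fintype.card_subtype]
    congr 1
    ext x; simp [Z, MonoidHom.mem_ker]
  have hinv : ∀ z, π z = 1 → ν z⁻¹ * ν z = 1 := by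
    intro z hz
    rw [← hm _ _ (by simp [hz]) hz]; simpa using h1
  let e : ∀ i, EC (Fin (d i) → ℂ) := fun i => ∑ z ∈ Z, ν z⁻¹ • ρ i z
  have hez : ∀ i z, π z = 1 → e i * ρ i z = ν z • e i := by
    intro i z hz
    simp only [e, sum_mul, smul_sum]
    refine sum_bij' (fun w _ => w * z) (fun w _ => w * z⁻¹) ?_ ?_ ?_ ?_ ?_
    · intro w hw; simpa [Z, hz] using hw
    · intro w hw; simpa [Z, hz] using hw
    · intro w _; simp
    · intro w _; simp
    · intro w hw
      have hw' : π w = 1 := by simpa [Z] using hw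
      rw [mul_inv_rev, hm _ _ (by simp [hz]) (by simp [hw']), smul_smul, ← mul_assoc, mul_comm (ν z),
        hinv z hz, one_mul, smul_mul_assoc, map_mul]
  have hecomm : ∀ i g, e i * ρ i g = ρ i g * e i := by
    intro i g
    simp only [e, sum_mul, mul_sum]
    refine sum_bij' (fun w _ => g⁻¹ * w * g) (fun w _ => g * w * g⁻¹) ?_ ?_ ?_ ?_ ?_
    · intro w hw
      have hw' : π w = 1 := by simpa [Z] using hw
      simp [Z, hw']
    · intro w hw
      have hw' : π w = 1 := by simpa [Z] using hw
      simp [Z, hw']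
    · intro w _; group
    · intro w _; group
    · intro w hw
      have hw' : π w = 1 := by simpa [Z] using hw
      have h3 := hc g⁻¹ w⁻¹ (by simp [hw'])
      have h4 : (g⁻¹ * w * g)⁻¹ = g⁻¹ * w⁻¹ * g⁻¹⁻¹ := by group
      rw [h4, h3, smul_mul_assoc, mul_smul_comm, ← map_mul, ← map_mul]
      group
  have hdich : ∀ i, (e i = 0) ∨ ((∀ z, π z = 1 → ρ i z = ν z • 1) ∧ e i = (NC π.ker : ℂ) • 1) := by
    intro i
    obtain ⟨c, hc'⟩ := (hirr i).scalar _ (hecomm i)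
    by_cases h0 : c = 0
    · left; rw [hc', h0, zero_smul]
    right
    have h3 : ∀ z, π z = 1 → ρ i z = ν z • 1 := by
      intro z hz
      have := hez i z hz
      rw [hc', smul_mul_assoc, one_mul, smul_comm] at this
      exact smul_right_injective _ h0 this
    refine ⟨h3, ?_⟩
    simp only [e]
    rw [sum_congr rfl (g := fun _ => (1 : EC (Fin (d i) → ℂ)))]
    · rw [sum_const, ← hZ, cast_smul_eq_nsmul]
    · intro z hz
      have hz' : π z = 1 := by simpa [Z] using hz
      rw [h3 z hz', smul_smul, hinv z hz', one_smul]
  refine ⟨⟨{i // e i ≠ 0}, inferInstance, fun i => d i, fun i => ρ i, fun i => hirr i, ν, h1,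
    fun z hz i => ((hdich i).resolve_left i.2).1 z hz, ?_⟩, rfl⟩
  intro g h
  have h3 : ∑ i, LinearMap.trace ℂ _ (ρ i g) * LinearMap.trace ℂ _ (e i * ρ i h⁻¹) =
      ∑ z ∈ Z, ν z⁻¹ * ((univ.filter fun x => g * x * (z * h⁻¹) = x).card : ℂ) := by
    simp only [← horth, mul_sum]
    rw [sum_comm]
    refine sum_congr rfl fun i _ => ?_
    simp only [e, sum_mul, map_sum, mul_sum, smul_mul_assoc, map_smul, smul_eq_mul, map_mul]
    refine sum_congr rfl fun z _ => ?_
    ring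
  have h4 : ∑ i, LinearMap.trace ℂ _ (ρ i g) * LinearMap.trace ℂ _ (e i * ρ i h⁻¹) =
      (NC π.ker : ℂ) * ∑ i : {i // e i ≠ 0}, LinearMap.trace ℂ _ (ρ i g) * LinearMap.trace ℂ _ (ρ i h⁻¹) := by
    rw [mul_sum, ← Finset.sum_subtype (univ.filter fun i => e i ≠ 0) (by simp)
      (fun i => (NC π.ker : ℂ) * (LinearMap.trace ℂ _ (ρ i g) * LinearMap.trace ℂ _ (ρ i h⁻¹))),
      sum_filter]
    refine sum_congr rfl fun i _ => ?_
    split_ifs with h5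
    · rw [((hdich i).resolve_left h5).2, smul_mul_assoc, one_mul, map_smul, smul_eq_mul]; ring
    · push Not at h5; rw [h5]; simp
  rw [eq_inv_mul_iff_mul_eq₀ hZc]
  refine h4.symm.trans (h3.trans ?_)
  simp only [card_filter, Nat.cast_sum, mul_sum]
  rw [sum_comm]
  refine sum_congr rfl fun x _ => ?_
  have h6 : ∀ z, g * x * (z * h⁻¹) = x ↔ z = x⁻¹ * g⁻¹ * x * h := by
    intro z
    constructor
    · intro h7
      have : z = x⁻¹ * g⁻¹ * (g * x * (z * h⁻¹)) * h := by group
      rw [this, h7]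
    · rintro rfl; group
  simp only [h6]
  split_ifs with h7
  · rw [sum_eq_single (x⁻¹ * g⁻¹ * x * h)]
    · simp [mul_assoc]
    · intro b _ hb; simp [hb]
    · intro hb
      exfalso; apply hb
      have : π (x⁻¹ * g⁻¹ * x * h) = (π (x⁻¹ * g * x))⁻¹ * π h := by simp [mul_assoc]
      simp [Z, this, h7]
  · refine sum_eq_zero fun z hz => ?_
    have hz' : π z = 1 := by simpa [Z] using hz
    rw [if_neg]; · simp
    rintro rfl
    apply h7
    have : π (x⁻¹ * g⁻¹ * x * h) = (π (x⁻¹ * g * x))⁻¹ * π h := by simp [mul_assoc]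
    rw [this, inv_mul_eq_one] at hz'
    exact hz'
end FamS

lemma var_bound (s : Finset ℕ) (f : ℕ → ℕ) :
    (0 : ℤ) ≤ s.card * ∑ i ∈ s, (f i : ℤ) ^ 2 - (∑ i ∈ s, (f i : ℤ)) ^ 2 ∧
    ((s.card : ℤ) - 1 ≤ s.card * ∑ i ∈ s, (f i : ℤ) ^ 2 - (∑ i ∈ s, (f i : ℤ)) ^ 2 ∨
      s.card ∣ ∑ i ∈ s, f i) := by
  classical
  constructor
  · have := sq_sum_le_card_mul_sum_sq (s := s) (f := fun i => (f i : ℤ))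
    linarith
  by_cases hs : ∃ x ∈ s, ∃ y ∈ s, f x ≠ f y
  · left
    obtain ⟨x, hx, y, hy, hxy⟩ := hs
    obtain ⟨v, hv⟩ : ∃ v : ℤ, v = (f x : ℤ) := ⟨_, rfl⟩
    let U := s.filter fun i => (f i : ℤ) - v ≠ 0
    have h1 : s.card * ∑ i ∈ s, (f i : ℤ) ^ 2 - (∑ i ∈ s, (f i : ℤ)) ^ 2
        = s.card * ∑ i ∈ s, ((f i : ℤ) - v) ^ 2 - (∑ i ∈ s, ((f i : ℤ) - v)) ^ 2 := by
      simp only [sub_sq, sum_add_distrib, sum_sub_distrib, sum_const,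
        ← sum_mul, ← mul_sum, nsmul_eq_mul]
      ring
    have h2 : ∑ i ∈ s, ((f i : ℤ) - v) ^ 2 = ∑ i ∈ U, ((f i : ℤ) - v) ^ 2 := by
      rw [sum_filter_of_ne]
      intro i _ h h'; simp [h'] at h
    have h3 : ∑ i ∈ s, ((f i : ℤ) - v) = ∑ i ∈ U, ((f i : ℤ) - v) := by
      rw [sum_filter_of_ne]
      intro i _ h; exact h
    have h4 := sq_sum_le_card_mul_sum_sq (s := U) (f := fun i => (f i : ℤ) - v)
    have h5 : (U.card : ℤ) ≤ ∑ i ∈ U, ((f i : ℤ) - v) ^ 2 := by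
      have : ∑ i ∈ U, (1 : ℤ) ≤ ∑ i ∈ U, ((f i : ℤ) - v) ^ 2 := by
        refine sum_le_sum fun i hi => ?_
        have h6 := (mem_filter.1 hi).2
        have : 0 < ((f i : ℤ) - v) ^ 2 := by positivity
        linarith
      simpa using this
    have h6 : U.card + 1 ≤ s.card := by
      have : U ⊂ s := by
        refine Finset.filter_ssubset.2 ⟨x, hx, by simp [hv]⟩
      exact Finset.card_lt_card this
    have h7 : 1 ≤ U.card := by
      refine Finset.card_pos.2 ⟨y, mem_filter.2 ⟨hy, ?_⟩⟩
      rw [sub_ne_zero, hv]; exact_mod_cast hxy.symm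
    rw [h1, h2, h3]
    have h6' : (U.card : ℤ) + 1 ≤ s.card := by exact_mod_cast h6
    have h7' : (1 : ℤ) ≤ U.card := by exact_mod_cast h7
    nlinarith
  · right
    push Not at hs
    rcases s.eq_empty_or_nonempty with rfl | ⟨x, hx⟩
    · simp
    · rw [sum_congr rfl (g := fun _ => f x) (fun i hi => hs i hi x hx)]
      simp

namespace Fam
variable {Γ S : Type} [Group Γ] [Fintype Γ] [Group S] {π : Γ →* S} (F : Fam π)

noncomputable def χ (i : F.ι) (g : Γ) : ℂ := LinearMap.trace ℂ _ (F.ρ i g)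

def Good (g : Γ) : Prop := ∀ x, Commute (π g) (π x) → F.ν (g⁻¹ * (x⁻¹ * g * x)) = 1

lemma npos (i : F.ι) : F.n i ≠ 0 := by
  have := (F.irr i).1
  intro h0
  have h1 : finrank ℂ (Fin (F.n i) → ℂ) = 0 := by simpa using h0
  exact finrank_pos.ne' h1

lemma χ_one (i : F.ι) : F.χ i 1 = F.n i := by
  rw [χ, map_one, trace_one]; simp

lemma smul_one_inj (i : F.ι) {c d : ℂ} (h : c • (1 : EC (Fin (F.n i) → ℂ)) = d • 1) : c = d := by
  have := (F.irr i).1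
  have h1 := congrFun (LinearMap.congr_fun h (fun _ => 1)) ⟨0, Nat.pos_of_ne_zero (F.npos i)⟩
  simpa using h1

lemma ker_mem {g x : Γ} (h : Commute (π g) (π x)) : π (g⁻¹ * (x⁻¹ * g * x)) = 1 := by
  simp only [map_mul, map_inv]
  rw [mul_assoc (π x)⁻¹, h.eq]; group

lemma ρ_swap {g x : Γ} (h : Commute (π g) (π x)) (i : F.ι) :
    F.ρ i g * F.ρ i x = F.ν (g⁻¹ * (x⁻¹ * g * x)) • (F.ρ i x * F.ρ i g) := by
  have : g * x = x * g * (g⁻¹ * (x⁻¹ * g * x)) := by group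
  rw [← map_mul, this, map_mul, F.scal _ (ker_mem h), map_mul]; simp

lemma ρ_inv_mul (i : F.ι) (g : Γ) : F.ρ i g⁻¹ * F.ρ i g = 1 := by
  rw [← map_mul]; simp

lemma ν_of_commute {g x : Γ} (h : Commute (π g) (π x)) (i : F.ι)
    (hc : F.ρ i g * F.ρ i x = F.ρ i x * F.ρ i g) : F.ν (g⁻¹ * (x⁻¹ * g * x)) = 1 := by
  have h1 := F.ρ_swap h i
  rw [hc] at h1
  have h2 := congrArg (fun y => F.ρ i g⁻¹ * (F.ρ i x⁻¹ * y)) h1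
  simp only [mul_smul_comm] at h2
  rw [← mul_assoc (F.ρ i x⁻¹), ρ_inv_mul, one_mul, ρ_inv_mul] at h2
  refine (F.smul_one_inj i ?_)
  rw [← h2, one_smul]

lemma χ_conj (i : F.ι) (g x : Γ) : F.χ i (x⁻¹ * g * x) = F.χ i g := by
  rw [χ, χ, map_mul, trace_mul_comm, ← map_mul]; group

lemma χ_mul_ker (i : F.ι) (g z : Γ) (hz : π z = 1) : F.χ i (g * z) = F.ν z * F.χ i g := by
  rw [χ, map_mul, F.scal z hz, mul_smul_comm, mul_one, map_smul, smul_eq_mul, χ]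

lemma ν_norm [Nonempty F.ι] {z : Γ} (hz : π z = 1) : ‖F.ν z‖ = 1 := by
  obtain ⟨i⟩ := ‹Nonempty F.ι›
  have h1 := rep_pow_card (F.ρ i) z
  rw [F.scal z hz, smul_pow, one_pow] at h1
  have h2 : F.ν z ^ NC Γ = 1 := F.smul_one_inj i (by rw [h1, one_smul])
  exact Complex.norm_eq_one_of_pow_eq_one h2 Nat.card_pos.ne'

lemma bad {g : Γ} (h : ¬ F.Good g) (i : F.ι) : F.χ i g = 0 := by
  rw [Good] at h; push Not at h
  obtain ⟨x, hx, hν⟩ := h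
  have h1 : x⁻¹ * g * x = g * (g⁻¹ * (x⁻¹ * g * x)) := by group
  have h2 := F.χ_conj i g x
  rw [h1, F.χ_mul_ker i _ _ (ker_mem hx)] at h2
  by_contra h0
  exact hν (mul_right_cancel₀ h0 (by rw [h2, one_mul]))

lemma orth' (g h : Γ) (hc : ∀ x, π (x⁻¹ * g * x) ≠ π h) : ∑ i, F.χ i g * F.χ i h⁻¹ = 0 := by
  have := F.orth g h
  simp only [χ, this]
  rw [sum_eq_zero, mul_zero]
  intro x _; rw [if_neg (hc x)]

lemma card_cent (C : Subgroup S) (hC : C ≤ π.range) :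
    NC (C.comap π) = NC π.ker * NC C := by
  let f : C.comap π →* C := (π.comp (C.comap π).subtype).codRestrict C (fun x => x.2)
  have hf : Surjective f := by
    rintro ⟨y, hy⟩
    obtain ⟨x, rfl⟩ := hC hy
    exact ⟨⟨x, hy⟩, rfl⟩
  have h1 := f.ker.card_eq_card_quotient_mul_card_subgroup
  have h2 : NC (C.comap π ⧸ f.ker) = NC C :=
    Nat.card_congr (quotientKerEquivOfSurjective f hf).toEquiv
  have h3 : NC f.ker = NC π.ker := by
    refine Nat.card_congr ⟨fun x => ⟨x.1.1, congrArg Subtype.val x.2⟩,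
      fun x => ⟨⟨x.1, by rw [mem_comap, x.2]; exact C.one_mem⟩, Subtype.ext x.2⟩, ?_, ?_⟩
    · intro x; rfl
    · intro x; rfl
  rw [h1, h2, h3, mul_comm]

def cen (π : Γ →* S) (s : S) : Subgroup S := Subgroup.centralizer {s} ⊓ π.range

lemma norm_sum {g : Γ} (h : F.Good g) : ∑ i, ‖F.χ i g‖ ^ 2 = NC (cen π (π g)) := by
  classical
  have h1 := F.orth g g
  have h2 : ∀ i, LinearMap.trace ℂ _ (F.ρ i g) * LinearMap.trace ℂ _ (F.ρ i g⁻¹) = ((‖F.χ i g‖ ^ 2 : ℝ) : ℂ) :=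
    fun i => tr_mul_inv (F.ρ i) g
  simp only [h2] at h1
  have h3 : (∑ x, if π (x⁻¹ * g * x) = π g then F.ν (g⁻¹ * (x⁻¹ * g * x)) else 0)
      = (NC ((cen π (π g)).comap π) : ℂ) := by
    rw [card_eq_fintype_card, Fintype.card_subtype, card_filter]
    push_cast
    refine sum_congr rfl fun x _ => ?_
    have h4 : π (x⁻¹ * g * x) = π g ↔ Commute (π g) (π x) := by
      rw [map_mul, map_mul, map_inv, commute_iff_eq, mul_assoc, inv_mul_eq_iff_eq_mul]
    have h5 : x ∈ (cen π (π g)).comap π ↔ Commute (π g) (π x) := by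
      rw [mem_comap, cen, Subgroup.mem_inf, mem_centralizer_singleton_iff]
      exact ⟨fun h => h.1.symm, fun h => ⟨h.symm, x, rfl⟩⟩
    simp only [h4, h5]
    split_ifs with h6
    · exact h x h6
    · rfl
  rw [card_cent (cen π (π g)) inf_le_right] at h3
  have hZc : (NC π.ker : ℂ) ≠ 0 := by exact_mod_cast Nat.card_pos.ne'
  have h6 : ((∑ i, ‖F.χ i g‖ ^ 2 : ℝ) : ℂ) = ((NC (cen π (π g)) : ℝ) : ℂ) := by
    push_cast
    push_cast at h1 h3
    rw [h1]
    refine Eq.trans ?_ (inv_mul_cancel_left₀ hZc _)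
    rw [← h3]
  exact_mod_cast h6

lemma good_one : F.Good 1 := by
  intro x _; simpa using F.ν1

instance [Finite S] : Nonempty F.ι := by
  have h := F.norm_sum F.good_one
  by_contra hc
  rw [not_nonempty_iff] at hc
  rw [Finset.univ_eq_empty, Finset.sum_empty] at h
  have : NC (cen π (π 1)) ≠ 0 := Nat.card_pos.ne'
  exact this (by exact_mod_cast h.symm)

lemma lemK [Finite S] {κ : Type} [Fintype κ] (g : κ → Γ) (hg : ∀ a, F.Good (g a))
    (hne : ∀ a b, a ≠ b → ∀ x, π (x⁻¹ * g a * x) ≠ π (g b)) : Fintype.card κ ≤ Fintype.card F.ι := by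
  classical
  let v : κ → (F.ι → ℂ) := fun a i => F.χ i (g a)
  have hv : LinearIndependent ℂ v := by
    rw [Fintype.linearIndependent_iff]
    intro c hc b
    have h1 : ∑ i, (∑ a, c a * F.χ i (g a)) * F.χ i (g b)⁻¹ = 0 := by
      refine sum_eq_zero fun i _ => ?_
      have := congrFun hc i
      simp only [Finset.sum_apply, Pi.smul_apply, smul_eq_mul, Pi.zero_apply, v] at this
      rw [this, zero_mul]
    simp only [sum_mul] at h1
    rw [sum_comm] at h1
    rw [sum_eq_single b] at h1
    · simp only [mul_assoc, ← mul_sum] at h1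
      refine (mul_eq_zero.1 h1).resolve_right ?_
      have h2 : ∀ i, F.χ i (g b) * F.χ i (g b)⁻¹ = ((‖F.χ i (g b)‖ ^ 2 : ℝ) : ℂ) :=
        fun i => tr_mul_inv (F.ρ i) (g b)
      simp only [h2]
      rw [← Complex.ofReal_sum, F.norm_sum (hg b)]
      exact_mod_cast Nat.card_pos.ne'
    · intro a _ hab
      simp only [mul_assoc, ← mul_sum]
      rw [F.orth' _ _ (hne a b hab), mul_zero]
    · simp
  simpa using hv.fintype_card_le_finrank

lemma ρ_of_zpow [Finite S] (w : Γ) {x : Γ} (hx : π x ∈ zpowers (π w)) (i : F.ι) :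
    ∃ (a : ℤ) (c : ℂ), F.ρ i x = c • F.ρ i (w ^ a) := by
  obtain ⟨a, ha⟩ := hx
  refine ⟨a, F.ν (x * (w ^ a)⁻¹), ?_⟩
  have h1 : x = (x * (w ^ a)⁻¹) * w ^ a := by group
  conv_lhs => rw [h1]
  rw [map_mul, F.scal]
  · simp
  · rw [map_mul, map_inv, map_zpow]
    exact mul_inv_eq_one.2 ha.symm

lemma good_of_cyc [Finite S] (w : Γ) {g : Γ}
    (h : ∀ x, Commute (π g) (π x) → π x ∈ zpowers (π w)) : F.Good g := by
  intro x hx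
  obtain ⟨i⟩ : Nonempty F.ι := inferInstance
  obtain ⟨a, c, h1⟩ := F.ρ_of_zpow w (h x hx) i
  obtain ⟨b, d, h2⟩ := F.ρ_of_zpow w (h g (Commute.refl _)) i
  refine F.ν_of_commute hx i ?_
  rw [h1, h2, smul_mul_smul_comm, smul_mul_smul_comm, ← map_mul, ← map_mul, mul_comm c d,
    (Commute.refl w).zpow_zpow b a |>.eq]
end Fam

lemma sum_range_two_mul {R : Type*} [AddCommMonoid R] (f : ℕ → R) (b : ℕ) :
    ∑ i ∈ Finset.range (2 * b), f i = ∑ l ∈ Finset.range b, f (2 * l) + ∑ l ∈ Finset.range b, f (2 * l + 1) := by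
  induction b with
  | zero => simp
  | succ b ih =>
    rw [show 2 * (b + 1) = 2 * b + 1 + 1 by ring, sum_range_succ, sum_range_succ, ih,
      sum_range_succ, sum_range_succ]
    abel

lemma zt_half {b : ℕ} (hb : b ≠ 0) : zt (2 * b) ^ b = -1 := by
  have h := (zt_prim (c := 2 * b) (by omega)).pow (n := 2 * b) (by omega) (a := b) (b := 2) (by ring)
  exact h.eq_neg_one_of_two_right

namespace Fam
variable {Γ S : Type} [Group Γ] [Fintype Γ] [Group S] [Finite S] {π : Γ →* S} (F : Fam π)

lemma dft (i : F.ι) (w : Γ) {c : ℕ} (hc : c ≠ 0) (hw : π w ^ c = 1) :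
    ∃ m : ℕ → ℕ, (∀ j, ‖F.χ i (w ^ j)‖ = ‖∑ l ∈ Finset.range c, (m l : ℂ) * (zt c ^ l) ^ j‖) ∧
      F.n i = ∑ l ∈ Finset.range c, m l := by
  have hk : π (w ^ c) = 1 := by rw [map_pow, hw]
  have hn := F.ν_norm hk
  have hn0 : F.ν (w ^ c) ≠ 0 := by intro h; rw [h] at hn; simp at hn
  obtain ⟨μ, hμ⟩ := IsAlgClosed.exists_pow_nat_eq (F.ν (w ^ c))⁻¹ (Nat.pos_of_ne_zero hc)
  have hμn : ‖μ‖ = 1 := by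
    have h1 : ‖μ‖ ^ c = 1 := by rw [← norm_pow, hμ, norm_inv, hn, inv_one]
    exact (pow_eq_one_iff_of_nonneg (norm_nonneg _) hc).1 h1
  obtain ⟨m, hm⟩ := dft_trace (μ • F.ρ i w) hc (by
    rw [smul_pow, hμ, ← map_pow, F.scal _ hk, smul_smul, inv_mul_cancel₀ hn0, one_smul])
  have hm' : ∀ j, μ ^ j * F.χ i (w ^ j) = ∑ l ∈ Finset.range c, (m l : ℂ) * (zt c ^ l) ^ j := by
    intro j
    rw [← hm, smul_pow, map_smul, smul_eq_mul, χ, map_pow]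
  refine ⟨m, fun j => ?_, ?_⟩
  · rw [← hm', norm_mul, norm_pow, hμn, one_pow, one_mul]
  · have := hm' 0
    rw [pow_zero, pow_zero, χ_one] at this
    simp only [pow_zero, mul_one, one_mul] at this
    exact_mod_cast this

lemma dft_odd (i : F.ι) (w : Γ) {c : ℕ} (hc : c ≠ 0) (hw : π w ^ c = 1) :
    0 ≤ (∑ j ∈ (Finset.range c).erase 0, ‖F.χ i (w ^ j)‖ ^ 2) ∧
    (¬ c ∣ F.n i → (c : ℝ) - 1 ≤ ∑ j ∈ (Finset.range c).erase 0, ‖F.χ i (w ^ j)‖ ^ 2) := by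
  refine ⟨sum_nonneg fun _ _ => by positivity, fun hd => ?_⟩
  obtain ⟨m, hm, hn⟩ := F.dft i w hc hw
  have h1 := parseval hc m
  rw [← add_sum_erase _ _ (mem_range.2 (Nat.pos_of_ne_zero hc))] at h1
  simp only [← hm] at h1
  rw [pow_zero, χ_one] at h1
  have h2 := (var_bound (Finset.range c) m).2
  rw [card_range] at h2
  have h3 := h2.resolve_right (by rw [← hn]; exact hd)
  have h4 : ((c : ℤ) : ℝ) - 1 ≤ c * ∑ i ∈ Finset.range c, (m i : ℝ) ^ 2 - (∑ i ∈ Finset.range c, (m i : ℝ)) ^ 2 := by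
    exact_mod_cast h3
  have h5 : (F.n i : ℝ) = ∑ i ∈ Finset.range c, (m i : ℝ) := by exact_mod_cast hn
  rw [← h1, ← h5] at h4
  simp only [Complex.norm_natCast] at h4
  push_cast at h4
  linarith

lemma dft_even (i : F.ι) (w : Γ) {b : ℕ} (hb : b ≠ 0) (hw : π w ^ (2 * b) = 1) :
    ∃ (A B : ℕ) (D E : ℤ), F.n i = A + B ∧ ‖F.χ i (w ^ b)‖ ^ 2 = ((A : ℝ) - B) ^ 2 ∧ 0 ≤ D ∧ 0 ≤ E ∧
      ((b : ℤ) - 1 ≤ D ∨ b ∣ A) ∧ ((b : ℤ) - 1 ≤ E ∨ b ∣ B) ∧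
      ∑ j ∈ ((Finset.range (2 * b)).erase 0).erase b, ‖F.χ i (w ^ j)‖ ^ 2 = 2 * D + 2 * E := by
  have hc : 2 * b ≠ 0 := by omega
  obtain ⟨m, hm, hn⟩ := F.dft i w hc hw
  have h1 := parseval hc m
  rw [← add_sum_erase _ _ (mem_range.2 (Nat.pos_of_ne_zero hc)),
    ← add_sum_erase _ _ (show b ∈ (Finset.range (2 * b)).erase 0 by
      rw [mem_erase, mem_range]; omega)] at h1
  simp only [← hm] at h1
  rw [pow_zero, χ_one, sum_range_two_mul] at h1
  rw [sum_range_two_mul] at hn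
  have hA := var_bound (Finset.range b) (fun l => m (2 * l))
  have hB := var_bound (Finset.range b) (fun l => m (2 * l + 1))
  rw [card_range] at hA hB
  have h3 : ‖F.χ i (w ^ b)‖ ^ 2 = (((∑ l ∈ Finset.range b, m (2 * l) : ℕ) : ℝ) - (∑ l ∈ Finset.range b, m (2 * l + 1) : ℕ)) ^ 2 := by
    rw [hm, sum_range_two_mul]
    have h4 : ∀ l, (zt (2 * b) ^ l) ^ b = (-1) ^ l := fun l => by rw [← pow_mul, mul_comm l, pow_mul, zt_half hb]
    have h5 : ∀ l, (-1 : ℂ) ^ (2 * l) = 1 := fun l => by rw [pow_mul]; simp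
    have h6 : ∀ l, (-1 : ℂ) ^ (2 * l + 1) = -1 := fun l => by rw [pow_succ, h5]; simp
    simp only [h4, h5, h6, mul_one, mul_neg, Finset.sum_neg_distrib]
    have : (∑ i ∈ Finset.range b, (m (2 * i) : ℂ)) + -∑ i ∈ Finset.range b, (m (2 * i + 1) : ℂ)
      = (((((∑ l ∈ Finset.range b, m (2 * l) : ℕ) : ℝ) - (∑ l ∈ Finset.range b, m (2 * l + 1) : ℕ)) : ℝ) : ℂ) := by
      push_cast; ring
    rw [this, ← sq_abs (_ - _), ← Real.norm_eq_abs, ← Complex.norm_real]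
  refine ⟨_, _, _, _, hn, h3, hA.1, hB.1, hA.2, hB.2, ?_⟩
  rw [h3, hn] at h1
  simp only [Complex.norm_natCast] at h1
  push_cast at h1 ⊢
  linarith

def Tor (π : Γ →* S) (w : Γ) (c : ℕ) : Prop :=
  orderOf (π w) = c ∧ ∀ j x, π w ^ (2 * j) ≠ 1 → Commute (π w ^ j) (π x) → π x ∈ zpowers (π w)

lemma tor_sum {w : Γ} {c : ℕ} (h : Tor π w c) (j : ℕ) (hj : π w ^ (2 * j) ≠ 1) :
    F.Good (w ^ j) ∧ ∑ i, ‖F.χ i (w ^ j)‖ ^ 2 = c := by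
  have hg : F.Good (w ^ j) := F.good_of_cyc w (fun x hx => h.2 j x hj (by rwa [map_pow] at hx))
  refine ⟨hg, ?_⟩
  rw [F.norm_sum hg]
  have : cen π (π (w ^ j)) = zpowers (π w) := by
    apply le_antisymm
    · rintro y ⟨hy, x, rfl⟩
      exact h.2 j x hj (by
        have := mem_centralizer_singleton_iff.1 hy
        rw [map_pow] at this; exact this.symm)
    · rw [zpowers_le]
      refine ⟨mem_centralizer_singleton_iff.2 ?_, w, rfl⟩
      rw [map_pow]; exact (pow_mul_comm' _ _).symm
  rw [this, card_zpowers, h.1]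

lemma tor_pow {w : Γ} {c : ℕ} (h : Tor π w c) (j : ℕ) : π w ^ j = 1 ↔ c ∣ j := by
  rw [← h.1]; exact orderOf_dvd_iff_pow_eq_one.symm

lemma sum_odd {w : Γ} {c : ℕ} (h : Tor π w c) (hc : Odd c) :
    ∑ i, ∑ j ∈ (Finset.range c).erase 0, ‖F.χ i (w ^ j)‖ ^ 2 = (c - 1) * c := by
  rw [sum_comm, sum_congr rfl (g := fun _ => (c : ℝ))]
  · rw [sum_const, card_erase_of_mem (mem_range.2 hc.pos), card_range,
      nsmul_eq_mul, cast_sub hc.pos]; simp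
  · intro j hj
    rw [mem_erase, mem_range] at hj
    refine (F.tor_sum h j ?_).2
    rw [ne_eq, tor_pow h]
    intro h1
    have := (Coprime.dvd_of_dvd_mul_left (coprime_two_right.2 hc) h1)
    exact absurd (le_of_dvd (by omega) this) (by omega)

lemma sum_even {w : Γ} {b : ℕ} (h : Tor π w (2 * b)) (hb : b ≠ 0) :
    ∑ i, ∑ j ∈ ((Finset.range (2 * b)).erase 0).erase b, ‖F.χ i (w ^ j)‖ ^ 2 = (2 * b - 2) * (2 * b) := by
  rw [sum_comm, sum_congr rfl (g := fun _ => (2 * b : ℝ))]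
  · rw [sum_const, card_erase_of_mem (by rw [mem_erase, mem_range]; omega),
      card_erase_of_mem (mem_range.2 (by omega)), card_range,
      nsmul_eq_mul]
    have : 2 * b - 1 - 1 = 2 * (b - 1) := by omega
    rw [this]; push_cast [one_le_iff_ne_zero.2 hb]; ring
  · intro j hj
    rw [mem_erase, mem_erase, mem_range] at hj
    have := (F.tor_sum h j ?_).2
    · rw [this]; push_cast; ring
    rw [ne_eq, tor_pow h]
    intro h1
    have h2 : b ∣ j := dvd_of_mul_dvd_mul_left two_pos h1
    obtain ⟨e, rfl⟩ := h2
    have h3 : e < 2 := by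
      by_contra hh; push Not at hh
      have := Nat.mul_le_mul_left b hh
      omega
    interval_cases e <;> simp at hj

lemma count_le {P : F.ι → Prop} [DecidablePred P] {f : F.ι → ℝ} {t T : ℝ} (h0 : ∀ i, 0 ≤ f i)
    (h1 : ∀ i, P i → t ≤ f i) (hs : ∑ i, f i ≤ T) : ((univ.filter P).card : ℝ) * t ≤ T := by
  refine le_trans ?_ hs
  refine le_trans ?_ (sum_le_sum_of_subset_of_nonneg (filter_subset P _) (fun i _ _ => h0 i))
  rw [← nsmul_eq_mul]
  exact card_nsmul_le_sum _ _ _ (fun i hi => h1 i (mem_filter.1 hi).2)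

open Classical in
lemma up_odd {w : Γ} {c : ℕ} (h : Tor π w c) (hc : Odd c) (h3 : 1 < c) :
    (univ.filter fun i => ¬ c ∣ F.n i).card ≤ c := by
  have hw : π w ^ c = 1 := (tor_pow h c).2 dvd_rfl
  have := F.count_le (P := fun i => ¬ c ∣ F.n i) (fun i => (F.dft_odd i w (by omega) hw).1)
    (fun i => (F.dft_odd i w (by omega) hw).2) (F.sum_odd h hc).le
  have h4 : (0 : ℝ) < c - 1 := by
    have : (1 : ℝ) < c := by exact_mod_cast h3
    linarith
  rw [mul_comm (_ - _)] at this
  exact_mod_cast le_of_mul_le_mul_right this h4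

lemma even_cast {b : ℕ} (h3 : 1 < b) : (0 : ℝ) < 2 * b - 2 := by
  have : (1 : ℝ) < b := by exact_mod_cast h3
  linarith

open Classical in
lemma up_even' {w : Γ} {b : ℕ} (h : Tor π w (2 * b)) (h3 : 1 < b) :
    (univ.filter fun i => ¬ (b ∣ F.n i ∧ (¬ 2 ∣ F.n i → (b : ℝ) ^ 2 ≤ ‖F.χ i (w ^ b)‖ ^ 2))).card ≤ 2 * b := by
  have hw : π w ^ (2 * b) = 1 := (tor_pow h _).2 dvd_rfl
  have := F.count_le (P := fun i => ¬ (b ∣ F.n i ∧ (¬ 2 ∣ F.n i → (b : ℝ) ^ 2 ≤ ‖F.χ i (w ^ b)‖ ^ 2)))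
    (fun i => sum_nonneg fun _ _ => by positivity) (t := 2 * b - 2) (fun i hi => ?_)
      (F.sum_even h (by omega)).le
  · have h4 := even_cast h3
    rw [mul_comm (_ - _)] at this
    exact_mod_cast le_of_mul_le_mul_right this h4
  · obtain ⟨A, B, D, E, hn, ht, hD, hE, hA, hB, hs⟩ := F.dft_even i w (by omega) hw
    rw [hs]
    have hD' : (0 : ℝ) ≤ D := by exact_mod_cast hD
    have hE' : (0 : ℝ) ≤ E := by exact_mod_cast hE
    rcases hA with hA | hA
    · have : (b : ℝ) - 1 ≤ D := by exact_mod_cast hA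
      linarith
    rcases hB with hB | hB
    · have : (b : ℝ) - 1 ≤ E := by exact_mod_cast hB
      linarith
    exfalso; apply hi
    rw [hn, ht]
    refine ⟨dvd_add hA hB, fun h2 => ?_⟩
    obtain ⟨a, rfl⟩ := hA
    obtain ⟨a', rfl⟩ := hB
    have h5 : ((a : ℤ) - a') ≠ 0 := by
      intro h6
      have : a = a' := by omega
      subst this
      exact h2 ⟨b * a, by ring⟩
    have h6 : (1 : ℤ) ≤ ((a : ℤ) - a') ^ 2 := by
      have : 0 < ((a : ℤ) - a') ^ 2 := by positivity
      linarith
    have h7 : (1 : ℝ) ≤ ((a : ℝ) - a') ^ 2 := by exact_mod_cast h6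
    push_cast
    have : ((b : ℝ) * a - b * a') ^ 2 = b ^ 2 * ((a : ℝ) - a') ^ 2 := by ring
    rw [this]
    nlinarith [sq_nonneg (b : ℝ)]

open Classical in
lemma up_bad {w : Γ} {b : ℕ} (h : Tor π w (2 * b)) (h3 : 1 < b) (hb : ¬ F.Good (w ^ b)) :
    (univ.filter fun i => ¬ (2 * b ∣ F.n i)).card ≤ b := by
  have hw : π w ^ (2 * b) = 1 := (tor_pow h _).2 dvd_rfl
  have := F.count_le (P := fun i => ¬ (2 * b ∣ F.n i))
    (fun i => sum_nonneg fun _ _ => by positivity) (t := 2 * (2 * b - 2)) (fun i hi => ?_)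
      (F.sum_even h (by omega)).le
  · have h4 := even_cast h3
    have h5 : ((univ.filter fun i => ¬ (2 * b ∣ F.n i)).card : ℝ) * (2 * b - 2) ≤ b * (2 * b - 2) := by linarith
    exact_mod_cast le_of_mul_le_mul_right h5 h4
  · obtain ⟨A, B, D, E, hn, ht, hD, hE, hA, hB, hs⟩ := F.dft_even i w (by omega) hw
    rw [hs]
    rw [F.bad hb] at ht
    have hAB : A = B := by
      have : ((A : ℝ) - B) = 0 := by
        rw [norm_zero] at ht
        exact pow_eq_zero_iff two_ne_zero |>.1 (by linarith)
      exact_mod_cast sub_eq_zero.1 this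
    subst hAB
    have hd : ¬ b ∣ A := by
      rintro ⟨a, rfl⟩
      exact hi ⟨a, by rw [hn]; ring⟩
    have h1 : (b : ℝ) - 1 ≤ D := by exact_mod_cast hA.resolve_right hd
    have h2 : (b : ℝ) - 1 ≤ E := by exact_mod_cast hB.resolve_right hd
    linarith

end Fam

abbrev SL2 (F : Type) [Field F] := Matrix.SpecialLinearGroup (Fin 2) F

lemma sq1 {F : Type*} [Field F] {x : F} (h : x ^ 2 = 1) : x = 1 ∨ x = -1 :=
  sq_eq_sq_iff_eq_or_eq_neg.1 (by rw [h, one_pow])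

section PSL
variable {F : Type} [Field F]

def mkS : SL2 F →* PSL2 F := mk' _

lemma mkS_surj : Surjective (mkS : SL2 F →* PSL2 F) := QuotientGroup.mk'_surjective _

lemma sl_mul (A B : SL2 F) (i j : Fin 2) : (A * B) i j = A i 0 * B 0 j + A i 1 * B 1 j := by
  simp [Matrix.mul_apply, Fin.sum_univ_two]

lemma sl_det (A : SL2 F) : A 0 0 * A 1 1 - A 0 1 * A 1 0 = 1 := by
  have := A.2; rwa [det_fin_two] at this

lemma sl_neg (A : SL2 F) (i j : Fin 2) : (-A) i j = - A i j := by simp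

lemma sl_ext {A B : SL2 F} (h1 : A 0 0 = B 0 0) (h2 : A 0 1 = B 0 1) (h3 : A 1 0 = B 1 0) (h4 : A 1 1 = B 1 1) :
    A = B := by
  ext i j; fin_cases i <;> fin_cases j <;> assumption

lemma sl_inv (A : SL2 F) : A⁻¹ 0 0 = A 1 1 ∧ A⁻¹ 0 1 = - A 0 1 ∧ A⁻¹ 1 0 = - A 1 0 ∧ A⁻¹ 1 1 = A 0 0 := by
  simp [Matrix.adjugate_fin_two]

lemma mem_cen {A : SL2 F} : A ∈ Subgroup.center (SL2 F) ↔ A = 1 ∨ A = -1 := by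
  rw [Matrix.SpecialLinearGroup.mem_center_iff]
  constructor
  · rintro ⟨r, hr, h⟩
    have h1 : r = 1 ∨ r = -1 := by
      rw [Fintype.card_fin] at hr; exact sq1 hr
    rcases h1 with rfl | rfl
    · left; ext i j; rw [← h]; simp
    · right; ext i j; rw [← h]; fin_cases i <;> fin_cases j <;> simp
  · rintro (rfl | rfl)
    · exact ⟨1, by simp, by simp⟩
    · refine ⟨-1, by simp, ?_⟩
      ext i j; fin_cases i <;> fin_cases j <;> simp

lemma mkS_eq {A B : SL2 F} : mkS A = mkS B ↔ B = A ∨ B = -A := by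
  change (QuotientGroup.mk A : PSL2 F) = QuotientGroup.mk B ↔ _
  rw [QuotientGroup.eq, mem_cen, inv_mul_eq_iff_eq_mul, inv_mul_eq_iff_eq_mul]; simp

lemma mkS_one {A : SL2 F} : mkS A = 1 ↔ A = 1 ∨ A = -1 := by
  rw [← map_one mkS, eq_comm, mkS_eq]

lemma mkS_neg (A : SL2 F) : mkS (-A) = mkS A := mkS_eq.2 (inr (by simp))

def tra (A : SL2 F) : F := A 0 0 + A 1 1

lemma tra_neg (A : SL2 F) : tra (-A) = - tra A := by simp [tra]; ring

lemma tra_conj (A g : SL2 F) : tra (g * A * g⁻¹) = tra A := by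
  obtain ⟨h1, h2, h3, h4⟩ := sl_inv g
  have := sl_det g
  simp only [tra, sl_mul, h1, h2, h3, h4]
  linear_combination (A 0 0 + A 1 1) * this

noncomputable def trsq (s : PSL2 F) : F := tra (Quotient.out s) ^ 2

lemma trsq_mk (A : SL2 F) : trsq (mkS A) = tra A ^ 2 := by
  have h : mkS (Quotient.out (mkS A)) = mkS A := Quotient.out_eq _
  rw [trsq]
  rcases mkS_eq.1 h with h | h
  · rw [← h]
  · conv_rhs => rw [h, tra_neg, neg_sq]

lemma trsq_conj (s g : PSL2 F) : trsq (g * s * g⁻¹) = trsq s := by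
  obtain ⟨A, rfl⟩ := mkS_surj s
  obtain ⟨B, rfl⟩ := mkS_surj g
  rw [← map_inv, ← map_mul, ← map_mul, trsq_mk, trsq_mk, tra_conj]

lemma sl_sq (A : SL2 F) (h : tra A = 0) : A * A = -1 := by
  have h1 : A 1 1 = - A 0 0 := by rw [tra] at h; linear_combination h
  have h2 := sl_det A
  rw [h1] at h2
  apply sl_ext <;> simp only [sl_mul, sl_neg, h1] <;> simp <;> first | ring1 | linear_combination -h2

def cm (g X : SL2 F) (a b : F) : Prop :=
  g 0 0 = a + b * X 0 0 ∧ g 0 1 = b * X 0 1 ∧ g 1 0 = b * X 1 0 ∧ g 1 1 = a + b * X 1 1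

lemma nonscal {X : SL2 F} (hX : tra X ^ 2 ≠ 4) : ¬ (X 0 1 = 0 ∧ X 1 0 = 0 ∧ X 0 0 = X 1 1) := by
  rintro ⟨h1, h2, h3⟩
  apply hX
  have := sl_det X
  rw [h1, h3] at this
  rw [tra, h3]; linear_combination 4 * this

lemma comm_entries {g X : SL2 F} (h : Commute g X) :
    g 0 1 * X 1 0 = X 0 1 * g 1 0 ∧ g 0 0 * X 0 1 + g 0 1 * X 1 1 = X 0 0 * g 0 1 + X 0 1 * g 1 1 ∧
    g 1 0 * X 0 0 + g 1 1 * X 1 0 = X 1 0 * g 0 0 + X 1 1 * g 1 0 := by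
  have h1 : ∀ i j, (g * X) i j = (X * g) i j := fun i j => by rw [h.eq]
  simp only [sl_mul] at h1
  exact ⟨by linear_combination h1 0 0, h1 0 1, h1 1 0⟩

lemma comm_form {g X : SL2 F} (hX : ¬ (X 0 1 = 0 ∧ X 1 0 = 0 ∧ X 0 0 = X 1 1)) (h : Commute g X) :
    ∃ a b, cm g X a b := by
  obtain ⟨h1, h2, h3⟩ := comm_entries h
  by_cases h01 : X 0 1 = 0
  · by_cases h10 : X 1 0 = 0
    · have hd : X 0 0 - X 1 1 ≠ 0 := fun h => hX ⟨h01, h10, sub_eq_zero.1 h⟩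
      refine ⟨g 0 0 - (g 0 0 - g 1 1) / (X 0 0 - X 1 1) * X 0 0, (g 0 0 - g 1 1) / (X 0 0 - X 1 1), by ring, ?_, ?_, ?_⟩
      · rw [h01, mul_zero]
        refine (mul_eq_zero.1 (show g 0 1 * (X 0 0 - X 1 1) = 0 from ?_)).resolve_right hd
        rw [h01] at h2; linear_combination -h2
      · rw [h10, mul_zero]
        refine (mul_eq_zero.1 (show g 1 0 * (X 0 0 - X 1 1) = 0 from ?_)).resolve_right hd
        rw [h10] at h3; linear_combination h3
      · field_simp; ring
    · refine ⟨g 0 0 - g 1 0 / X 1 0 * X 0 0, g 1 0 / X 1 0, by ring, ?_, by field_simp, ?_⟩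
      · field_simp; linear_combination h1
      · field_simp; linear_combination h3
  · refine ⟨g 0 0 - g 0 1 / X 0 1 * X 0 0, g 0 1 / X 0 1, by ring, by field_simp, ?_, ?_⟩
    · field_simp; linear_combination -h1
    · field_simp; linear_combination -h2

lemma cm_uniq {g X : SL2 F} (hX : ¬ (X 0 1 = 0 ∧ X 1 0 = 0 ∧ X 0 0 = X 1 1)) {a b a' b' : F}
    (h : cm g X a b) (h' : cm g X a' b') : a = a' ∧ b = b' := by
  obtain ⟨h1, h2, h3, h4⟩ := h
  obtain ⟨h1', h2', h3', h4'⟩ := h'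
  have hb : b = b' := by
    by_contra hc
    have hc' : b - b' ≠ 0 := sub_ne_zero.2 hc
    refine hX ⟨?_, ?_, ?_⟩
    · refine (mul_eq_zero.1 (show (b - b') * X 0 1 = 0 from ?_)).resolve_left hc'
      linear_combination h2' - h2
    · refine (mul_eq_zero.1 (show (b - b') * X 1 0 = 0 from ?_)).resolve_left hc'
      linear_combination h3' - h3
    · refine sub_eq_zero.1 ((mul_eq_zero.1 (show (b - b') * (X 0 0 - X 1 1) = 0 from ?_)).resolve_left hc')
      linear_combination h1' - h1 - h4' + h4
  subst hb
  exact ⟨by linear_combination h1' - h1, rfl⟩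

lemma cm_mul {g g' X : SL2 F} {a b a' b' : F} (h : cm g X a b) (h' : cm g' X a' b') :
    cm (g * g') X (a * a' - b * b') (a * b' + a' * b + b * b' * tra X) := by
  obtain ⟨h1, h2, h3, h4⟩ := h
  obtain ⟨h1', h2', h3', h4'⟩ := h'
  have := sl_det X
  simp only [cm, sl_mul, h1, h2, h3, h4, h1', h2', h3', h4', tra]
  refine ⟨?_, ?_, ?_, ?_⟩
  · linear_combination (-b * b') * this
  · ring
  · ring
  · linear_combination (-b * b') * this

lemma cm_det {g X : SL2 F} {a b : F} (h : cm g X a b) : a ^ 2 + a * b * tra X + b ^ 2 = 1 := by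
  obtain ⟨h1, h2, h3, h4⟩ := h
  have h5 := sl_det X
  have h6 := sl_det g
  rw [h1, h2, h3, h4] at h6
  rw [tra]; linear_combination h6 - b ^ 2 * h5

lemma cm_comm {g g' X : SL2 F} {a b : F} (h : cm g X a b) (h' : Commute g' X) : Commute g' g := by
  obtain ⟨h1, h2, h3, h4⟩ := h
  obtain ⟨e1, e2, e3⟩ := comm_entries h'
  apply sl_ext <;> simp only [sl_mul, h1, h2, h3, h4]
  · linear_combination b * e1
  · linear_combination b * e2
  · linear_combination b * e3
  · linear_combination -b * e1

lemma torus_hom [Finite F] {X : SL2 F} (hX : tra X ^ 2 ≠ 4) :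
    ∃ φ : Subgroup.centralizer {X} →* AlgebraicClosure F, Function.Injective φ ∧
      (∀ g, algebraMap F (AlgebraicClosure F) (tra g.1) = φ g + φ g⁻¹) ∧
      ((∀ g, φ g ^ (NC F - 1) = 1) ∨ (∀ g, φ g ^ (NC F + 1) = 1)) := by
  classical
  let K := AlgebraicClosure F
  have hns := nonscal hX
  have hex : ∀ g : Subgroup.centralizer {X}, ∃ a b, cm g.1 X a b := fun g =>
    comm_form hns (mem_centralizer_singleton_iff.1 g.2)
  choose a b hab using hex
  let τ : K := algebraMap F K (tra X)
  obtain ⟨e, he⟩ : ∃ e : K, e ^ 2 - τ * e + 1 = 0 := by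
    have h2 : (Polynomial.X ^ 2 - Polynomial.C τ * Polynomial.X + 1 : Polynomial K).degree ≠ 0 := by
      have : (Polynomial.X ^ 2 - Polynomial.C τ * Polynomial.X + 1 : Polynomial K).degree = 2 := by
        compute_degree!
      rw [this]; decide
    obtain ⟨e, he⟩ := IsAlgClosed.exists_root _ h2
    exact ⟨e, by simpa [Polynomial.IsRoot] using he⟩
  have he0 : e ≠ 0 := by rintro rfl; simp at he
  have hi : e * e⁻¹ = 1 := mul_inv_cancel₀ he0
  have hτ : τ = e + e⁻¹ := by linear_combination (-e⁻¹) * he + (e - τ) * hi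
  have hee : e - e⁻¹ ≠ 0 := by
    intro h
    apply hX
    apply (algebraMap F K).injective
    rw [map_pow, map_ofNat]
    change τ ^ 2 = 4
    have : e⁻¹ = e := (sub_eq_zero.1 h).symm
    have h1 : e * e = 1 := by nth_rewrite 2 [← this]; exact mul_inv_cancel₀ he0
    rw [hτ, this]; linear_combination 4 * h1
  let ι := algebraMap F K
  let φ : Subgroup.centralizer {X} →* K :=
    { toFun := fun g => ι (a g) + ι (b g) * e
      map_one' := by
        have : cm (1 : SL2 F) X 1 0 := by simp [cm]
        obtain ⟨h1, h2⟩ := cm_uniq hns (hab 1) this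
        rw [h1, h2]; simp
      map_mul' := by
        intro g g'
        obtain ⟨h1, h2⟩ := cm_uniq hns (hab (g * g')) (cm_mul (hab g) (hab g'))
        rw [h1, h2]
        simp only [map_add, map_sub, map_mul]
        change _ + (_ + ι (b g) * ι (b g') * τ) * e = _
        linear_combination (- ι (b g) * ι (b g')) * he }
  have hφ : ∀ g, φ g = ι (a g) + ι (b g) * e := fun _ => rfl
  have hφi : ∀ g, φ g⁻¹ = ι (a g) + ι (b g) * e⁻¹ := by
    intro g
    have h1 : φ g * (ι (a g) + ι (b g) * e⁻¹) = 1 := by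
      have := congrArg ι (cm_det (hab g))
      simp only [map_add, map_mul, map_pow, map_one] at this
      change _ + _ * τ + _ = _ at this
      rw [hφ, ← this, hτ]; linear_combination (ι (b g)) ^ 2 * hi
    have h2 : φ g⁻¹ * φ g = 1 := by rw [← map_mul]; simp
    calc φ g⁻¹ = φ g⁻¹ * (φ g * (ι (a g) + ι (b g) * e⁻¹)) := by rw [h1, mul_one]
      _ = _ := by rw [← mul_assoc, h2, one_mul]
  refine ⟨φ, ?_, ?_, ?_⟩
  · intro g g' h
    have h1 : φ g⁻¹ = φ g'⁻¹ := by
      have h2 : φ g⁻¹ * φ g = 1 := by rw [← map_mul]; simp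
      have h3 : φ g * φ g'⁻¹ = 1 := by rw [h, ← map_mul]; simp
      calc φ g⁻¹ = φ g⁻¹ * (φ g * φ g'⁻¹) := by rw [h3, mul_one]
        _ = _ := by rw [← mul_assoc, h2, one_mul]
    rw [hφ, hφ] at h
    rw [hφi, hφi] at h1
    have h4 : ι (b g) = ι (b g') := by
      refine sub_eq_zero.1 ((mul_eq_zero.1 (show (ι (b g) - ι (b g')) * (e - e⁻¹) = 0 from ?_)).resolve_right hee)
      linear_combination h - h1
    have h5 : ι (a g) = ι (a g') := by rw [h4] at h; linear_combination h
    have h4' := ι.injective h4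
    have h5' := ι.injective h5
    obtain ⟨e1, e2, e3, e4⟩ := hab g
    obtain ⟨f1, f2, f3, f4⟩ := hab g'
    rw [h4', h5'] at *
    exact Subtype.ext (sl_ext (e1.trans f1.symm) (e2.trans f2.symm) (e3.trans f3.symm) (e4.trans f4.symm))
  · intro g
    obtain ⟨e1, e2, e3, e4⟩ := hab g
    rw [hφ, hφi]
    have : tra g.1 = 2 * a g + b g * tra X := by rw [tra, tra, e1, e4]; ring
    rw [this]
    simp only [map_add, map_mul, map_ofNat]
    change _ + ι (b g) * τ = _
    rw [hτ]; ring
  · have := ofFinite F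
    let Φ := FiniteField.frobeniusAlgHom F K
    have hΦ : ∀ x, Φ x = x ^ NC F := fun x => by rw [card_eq_fintype_card]; rfl
    have hΦι : ∀ x, Φ (ι x) = ι x := fun x => Φ.commutes x
    have h1 : Φ e ^ 2 - τ * Φ e + 1 = 0 := by
      have := congrArg Φ he
      simp only [map_add, map_sub, map_mul, map_pow, map_one, map_zero] at this
      rwa [show Φ τ = τ from hΦι _] at this
    have h2 : Φ e = e ∨ Φ e = e⁻¹ := by
      have : (Φ e - e) * (Φ e - e⁻¹) = 0 := by
        rw [hτ] at h1
        have : e * e⁻¹ = 1 := mul_inv_cancel₀ he0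
        linear_combination h1 + this
      rcases mul_eq_zero.1 this with h | h
      · left; exact sub_eq_zero.1 h
      · right; exact sub_eq_zero.1 h
    have hφ0 : ∀ g, φ g ≠ 0 := fun g h => by
      have : φ g * φ g⁻¹ = 1 := by rw [← map_mul]; simp
      rw [h] at this; simp at this
    have hq : NC F ≠ 0 := Nat.card_pos.ne'
    rcases h2 with h2 | h2
    · left; intro g
      have h3 : φ g ^ NC F = φ g := by
        rw [← hΦ, hφ]; simp only [map_add, map_mul, hΦι, h2]
      refine mul_right_cancel₀ (hφ0 g) ?_
      rw [← pow_succ, Nat.sub_add_cancel (one_le_iff_ne_zero.2 hq), h3, one_mul]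
    · right; intro g
      have h3 : φ g ^ NC F = φ g⁻¹ := by
        rw [← hΦ, hφ, hφi]; simp only [map_add, map_mul, hΦι, h2]
      rw [pow_succ, h3, ← map_mul]; simp

def tor (X : SL2 F) : Subgroup (PSL2 F) := (Subgroup.centralizer {X}).map mkS

lemma mem_tor {X : SL2 F} {h : PSL2 F} : h ∈ tor X ↔ ∃ g, Commute g X ∧ mkS g = h := by
  simp only [tor, Subgroup.mem_map, mem_centralizer_singleton_iff, commute_iff_eq]

lemma tor_self (X : SL2 F) : mkS X ∈ tor X := mem_tor.2 ⟨X, Commute.refl _, rfl⟩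

lemma tor_cyc [Finite F] {X : SL2 F} (hX : tra X ^ 2 ≠ 4) : IsCyclic (tor X) := by
  obtain ⟨φ, hφ, -, -⟩ := torus_hom hX
  have : IsCyclic (Subgroup.centralizer {X}) := isCyclic_of_injective_ringHom φ hφ
  let f : Subgroup.centralizer {X} →* tor X :=
    { toFun := fun g => ⟨mkS g.1, g.1, g.2, rfl⟩
      map_one' := by ext; simp
      map_mul' := by intro a b; ext; simp }
  refine isCyclic_of_surjective f ?_
  rintro ⟨_, g, hg, rfl⟩
  exact ⟨⟨g, hg⟩, rfl⟩

lemma tor_exp [Finite F] (h2 : Odd (NC F)) {X : SL2 F} (hX : tra X ^ 2 ≠ 4) :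
    (∀ h ∈ tor X, h ^ ((NC F - 1) / 2) = 1) ∨ (∀ h ∈ tor X, h ^ ((NC F + 1) / 2) = 1) := by
  obtain ⟨φ, hφ, -, h3⟩ := torus_hom hX
  have key : ∀ m, (∀ g, φ g ^ (2 * m) = 1) → ∀ h ∈ tor X, h ^ m = 1 := by
    rintro m hm _ ⟨g, hg, rfl⟩
    rw [← map_pow, mkS_one]
    let g' : Subgroup.centralizer {X} := ⟨g, hg⟩
    have h1 : φ (g' ^ m) ^ 2 = 1 := by rw [← map_pow, ← pow_mul, mul_comm, map_pow]; exact hm g'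
    have hm1 : (-1 : SL2 F) ∈ Subgroup.centralizer {X} := by
      rw [mem_centralizer_singleton_iff]; simp
    rcases sq1 h1 with h | h
    · left
      have := hφ (h.trans (map_one φ).symm)
      exact congrArg Subtype.val this
    · have h4 : φ ⟨-1, hm1⟩ ^ 2 = 1 := by
        rw [← map_pow, ← map_one φ]; congr 1; ext1; simp
      rcases sq1 h4 with h5 | h5
      · have h6 := congrArg Subtype.val (hφ (h5.trans (map_one φ).symm))
        have h7 : (-1 : SL2 F) = 1 := h6
        have h8 := congrArg (fun A : SL2 F => A 0 0) h7
        simp only [sl_neg] at h8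
        left
        have : (-1 : AlgebraicClosure F) = 1 := by
          have := congrArg (algebraMap F (AlgebraicClosure F)) h8
          simpa using this
        rw [this] at h
        exact congrArg Subtype.val (hφ (h.trans (map_one φ).symm))
      · right
        exact congrArg Subtype.val (hφ (h.trans h5.symm))
  obtain ⟨m, hm⟩ := h2
  rcases h3 with h3 | h3
  · left
    have : NC F - 1 = 2 * ((NC F - 1) / 2) := by omega
    exact key _ (by rw [← this]; exact h3)
  · right
    have : NC F + 1 = 2 * ((NC F + 1) / 2) := by omega
    exact key _ (by rw [← this]; exact h3)

lemma tor_comm [Finite F] {X : SL2 F} (hX : tra X ^ 2 ≠ 4) {h y : PSL2 F} (hh : h ∈ tor X) (hy : y ∈ tor X) :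
    Commute h y := by
  have := tor_cyc hX
  have := (IsCyclic.commGroup (α := tor X)).mul_comm ⟨h, hh⟩ ⟨y, hy⟩
  exact congrArg Subtype.val this

lemma commute_mk {A B : SL2 F} (h : Commute (mkS A) (mkS B)) (hA : tra A ≠ 0) (h2 : (2 : F) ≠ 0) : Commute A B := by
  rw [commute_iff_eq, ← map_mul, ← map_mul, mkS_eq] at h
  rcases h with h | h
  · exact h.symm
  · exfalso
    have h1 : B * A * B⁻¹ = -A := by rw [h]; simp
    have h3 := tra_conj A B
    rw [h1, tra_neg] at h3
    apply hA
    have : 2 * tra A = 0 := by linear_combination -h3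
    exact (mul_eq_zero.1 this).resolve_left h2

lemma sq_one_of_tr0 {A : SL2 F} (h : tra A = 0) : mkS A ^ 2 = 1 := by
  rw [sq, ← map_mul, sl_sq A h, mkS_neg, map_one]

lemma tor_cent {X : SL2 F} (hX : tra X ^ 2 ≠ 4) (h2 : (2 : F) ≠ 0) {h y : PSL2 F} (hh : h ∈ tor X)
    (h1 : h ^ 2 ≠ 1) (hy : Commute h y) : y ∈ tor X := by
  obtain ⟨g, hg, rfl⟩ := mem_tor.1 hh
  obtain ⟨B, rfl⟩ := mkS_surj y
  have h3 := commute_mk hy (fun h => h1 (sq_one_of_tr0 h)) h2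
  obtain ⟨a, b, hab⟩ := comm_form (nonscal hX) hg
  have hb : b ≠ 0 := by
    rintro rfl
    apply h1
    rw [← map_pow, mkS_one, sq]
    obtain ⟨e1, e2, e3, e4⟩ := hab
    have h5 := sl_det g
    left
    apply sl_ext <;> simp only [sl_mul, e1, e2, e3, e4] at h5 ⊢ <;> simp at h5 ⊢ <;> exact h5
  refine mem_tor.2 ⟨B, ?_, rfl⟩
  obtain ⟨e1, e2, e3, e4⟩ := hab
  refine cm_comm (a := -a / b) (b := b⁻¹) (X := g) ?_ h3.symm
  refine ⟨?_, ?_, ?_, ?_⟩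
  · rw [e1]; field_simp; ring
  · rw [e2]; field_simp
  · rw [e3]; field_simp
  · rw [e4]; field_simp; ring

lemma tor_tr [Finite F] {X : SL2 F} (hX : tra X ^ 2 ≠ 4) {h h' : PSL2 F} (hh : h ∈ tor X) (hh' : h' ∈ tor X)
    (ht : trsq h = trsq h') : h' = h ∨ h' = h⁻¹ := by
  obtain ⟨φ, hφ, htr, -⟩ := torus_hom hX
  obtain ⟨g, hg, rfl⟩ := mem_tor.1 hh
  obtain ⟨g', hg', rfl⟩ := mem_tor.1 hh'
  rw [trsq_mk, trsq_mk] at ht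
  have key : ∀ g', Commute g' X → tra g = tra g' → mkS g' = mkS g ∨ mkS g' = (mkS g)⁻¹ := by
    intro g' hg' ht
    let a : Subgroup.centralizer {X} := ⟨g, mem_centralizer_singleton_iff.2 hg⟩
    let b : Subgroup.centralizer {X} := ⟨g', mem_centralizer_singleton_iff.2 hg'⟩
    have h1 := htr a
    have h2 := htr b
    change algebraMap _ _ (tra g) = _ at h1
    change algebraMap _ _ (tra g') = _ at h2
    rw [ht, h2] at h1
    have ha : φ a * φ a⁻¹ = 1 := by rw [← map_mul]; simp
    have hb : φ b * φ b⁻¹ = 1 := by rw [← map_mul]; simp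
    have h3 : (φ b - φ a) * (φ b - φ a⁻¹) = 0 := by
      linear_combination φ b * h1 + ha - hb
    rcases mul_eq_zero.1 h3 with h | h
    · left
      exact congrArg mkS (congrArg Subtype.val (hφ (sub_eq_zero.1 h)))
    · right
      rw [← map_inv]
      exact congrArg mkS (congrArg Subtype.val (hφ (sub_eq_zero.1 h)))
  rcases sq_eq_sq_iff_eq_or_eq_neg.1 ht with h | h
  · exact key g' hg' h
  · rw [← mkS_neg g']
    refine key (-g') ?_ (by rw [tra_neg, h])
    rw [commute_iff_eq] at hg' ⊢; simp [hg']
end PSL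

section PSL
variable {F : Type} [Field F]

def uu (a : F) : SL2 F := ⟨!![1, a; 0, 1], by simp [det_fin_two]⟩
def ul (a : F) : SL2 F := ⟨!![1, 0; a, 1], by simp [det_fin_two]⟩
def dg (t : Fˣ) : SL2 F := ⟨!![(t : F), 0; 0, ((t⁻¹ : Fˣ) : F)], by simp [det_fin_two]⟩
def comp2 (t : F) : SL2 F := ⟨!![t, -1; 1, 0], by simp [det_fin_two]⟩

lemma uu_e (a : F) : uu a 0 0 = 1 ∧ uu a 0 1 = a ∧ uu a 1 0 = 0 ∧ uu a 1 1 = 1 := by simp [uu]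
lemma ul_e (a : F) : ul a 0 0 = 1 ∧ ul a 0 1 = 0 ∧ ul a 1 0 = a ∧ ul a 1 1 = 1 := by simp [ul]
lemma dg_e (t : Fˣ) : dg t 0 0 = t ∧ dg t 0 1 = 0 ∧ dg t 1 0 = 0 ∧ dg t 1 1 = ((t⁻¹ : Fˣ) : F) := by simp [dg]
lemma comp2_tr (t : F) : tra (comp2 t) = t := by simp [tra, comp2]

lemma uu_add (a b : F) : uu (a + b) = uu a * uu b := by
  obtain ⟨h1, h2, h3, h4⟩ := uu_e a
  obtain ⟨k1, k2, k3, k4⟩ := uu_e b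
  obtain ⟨l1, l2, l3, l4⟩ := uu_e (a + b)
  apply sl_ext <;> simp only [sl_mul, h1, h2, h3, h4, k1, k2, k3, k4, l1, l2, l3, l4] <;> ring

lemma uu_zero : uu (0 : F) = 1 := by
  obtain ⟨l1, l2, l3, l4⟩ := uu_e (0 : F)
  apply sl_ext <;> simp [l1, l2, l3, l4]

lemma uu_tr (a : F) : tra (uu a) = 2 := by
  obtain ⟨l1, l2, l3, l4⟩ := uu_e a
  rw [tra, l1, l4]; norm_num

def US : Multiplicative F →* PSL2 F where
  toFun a := mkS (uu a.toAdd)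
  map_one' := by simp [uu_zero]
  map_mul' a b := by rw [toAdd_mul, uu_add, map_mul]

lemma US_inj (h2 : (2 : F) ≠ 0) : Function.Injective (US : Multiplicative F →* PSL2 F) := by
  intro a b h
  rcases mkS_eq.1 h with h | h
  · have := congrArg (fun A : SL2 F => A 0 1) h
    simp only [(uu_e _).2.1] at this
    exact this.symm
  · exfalso
    have := congrArg (fun A : SL2 F => A 0 0) h
    simp only [sl_neg, (uu_e _).1] at this
    apply h2; linear_combination this

lemma uu_cent (h2 : (2 : F) ≠ 0) {a : F} (ha : a ≠ 0) {y : PSL2 F} (h : Commute (mkS (uu a)) y) :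
    ∃ b, y = mkS (uu b) := by
  obtain ⟨B, rfl⟩ := mkS_surj y
  have h1 := commute_mk h (by rw [uu_tr]; exact h2) h2
  obtain ⟨e1, e2, -⟩ := comm_entries h1
  obtain ⟨l1, l2, l3, l4⟩ := uu_e a
  rw [l2, l3, mul_zero, ] at e1
  have hB : B 1 0 = 0 := by
    have := e1; exact (mul_eq_zero.1 this).resolve_left ha
  rw [l1, l2, l4] at e2
  have hd : B 0 0 = B 1 1 := by
    have : a * (B 0 0 - B 1 1) = 0 := by linear_combination -e2
    exact sub_eq_zero.1 ((mul_eq_zero.1 this).resolve_left ha)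
  have h5 := sl_det B
  rw [hB, ← hd] at h5
  rcases sq1 (show B 0 0 ^ 2 = 1 by linear_combination h5) with h6 | h6
  · refine ⟨B 0 1, congrArg mkS ?_⟩
    obtain ⟨k1, k2, k3, k4⟩ := uu_e (B 0 1)
    exact sl_ext (by rw [k1, h6]) (by rw [k2]) (by rw [k3, hB]) (by rw [k4, ← hd, h6])
  · refine ⟨- B 0 1, ?_⟩
    rw [← mkS_neg]
    congr 1
    obtain ⟨k1, k2, k3, k4⟩ := uu_e (- B 0 1)
    exact sl_ext (by rw [k1, sl_neg, h6, neg_neg]) (by rw [k2, sl_neg]) (by rw [k3, sl_neg, hB, neg_zero])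
      (by rw [k4, sl_neg, ← hd, h6, neg_neg])

lemma uu_conj (h2 : (2 : F) ≠ 0) {a b : F} (ha : a ≠ 0) {x : PSL2 F} (h : x * mkS (uu a) * x⁻¹ = mkS (uu b)) :
    ∃ t : F, b = t ^ 2 * a := by
  obtain ⟨B, rfl⟩ := mkS_surj x
  rw [← map_inv, ← map_mul, ← map_mul, mkS_eq] at h
  rcases h with h | h
  · have h1 : uu b * B = B * uu a := by rw [h]; group
    obtain ⟨l1, l2, l3, l4⟩ := uu_e a
    obtain ⟨k1, k2, k3, k4⟩ := uu_e b
    have e : ∀ i j, (uu b * B) i j = (B * uu a) i j := fun i j => by rw [h1]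
    simp only [sl_mul] at e
    have e1 := e 1 1
    have e2 := e 0 1
    rw [k3, k4, l2, l4] at e1
    have hB : B 1 0 = 0 := by
      have : a * B 1 0 = 0 := by linear_combination -e1
      exact (mul_eq_zero.1 this).resolve_left ha
    rw [k1, k2, l2, l4] at e2
    have h5 := sl_det B
    rw [hB] at h5
    exact ⟨B 0 0, by linear_combination B 0 0 * e2 - b * h5⟩
  · exfalso
    have := congrArg tra h
    rw [tra_neg, tra_conj, uu_tr, uu_tr] at this
    have h4 : (2 : F) * 2 = 0 := by linear_combination this
    rcases mul_eq_zero.1 h4 with h | h <;> exact h2 h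

lemma unip_pow (p : ℕ) [hp : Fact p.Prime] [CharP F p] {s : PSL2 F} (h : trsq s = 4) : s ^ p = 1 := by
  obtain ⟨A, rfl⟩ := mkS_surj s
  rw [trsq_mk] at h
  have key : ∀ A : SL2 F, tra A = 2 → A ^ p = 1 := by
    intro A hA
    have h1 : (A.1 - 1) ^ p = 0 := by
      have : (A.1 - 1) ^ 2 = 0 := by
        have hd := sl_det A
        rw [tra] at hA
        have h11 : A 1 1 = 2 - A 0 0 := by linear_combination hA
        rw [h11] at hd
        ext i j
        rw [sq, Matrix.mul_apply, Fin.sum_univ_two]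
        fin_cases i <;> fin_cases j <;> simp [h11]
        · linear_combination -hd
        · ring
        · ring
        · linear_combination -hd
      obtain ⟨m, hm⟩ := Nat.exists_eq_add_of_le hp.out.two_le
      rw [hm, pow_add, this, zero_mul]
    rw [sub_pow_char_of_commute p (Commute.one_right _), one_pow, sub_eq_zero] at h1
    ext i j
    rw [Matrix.SpecialLinearGroup.coe_pow, h1]; rfl
  have h4 : tra A = 2 ∨ tra A = -2 := sq_eq_sq_iff_eq_or_eq_neg.1 (by rw [h]; norm_num)
  rcases h4 with h4 | h4
  · rw [← map_pow, key A h4, map_one]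
  · rw [← mkS_neg, ← map_pow, key (-A) (by rw [tra_neg, h4, neg_neg]), map_one]

lemma trsq_one_or {s : PSL2 F} (h : trsq s = 0) : s ^ 2 = 1 := by
  obtain ⟨A, rfl⟩ := mkS_surj s
  rw [trsq_mk] at h
  exact sq_one_of_tr0 (pow_eq_zero_iff two_ne_zero |>.1 h)

def BL : Subgroup (SL2 F) where
  carrier := {A | A 1 0 = 0}
  one_mem' := by simp
  mul_mem' := by
    intro A B hA hB
    simp only [Set.mem_setOf_eq, sl_mul] at *
    rw [hA, hB]; ring
  inv_mem' := by
    intro A hA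
    simp only [Set.mem_setOf_eq] at *
    rw [(sl_inv A).2.2.1, hA, neg_zero]

lemma mem_BL {A : SL2 F} : A ∈ BL ↔ A 1 0 = 0 := Iff.rfl

def BS : Subgroup (PSL2 F) := BL.map mkS

lemma mem_BS {A : SL2 F} : mkS A ∈ BS ↔ A 1 0 = 0 := by
  constructor
  · rintro ⟨B, hB, h⟩
    rcases mkS_eq.1 h with rfl | rfl
    · exact hB
    · rw [sl_neg, mem_BL.1 hB, neg_zero]
  · exact fun h => ⟨A, h, rfl⟩

lemma bruhat (A : SL2 F) (h : A 1 0 ≠ 0) :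
    A = uu ((A 0 0 - 1) / A 1 0) * ul (A 1 0) * uu ((A 1 1 - 1) / A 1 0) := by
  obtain ⟨h1, h2, h3, h4⟩ := uu_e ((A 0 0 - 1) / A 1 0)
  obtain ⟨k1, k2, k3, k4⟩ := uu_e ((A 1 1 - 1) / A 1 0)
  obtain ⟨l1, l2, l3, l4⟩ := ul_e (A 1 0)
  have hd := sl_det A
  apply sl_ext <;> simp only [sl_mul, h1, h2, h3, h4, k1, k2, k3, k4, l1, l2, l3, l4]
  · field_simp; ring
  · field_simp; linear_combination -hd
  · ring
  · field_simp; ring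

lemma gen_top {H : Subgroup (PSL2 F)} (hU : ∀ a : F, mkS (uu a) ∈ H) (hB : ¬ H ≤ BS) : H = ⊤ := by
  rw [SetLike.not_le_iff_exists] at hB
  obtain ⟨s, hs, hsB⟩ := hB
  obtain ⟨A, rfl⟩ := mkS_surj s
  rw [mem_BS] at hsB
  have h1 : mkS (ul (A 1 0)) ∈ H := by
    rw [bruhat A hsB, map_mul, map_mul] at hs
    rw [Subgroup.mul_mem_cancel_right _ (hU _), Subgroup.mul_mem_cancel_left _ (hU _)] at hs
    exact hs
  set c := A 1 0 with hc
  have hn : mkS (uu (-c⁻¹) * ul c * uu (-c⁻¹)) ∈ H := by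
    rw [map_mul, map_mul]; exact H.mul_mem (H.mul_mem (hU _) h1) (hU _)
  have h3 : ∀ a, mkS (ul a) ∈ H := by
    intro a
    have h4 : (uu (-c⁻¹) * ul c * uu (-c⁻¹)) * uu (- a / c ^ 2) = ul a * (uu (-c⁻¹) * ul c * uu (-c⁻¹)) := by
      obtain ⟨h1, h2, h3, h4⟩ := uu_e (-c⁻¹)
      obtain ⟨k1, k2, k3, k4⟩ := uu_e (- a / c ^ 2)
      obtain ⟨l1, l2, l3, l4⟩ := ul_e c
      obtain ⟨m1, m2, m3, m4⟩ := ul_e a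
      apply sl_ext <;> simp only [sl_mul, h1, h2, h3, h4, k1, k2, k3, k4, l1, l2, l3, l4, m1, m2, m3, m4] <;>
        field_simp <;> ring
    have h5 := congrArg mkS h4
    rw [map_mul, map_mul (mkS) (ul a)] at h5
    rw [← Subgroup.mul_mem_cancel_right H hn, ← h5]
    exact H.mul_mem hn (hU _)
  rw [eq_top_iff]
  rintro s -
  obtain ⟨A, rfl⟩ := mkS_surj s
  have key : ∀ A : SL2 F, A 1 0 ≠ 0 → mkS A ∈ H := by
    intro A hA
    rw [bruhat A hA, map_mul, map_mul]
    exact H.mul_mem (H.mul_mem (hU _) (h3 _)) (hU _)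
  by_cases hA : A 1 0 = 0
  · have : mkS (ul 1 * A) ∈ H := by
      apply key
      rw [sl_mul, hA]
      obtain ⟨m1, m2, m3, m4⟩ := ul_e (1 : F)
      rw [m3]
      intro h
      have hd := sl_det A
      rw [hA] at hd
      have : A 0 0 = 0 := by linear_combination h
      rw [this] at hd; simp at hd
    rw [map_mul, Subgroup.mul_mem_cancel_left _ (h3 _)] at this
    exact this
  · exact key A hA

variable [Finite F]

lemma card_BL : NC (BL : Subgroup (SL2 F)) = NC F * (NC F - 1) := by
  let e : (BL : Subgroup (SL2 F)) ≃ F × Fˣ :=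
    { toFun := fun A => (A.1 0 1, ⟨A.1 0 0, A.1 1 1, by
        have := sl_det A.1; rw [mem_BL.1 A.2] at this; linear_combination this, by
        have := sl_det A.1; rw [mem_BL.1 A.2] at this; linear_combination this⟩)
      invFun := fun x => ⟨⟨!![(x.2 : F), x.1; 0, ((x.2⁻¹ : Fˣ) : F)], by simp [det_fin_two]⟩, by
        exact mem_BL.2 (by simp)⟩
      left_inv := by
        intro A
        apply Subtype.ext
        apply sl_ext <;> simp
        exact (mem_BL.1 A.2).symm
      right_inv := by
        intro x
        ext <;> simp }
  rw [Nat.card_congr e, Nat.card_prod, Nat.card_units]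

lemma card_SL : NC (SL2 F) = NC F * (NC F - 1) * (NC F + 1) := by
  classical
  have := ofFinite F
  have h1 := Matrix.card_GL_field (𝔽 := F) 2
  let d : GL (Fin 2) F →* Fˣ := Matrix.GeneralLinearGroup.det
  have hd : Surjective d := by
    intro t
    refine ⟨Matrix.GeneralLinearGroup.mkOfDetNeZero !![(t : F), 0; 0, 1] (by simp [det_fin_two]), ?_⟩
    ext; simp [d, Matrix.GeneralLinearGroup.mkOfDetNeZero, det_fin_two]
  have h2 := d.ker.card_eq_card_quotient_mul_card_subgroup
  rw [Nat.card_congr (quotientKerEquivOfSurjective d hd).toEquiv, Nat.card_units] at h2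
  let e : SL2 F ≃ d.ker :=
    { toFun := fun A => ⟨(A : GL (Fin 2) F), by rw [MonoidHom.mem_ker]; ext; simp [d]⟩
      invFun := fun A => ⟨A.1.1, by
        have := congrArg Units.val (MonoidHom.mem_ker.1 A.2); simpa [d] using this⟩
      left_inv := by intro A; rfl
      right_inv := by intro A; ext; rfl }
  rw [← Nat.card_congr e, h1, Fin.prod_univ_two] at h2
  have hq : 1 < Fintype.card F := Fintype.one_lt_card
  rw [card_eq_fintype_card (α := F)] at h2 ⊢
  simp only [Fin.val_zero, Fin.val_one, pow_zero, pow_one] at h2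
  obtain ⟨m, hm⟩ := Nat.exists_eq_add_of_lt hq
  rw [hm] at h2 ⊢
  have e1 : (1 + m + 1) ^ 2 - 1 = (m + 1) * (m + 3) := by
    have : (1 + m + 1) ^ 2 = (m + 1) * (m + 3) + 1 := by ring
    omega
  have e2 : (1 + m + 1) ^ 2 - (1 + m + 1) = (m + 2) * (m + 1) := by
    have : (1 + m + 1) ^ 2 = (m + 2) * (m + 1) + (1 + m + 1) := by ring
    omega
  have e3 : 1 + m + 1 - 1 = m + 1 := by omega
  rw [e1, e2, e3] at h2
  rw [e3]
  apply eq_of_mul_eq_mul_left (show 0 < m + 1 by omega)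
  exact h2.symm.trans (by ring)

lemma card_PSL (h2 : (2 : F) ≠ 0) : 2 * NC (PSL2 F) = NC F * (NC F - 1) * (NC F + 1) := by
  have h := (Subgroup.center (SL2 F)).card_eq_card_quotient_mul_card_subgroup
  have hc : NC (Subgroup.center (SL2 F)) = 2 := by
    have : ((Subgroup.center (SL2 F)) : Set (SL2 F)) = {1, -1} := by
      ext A; rw [SetLike.mem_coe, mem_cen]; simp
    rw [← SetLike.coe_sort_coe, this, Nat.card_coe_set_eq, Set.ncard_pair]
    intro h
    have := congrArg (fun A : SL2 F => A 0 0) h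
    simp only [sl_neg] at this
    simp at this
    apply h2; linear_combination this
  rw [hc, card_SL] at h
  rw [h, mul_comm]

lemma index_BS : (BS : Subgroup (PSL2 F)).index = NC F + 1 := by
  have h1 : (BS : Subgroup (PSL2 F)).comap mkS = BL := by
    ext A; rw [mem_comap, mem_BS, mem_BL]
  rw [← Subgroup.index_comap_of_surjective _ mkS_surj, h1]
  have h3 := (BL : Subgroup (SL2 F)).card_mul_index
  rw [card_BL, card_SL] at h3
  have hq : 1 < NC F := Finite.one_lt_card
  exact eq_of_mul_eq_mul_left (Nat.mul_pos (by omega) (by omega)) h3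
end PSL

namespace Fam

variable {K : Type} [Field K] [Finite K] {Γ : Type} [Group Γ] [Fintype Γ] {π : Γ →* PSL2 K} (F : Fam π)

structure TD (π : Γ →* PSL2 K) (X : SL2 K) (w : Γ) (c : ℕ) : Prop where
  hX : tra X ^ 2 ≠ 4
  ht : Tor π w c
  hz : zpowers (π w) = tor X ⊓ π.range

lemma mk_tor (h2 : (2 : K) ≠ 0) {X : SL2 K} (hX : tra X ^ 2 ≠ 4) : ∃ w c, TD π X w c := by
  have h1 := tor_cyc hX
  have h3 : IsCyclic (tor X ⊓ π.range : Subgroup (PSL2 K)) :=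
    isCyclic_of_injective (Subgroup.inclusion inf_le_left) (Subgroup.inclusion_injective (inf_le_left (a := tor X) (b := π.range)))
  obtain ⟨g, hg⟩ := h3
  obtain ⟨w, hw⟩ := g.2.2
  have hz : zpowers (π w) = tor X ⊓ π.range := by
    apply le_antisymm
    · rw [zpowers_le, hw]; exact g.2
    · intro h hh
      obtain ⟨n, hn⟩ := hg ⟨h, hh⟩
      exact ⟨n, by rw [hw]; exact congrArg Subtype.val hn⟩
  refine ⟨w, _, hX, ⟨rfl, ?_⟩, hz⟩
  intro j x hj hc
  rw [hz]
  have hm : π w ^ j ∈ tor X := by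
    have : π w ^ j ∈ zpowers (π w) := ⟨j, by simp⟩
    rw [hz] at this; exact this.1
  exact ⟨tor_cent hX h2 hm (by rw [← pow_mul, mul_comm]; exact hj) hc, x, rfl⟩

lemma TD.good {X : SL2 K} {w : Γ} {c : ℕ} (T : TD π X w c) (h2 : (2 : K) ≠ 0) {g : Γ}
    (hg : π g ∈ tor X) (h : π g ^ 2 ≠ 1) : F.Good g := by
  refine F.good_of_cyc w fun x hx => ?_
  rw [T.hz]
  exact ⟨tor_cent T.hX h2 hg h hx, x, rfl⟩

lemma reg {p : ℕ} [hp : Fact p.Prime] [CharP K p] {ℓ : ℕ} (hℓ : ℓ.Prime) (h2 : ℓ ≠ 2) (hne : ℓ ≠ p) {s : PSL2 K}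
    (hs : orderOf s = ℓ) : trsq s ≠ 4 ∧ s ^ 2 ≠ 1 := by
  constructor
  · intro h
    have := orderOf_dvd_of_pow_eq_one (unip_pow p h)
    rw [hs] at this
    exact hne ((Nat.prime_dvd_prime_iff_eq hℓ hp.out).1 this)
  · intro h
    have := orderOf_dvd_of_pow_eq_one h
    rw [hs] at this
    exact h2 ((Nat.prime_dvd_prime_iff_eq hℓ Nat.prime_two).1 this)

lemma reg_tor {p : ℕ} [hp : Fact p.Prime] [CharP K p] (hq : Odd (NC K)) (h2 : (2 : K) ≠ 0) {ℓ : ℕ} (hℓ : ℓ.Prime) (hℓ2 : ℓ ≠ 2) (hne : ℓ ≠ p) {e : ℕ}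
    (he : e = NC K - 1 ∨ e = NC K + 1) (hd : ℓ ∣ e) {s : PSL2 K} (hs : orderOf s = ℓ) (hr : s ∈ π.range) :
    ∃ X w c, TD π X w c ∧ ℓ ∣ c ∧ c ∣ e / 2 := by
  obtain ⟨X, rfl⟩ := mkS_surj s
  have hX : tra X ^ 2 ≠ 4 := by
    have := (reg hℓ hℓ2 hne hs).1
    rwa [trsq_mk] at this
  obtain ⟨w, c, T⟩ := mk_tor (π := π) h2 hX
  have hw : π w ∈ tor X := by
    have : π w ∈ zpowers (π w) := Subgroup.mem_zpowers _
    rw [T.hz] at this; exact this.1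
  have hc : orderOf (π w) = c := T.ht.1
  refine ⟨X, w, c, T, ?_, ?_⟩
  · have : mkS X ∈ zpowers (π w) := by rw [T.hz]; exact ⟨tor_self X, hr⟩
    rw [← hs, ← hc]
    exact orderOf_dvd_of_mem_zpowers this
  · rw [← hc]
    apply orderOf_dvd_of_pow_eq_one
    obtain ⟨m, hm⟩ := hq
    have key : ∀ d, mkS X ^ d = 1 → ℓ ∣ d := fun d h => hs ▸ orderOf_dvd_of_pow_eq_one h
    have two : ∀ d, ℓ ∣ d → ¬ ℓ ∣ d + 1 := by
      intro d h h'
      have := (Nat.dvd_add_right h).1 h'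
      exact hℓ.one_lt.ne' (Nat.dvd_one.1 this)
    have hl : ∀ d, ℓ ∣ 2 * d → ℓ ∣ d := fun d h => ((Nat.Prime.dvd_mul hℓ).1 h).resolve_left fun h =>
      hℓ2 ((Nat.prime_dvd_prime_iff_eq hℓ Nat.prime_two).1 h)
    have e1 : (NC K - 1) / 2 = m := by omega
    have e2 : (NC K + 1) / 2 = m + 1 := by omega
    rcases tor_exp ⟨m, hm⟩ hX with h | h
    · rcases he with rfl | rfl
      · exact h _ hw
      · exfalso
        have := key _ (h _ (tor_self X))
        rw [e1] at this
        refine two m this (hl _ ?_)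
        rwa [show 2 * (m + 1) = NC K + 1 by omega]
    · rcases he with rfl | rfl
      · exfalso
        have := key _ (h _ (tor_self X))
        rw [e2] at this
        refine two m (hl _ ?_) this
        rwa [show 2 * m = NC K - 1 by omega]
      · exact h _ hw

lemma TD.up {X : SL2 K} {w : Γ} {c : ℕ} (T : TD π X w c) {x : ℕ} (hx : x.Prime) (hx2 : x ≠ 2) (hxc : x ∣ c)
    (hn : ∀ i, ¬ x ∣ F.n i) :
    (Odd c ∧ Fintype.card F.ι ≤ c) ∨ (∃ b, c = 2 * b ∧ F.Good (w ^ b) ∧ Fintype.card F.ι ≤ c) ∨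
      (∃ b, c = 2 * b ∧ Fintype.card F.ι ≤ b) := by
  classical
  have hc0 : c ≠ 0 := by
    rw [← T.ht.1]; exact (orderOf_pos _).ne'
  have h3 : 3 ≤ x := by
    have := hx.two_le; omega
  rcases Nat.even_or_odd' c with ⟨b, hb | hb⟩
  · right
    have hxb : x ∣ b := by
      rw [hb] at hxc
      exact ((Nat.Prime.dvd_mul hx).1 hxc).resolve_left fun h =>
        hx2 ((Nat.prime_dvd_prime_iff_eq hx Nat.prime_two).1 h)
    have hb1 : 1 < b := lt_of_lt_of_le (by omega) (le_of_dvd (by omega) hxb)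
    have ht := T.ht
    rw [hb] at ht
    by_cases hg : F.Good (w ^ b)
    · left
      refine ⟨b, hb, hg, ?_⟩
      have := F.up_even' ht hb1
      rw [Finset.filter_true_of_mem] at this
      · rw [hb]; exact this
      · intro i _ h
        exact hn i (hxb.trans h.1)
    · right
      refine ⟨b, hb, ?_⟩
      have := F.up_bad ht hb1 hg
      rw [Finset.filter_true_of_mem] at this
      · exact this
      · intro i _ h
        exact hn i ((hxb.mul_left 2).trans h)
  · left
    have ho : Odd c := ⟨b, hb⟩
    refine ⟨ho, ?_⟩
    have := F.up_odd T.ht ho (lt_of_lt_of_le (by omega) (le_of_dvd (by omega) hxc))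
    rw [Finset.filter_true_of_mem] at this
    · exact this
    · intro i _ h
      exact hn i (hxc.trans h)

lemma TD.up' {X : SL2 K} {w : Γ} {c : ℕ} (T : TD π X w c) {x : ℕ} (hx : x.Prime) (hx2 : x ≠ 2) (hxc : x ∣ c)
    (hn : ∀ i, ¬ x ∣ F.n i) : Fintype.card F.ι ≤ c := by
  rcases TD.up F T hx hx2 hxc hn with h | ⟨b, h⟩ | ⟨b, h⟩ <;> omega

lemma lemKf (A : Finset (PSL2 K)) (hA : ∀ a ∈ A, ∃ g, π g = a ∧ F.Good g)
    (hne : ∀ a ∈ A, ∀ b ∈ A, a ≠ b → ∀ x ∈ π.range, x⁻¹ * a * x ≠ b) : A.card ≤ Fintype.card F.ι := by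
  choose! g hg hG using hA
  have := F.lemK (κ := A) (fun a => g a) (fun a => hG _ a.2) (fun a b hab x => by
    rw [map_mul, map_mul, map_inv, hg _ a.2, hg _ b.2]
    exact hne _ a.2 _ b.2 (fun h => hab (Subtype.ext h)) _ ⟨x, rfl⟩)
  simpa using this

lemma exists_section {α β : Type*} [DecidableEq β] (B : Finset α) (f : α → β) (n : ℕ)
    (hn : ∀ b ∈ B.image f, (B.filter fun a => f a = b).card ≤ n) :
    ∃ A ⊆ B, Set.InjOn f A ∧ B.card ≤ n * A.card := by
  obtain ⟨A, hA, hi, hE⟩ := Finset.exists_subset_injOn_image_eq_of_surjOn (B : Set α) (B.image f)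
    (f := f) (by intro b hb; simpa using hb)
  refine ⟨A, by exact_mod_cast hA, hi, ?_⟩
  rw [← Finset.card_image_of_injOn hi, hE]
  exact Finset.card_le_mul_card_image _ n hn

lemma TD.A {X : SL2 K} {w : Γ} {c : ℕ} (T : TD π X w c) :
    ∃ A : Finset (PSL2 K), (∀ a ∈ A, a ∈ zpowers (π w) ∧ a ^ 2 ≠ 1) ∧ Set.InjOn trsq (A : Set (PSL2 K)) ∧
      c ≤ 2 * A.card + 2 ∧ (Odd c → c ≤ 2 * A.card + 1) := by
  classical
  have := ofFinite (PSL2 K)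
  let Z : Finset (PSL2 K) := univ.filter fun a => a ∈ zpowers (π w)
  have hZ : Z.card = c := by
    rw [← T.ht.1, ← card_zpowers, card_eq_fintype_card, Fintype.card_subtype]
  have hZt : ∀ a ∈ Z, a ∈ tor X := by
    intro a ha
    have : a ∈ zpowers (π w) := by simpa [Z] using ha
    rw [T.hz] at this; exact this.1
  obtain ⟨A, hA, hi, hcard⟩ := exists_section (Z.filter fun a => a ^ 2 ≠ 1) trsq 2 (by
    intro b hb
    obtain ⟨a, ha, rfl⟩ := Finset.mem_image.1 hb
    refine (Finset.card_le_card (t := {a, a⁻¹}) ?_).trans Finset.card_le_two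
    intro a' ha'
    simp only [mem_filter] at ha ha'
    simpa using tor_tr T.hX (hZt _ ha.1) (hZt _ ha'.1.1) ha'.2.symm)
  have hs : Z.card = (Z.filter fun a => a ^ 2 ≠ 1).card + (Z.filter fun a => ¬ a ^ 2 ≠ 1).card :=
    (Finset.card_filter_add_card_filter_not _).symm
  refine ⟨A, ?_, hi, ?_, ?_⟩
  · intro a ha
    have := mem_filter.1 (hA ha)
    exact ⟨by simpa [Z] using this.1, this.2⟩
  · have : (Z.filter fun a => ¬ a ^ 2 ≠ 1).card ≤ 2 := by
      have h := IsCyclic.card_pow_eq_one_le (α := zpowers (π w)) (n := 2) (by omega)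
      refine le_trans ?_ h
      rw [← Finset.card_map (Function.Embedding.subtype _)]
      apply Finset.card_le_card
      intro a ha
      simp only [mem_filter, not_not, Z, Finset.mem_univ, true_and] at ha
      rw [Finset.mem_map]
      exact ⟨⟨a, ha.1⟩, by simpa [Subtype.ext_iff] using ha.2, rfl⟩
    omega
  · intro ho
    have : (Z.filter fun a => ¬ a ^ 2 ≠ 1).card ≤ 1 := by
      rw [Finset.card_le_one]
      have : ∀ a ∈ (Z.filter fun a => ¬ a ^ 2 ≠ 1), a = 1 := by
        intro a ha
        simp only [mem_filter, not_not, Z, Finset.mem_univ, true_and] at ha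
        have h1 := orderOf_dvd_of_mem_zpowers ha.1
        rw [T.ht.1] at h1
        have h2 := orderOf_dvd_of_pow_eq_one ha.2
        have := Nat.dvd_gcd h1 h2
        rw [Coprime.gcd_eq_one ho.coprime_two_right] at this
        exact orderOf_eq_one_iff.1 (Nat.dvd_one.1 this)
      intro a ha b hb
      rw [this a ha, this b hb]
    omega

lemma trsq_conj' (s g : PSL2 K) : trsq (g⁻¹ * s * g) = trsq s := by
  have := trsq_conj s g⁻¹
  rwa [inv_inv] at this

lemma conj_one {a x : PSL2 K} (h : x⁻¹ * a * x = 1) : a = 1 := by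
  have : a = x * (x⁻¹ * a * x) * x⁻¹ := by group
  rw [this, h]; group

lemma conj_pow' {a x : PSL2 K} (n : ℕ) : (x⁻¹ * a * x) ^ n = x⁻¹ * a ^ n * x := by
  have := conj_pow (a := x⁻¹) (b := a) (i := n)
  rwa [inv_inv] at this

lemma TD.A' {X : SL2 K} {w : Γ} {c : ℕ} (T : TD π X w c) (h2 : (2 : K) ≠ 0) {x : ℕ} (hx : x.Prime) (hx2 : x ≠ 2) (hxc : x ∣ c)
    (hn : ∀ i, ¬ x ∣ F.n i) :
    ∃ A : Finset (PSL2 K), (∀ a ∈ A, a ∈ zpowers (π w) ∧ a ≠ 1 ∧ ∃ g, π g = a ∧ F.Good g) ∧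
      (∀ a ∈ A, ∀ b ∈ A, a ≠ b → ∀ x ∈ π.range, x⁻¹ * a * x ≠ b) ∧
      ((Odd c ∧ Fintype.card F.ι ≤ c ∧ c ≤ 2 * A.card + 1) ∨ (Even c ∧ Fintype.card F.ι ≤ c ∧ c ≤ 2 * A.card) ∨
      (Even c ∧ 2 * Fintype.card F.ι ≤ c ∧ c ≤ 2 * A.card + 2)) := by
  classical
  obtain ⟨A, hA, hi, h3, h4⟩ := T.A
  have hA' : ∀ a ∈ A, a ∈ zpowers (π w) ∧ a ≠ 1 ∧ ∃ g, π g = a ∧ F.Good g := by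
    intro a ha
    obtain ⟨m, hm⟩ := (hA a ha).1
    have hm' : π (w ^ m) = a := by rw [map_zpow]; exact hm
    refine ⟨(hA a ha).1, fun h => (hA a ha).2 (by rw [h, one_pow]), w ^ m, hm', ?_⟩
    have ht : a ∈ tor X := by
      have := (hA a ha).1
      rw [T.hz] at this; exact this.1
    exact T.good F h2 (hm' ▸ ht) (hm' ▸ (hA a ha).2)
  have hne : ∀ a ∈ A, ∀ b ∈ A, a ≠ b → ∀ x ∈ π.range, x⁻¹ * a * x ≠ b := by
    intro a ha b hb hab x _ h
    exact hab (hi ha hb (by rw [← h, trsq_conj']))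
  rcases T.up F hx hx2 hxc hn with ⟨ho, h⟩ | ⟨b, hb, hg, h⟩ | ⟨b, hb, h⟩
  · exact ⟨A, hA', hne, inl ⟨ho, h, h4 ho⟩⟩
  · have hc : orderOf (π w) = c := T.ht.1
    have hc0 : 0 < c := hc ▸ orderOf_pos _
    have hsq : (π w ^ b) ^ 2 = 1 := by rw [← pow_mul, mul_comm, ← hb, ← hc, pow_orderOf_eq_one]
    have ht1 : π w ^ b ≠ 1 := by
      intro h
      have := le_of_dvd (by omega) (orderOf_dvd_of_pow_eq_one h)
      omega
    have htA : π w ^ b ∉ A := fun h => (hA _ h).2 hsq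
    refine ⟨insert (π w ^ b) A, ?_, ?_, inr (inl ⟨⟨b, by omega⟩, h, ?_⟩)⟩
    · intro a ha
      rcases Finset.mem_insert.1 ha with rfl | ha
      · exact ⟨⟨b, by simp⟩, ht1, w ^ b, by simp, hg⟩
      · exact hA' a ha
    · intro a ha d hd had x hx h
      have e := conj_pow' (a := a) (x := x) 2
      rw [h] at e
      rcases Finset.mem_insert.1 ha with rfl | ha <;> rcases Finset.mem_insert.1 hd with rfl | hd
      · exact had rfl
      · exact (hA _ hd).2 (by rw [e, hsq]; group)
      · rw [hsq] at e
        exact (hA _ ha).2 (conj_one e.symm)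
      · exact hne a ha d hd had x hx h
    · rw [Finset.card_insert_of_notMem htA]; omega
  · exact ⟨A, hA', hne, inr (inr ⟨⟨b, by omega⟩, by omega, h3⟩)⟩

lemma star (h2 : (2 : K) ≠ 0) {X X' : SL2 K} {w w' : Γ} {c c' : ℕ} (T : TD π X w c) (T' : TD π X' w' c')
    (hcc : c.Coprime c') {x y : ℕ} (hx : x.Prime) (hx2 : x ≠ 2) (hxc : x ∣ c) (hy : y.Prime) (hy2 : y ≠ 2) (hyc : y ∣ c')
    (hnx : ∀ i, ¬ x ∣ F.n i) (hny : ∀ i, ¬ y ∣ F.n i) : False := by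
  classical
  obtain ⟨A, hA, hAn, hAc⟩ := T.A' F h2 hx hx2 hxc hnx
  obtain ⟨B, hB, hBn, hBc⟩ := T'.A' F h2 hy hy2 hyc hny
  have hpc : ∀ a ∈ A, a ^ c = 1 := fun a ha => by
    have := orderOf_dvd_of_mem_zpowers (hA a ha).1
    rw [T.ht.1] at this; exact orderOf_dvd_iff_pow_eq_one.1 this
  have hpc' : ∀ a ∈ B, a ^ c' = 1 := fun a ha => by
    have := orderOf_dvd_of_mem_zpowers (hB a ha).1
    rw [T'.ht.1] at this; exact orderOf_dvd_iff_pow_eq_one.1 this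
  have hcop : ∀ a : PSL2 K, a ^ c = 1 → a ^ c' = 1 → a = 1 := by
    intro a h h'
    have := Nat.dvd_gcd (orderOf_dvd_of_pow_eq_one h) (orderOf_dvd_of_pow_eq_one h')
    rw [hcc.gcd_eq_one] at this
    exact orderOf_eq_one_iff.1 (Nat.dvd_one.1 this)
  have hcj : ∀ (a x : PSL2 K) n, a ^ n = 1 → (x⁻¹ * a * x) ^ n = 1 := by
    intro a x n h
    rw [conj_pow', h]; group
  have hdis : Disjoint A B := by
    rw [Finset.disjoint_left]
    intro a ha hb
    exact (hA a ha).2.1 (hcop a (hpc a ha) (hpc' a hb))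
  have h1 : (1 : PSL2 K) ∉ A ∪ B := by
    intro h
    rcases Finset.mem_union.1 h with h | h
    · exact (hA _ h).2.1 rfl
    · exact (hB _ h).2.1 rfl
  have key := F.lemKf (insert 1 (A ∪ B)) (by
    intro a ha
    rcases Finset.mem_insert.1 ha with rfl | ha
    · exact ⟨1, map_one _, F.good_one⟩
    rcases Finset.mem_union.1 ha with h | h
    · exact (hA _ h).2.2
    · exact (hB _ h).2.2) (by
    intro a ha b hb hab x hx h
    rcases Finset.mem_insert.1 ha with rfl | ha
    · exact hab (by rw [← h]; group)
    rcases Finset.mem_insert.1 hb with rfl | hb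
    · exact hab (conj_one h)
    rcases Finset.mem_union.1 ha with ha | ha <;> rcases Finset.mem_union.1 hb with hb | hb
    · exact hAn a ha b hb hab x hx h
    · exact (hB _ hb).2.1 (hcop _ (h ▸ hcj a x c (hpc a ha)) (hpc' _ hb))
    · exact (hA _ hb).2.1 (hcop _ (hpc _ hb) (h ▸ hcj a x c' (hpc' a ha)))
    · exact hBn a ha b hb hab x hx h)
  rw [Finset.card_insert_of_notMem h1, Finset.card_union_of_disjoint hdis] at key
  have e2 : ¬ (Even c ∧ Even c') := by
    rintro ⟨⟨a, ha⟩, ⟨b, hb⟩⟩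
    have : 2 ∣ Nat.gcd c c' := Nat.dvd_gcd ⟨a, by omega⟩ ⟨b, by omega⟩
    rw [hcc.gcd_eq_one] at this; omega
  have hc : 0 < c := T.ht.1 ▸ orderOf_pos _
  have hc' : 0 < c' := T'.ht.1 ▸ orderOf_pos _
  have c3 := le_of_dvd hc hxc
  have c3' := le_of_dvd hc' hyc
  have := hx.two_le
  have := hy.two_le
  have hne : c ≠ c' := by
    rintro rfl
    rw [Nat.coprime_self] at hcc; omega
  rcases hAc with ⟨o, u1, u2⟩ | ⟨o, u1, u2⟩ | ⟨o, u1, u2⟩ <;> rcases hBc with ⟨o', v1, v2⟩ | ⟨o', v1, v2⟩ | ⟨o', v1, v2⟩ <;>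
    first | exact e2 ⟨o, o'⟩ | omega

end Fam

namespace Fam

variable {K : Type} [Field K] [Finite K] {Γ : Type} [Group Γ] [Fintype Γ] {π : Γ →* PSL2 K} (F : Fam π)

lemma upart {p : ℕ} [hp : Fact p.Prime] [CharP K p] (h2 : (2 : K) ≠ 0) :
    (∀ i, p ∣ F.n i) ∨ ∀ a : K, a ≠ 0 → ∀ g, π g = mkS (uu a) → F.Good g := by
  by_contra! hcon
  obtain ⟨⟨i, hi⟩, a, ha, g, hg, hb⟩ := hcon
  unfold Good at hb
  push Not at hb
  obtain ⟨x, hx, hν⟩ := hb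
  set ζ := F.ν (g⁻¹ * (x⁻¹ * g * x)) with hζ
  have hsw := F.ρ_swap hx i
  rw [← hζ] at hsw
  rw [hg] at hx
  obtain ⟨b, hb⟩ := uu_cent h2 ha hx
  have hxp : π (x ^ p) = 1 := by
    rw [map_pow, hb]; exact unip_pow p (by rw [trsq_mk, uu_tr]; norm_num)
  have h1 : ∀ m : ℕ, F.ρ i g * F.ρ i x ^ m = ζ ^ m • (F.ρ i x ^ m * F.ρ i g) := by
    intro m
    induction m with
    | zero => simp
    | succ m ih =>
      rw [pow_succ, ← mul_assoc, ih, smul_mul_assoc, mul_assoc, hsw, mul_smul_comm, smul_smul, ← mul_assoc, pow_succ]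
  have h3 := h1 p
  rw [← map_pow, F.scal _ hxp i] at h3
  have hinv := F.ρ_inv_mul i
  have hζp : ζ ^ p = 1 := by
    have h5 : F.ν (x ^ p) ≠ 0 := by
      intro h0
      have := hinv (x ^ p)
      rw [F.scal _ hxp i, h0, zero_smul, mul_zero] at this
      have := F.smul_one_inj i (c := 0) (d := 1) (by rw [zero_smul, one_smul]; exact this)
      simp at this
    have h6 := congrArg (fun f => F.ρ i g⁻¹ * f) h3
    simp only [mul_smul_comm, smul_mul_assoc, one_mul, mul_one, hinv, smul_smul] at h6
    have := F.smul_one_inj i h6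
    field_simp at this
    exact this.symm
  have hd := congrArg det hsw
  rw [det_smul, map_mul, map_mul, mul_comm (det (F.ρ i x)), Module.finrank_fin_fun] at hd
  have hdn : ∀ g, det (F.ρ i g) ≠ 0 := by
    intro g h
    have := congrArg det (hinv g)
    rw [map_mul, h] at this
    simp at this
  have hζn : ζ ^ F.n i = 1 := by
    have h0 := mul_ne_zero (hdn g) (hdn x)
    have : (ζ ^ F.n i - 1) * (det (F.ρ i g) * det (F.ρ i x)) = 0 := by
      linear_combination -hd
    rcases mul_eq_zero.1 this with h | h
    · linear_combination h
    · exact absurd h h0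
  apply hi
  rw [← orderOf_eq_prime hζp hν]
  exact orderOf_dvd_of_pow_eq_one hζn

lemma exists_ord {ℓ : ℕ} (hℓ : ℓ.Prime) (h2 : (2 : K) ≠ 0) (hℓ2 : ℓ ≠ 2) (hd : ℓ ∣ (NC K - 1) ∨ ℓ ∣ NC K + 1)
    (hI : ¬ ℓ ∣ π.range.index) : ∃ s, orderOf s = ℓ ∧ s ∈ π.range := by
  have h1 := π.range.card_mul_index
  have h3 := card_PSL h2
  have h4 : ℓ ∣ 2 * NC (PSL2 K) := by
    rw [h3]
    rcases hd with h | h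
    · exact (h.mul_left _).mul_right _
    · exact h.mul_left _
  have h5 := ((Nat.Prime.dvd_mul hℓ).1 h4).resolve_left fun h =>
        hℓ2 ((Nat.prime_dvd_prime_iff_eq hℓ Nat.prime_two).1 h)
  rw [← h1] at h5
  have h6 := ((Nat.Prime.dvd_mul hℓ).1 h5).resolve_right hI
  have := Fact.mk hℓ
  obtain ⟨s, hs⟩ := exists_prime_orderOf_dvd_card' ℓ h6
  exact ⟨s, by rw [Subgroup.orderOf_coe]; exact hs, s.2⟩

lemma ne_char {p : ℕ} [hp : Fact p.Prime] (hpq : p ∣ NC K) {ℓ e : ℕ}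
    (he : e = NC K - 1 ∨ e = NC K + 1) (hd : ℓ ∣ e) : ℓ ≠ p := by
  rintro rfl
  have h0 : 0 < NC K := Nat.card_pos
  have : ℓ ∣ 1 := by
    rcases he with rfl | rfl
    · have := (Nat.dvd_sub_iff_right (Nat.sub_le (NC K) 1) hpq).2 hd
      rwa [show NC K - (NC K - 1) = 1 by omega] at this
    · exact (Nat.dvd_add_right hpq).1 hd
  exact hp.out.one_lt.ne' (Nat.dvd_one.1 this)

lemma no_xy {p : ℕ} [hp : Fact p.Prime] [CharP K p] (hpq : p ∣ NC K) (hq : Odd (NC K)) (h2 : (2 : K) ≠ 0) {x y : ℕ}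
    (hx : x.Prime) (hx2 : x ≠ 2) (hxd : x ∣ NC K - 1) (hy : y.Prime) (hy2 : y ≠ 2) (hyd : y ∣ NC K + 1)
    (hnx : ∀ i, ¬ x ∣ F.n i) (hny : ∀ i, ¬ y ∣ F.n i) (hxI : ¬ x ∣ π.range.index) (hyI : ¬ y ∣ π.range.index) : False := by
  obtain ⟨s, hs, hsr⟩ := exists_ord hx h2 hx2 (inl hxd) hxI
  obtain ⟨s', hs', hsr'⟩ := exists_ord hy h2 hy2 (inr hyd) hyI
  obtain ⟨X, w, c, T, h3, h4⟩ := reg_tor hq h2 hx hx2 (ne_char hpq (inl rfl) hxd) (inl rfl) hxd hs hsr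
  obtain ⟨X', w', c', T', h3', h4'⟩ := reg_tor hq h2 hy hy2 (ne_char hpq (inr rfl) hyd) (inr rfl) hyd hs' hsr'
  refine F.star h2 T T' ?_ hx hx2 h3 hy hy2 h3' hnx hny
  refine Coprime.of_dvd h4 h4' ?_
  obtain ⟨m, hm⟩ := hq
  rw [hm, show (2 * m + 1 - 1) / 2 = m by omega, show (2 * m + 1 + 1) / 2 = m + 1 by omega]
  simp

lemma TD.inv {X : SL2 K} {w : Γ} {c : ℕ} (T : TD π X w c) {h : PSL2 K} (hh : h ∈ zpowers (π w))
    (h1 : h ≠ 1) (hs : h ^ 2 = 1) : ∃ b, c = 2 * b ∧ h = π w ^ b := by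
  classical
  obtain ⟨j, hjc, hj⟩ := Finset.mem_image.1 (mem_zpowers_iff_mem_range_orderOf.1 hh)
  refine ⟨j, ?_, hj.symm⟩
  rw [T.ht.1, mem_range] at hjc
  rw [← hj, ← pow_mul, tor_pow T.ht] at hs
  rw [← hj, Ne, tor_pow T.ht] at h1
  obtain ⟨m, hm⟩ := hs
  have : m = 1 := by
    have h0 : 0 < j := Nat.pos_of_ne_zero fun h => h1 (by simp [h])
    have : m < 2 := by
      by_contra! h
      have := Nat.mul_le_mul_left c h
      omega
    have : m ≠ 0 := by rintro rfl; omega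
    omega
  rw [this] at hm; omega

lemma TD.lift {X : SL2 K} {w : Γ} {c : ℕ} (T : TD π X w c) (h2 : (2 : K) ≠ 0) {h : PSL2 K} (hh : h ∈ zpowers (π w)) :
    (∃ g, π g = h ∧ F.Good g) ∨ ∃ b, c = 2 * b ∧ h = π w ^ b := by
  by_cases h1 : h = 1
  · exact inl ⟨1, by simp [h1], F.good_one⟩
  by_cases hs : h ^ 2 = 1
  · exact inr (T.inv hh h1 hs)
  · left
    obtain ⟨j, hj⟩ := hh
    have hj' : π (w ^ j) = h := by rw [map_zpow]; exact hj
    refine ⟨w ^ j, hj', T.good F h2 ?_ ?_⟩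
    · have : h ∈ zpowers (π w) := ⟨j, hj⟩
      rw [T.hz] at this
      rw [hj']; exact this.1
    · rw [hj']; exact hs

noncomputable def conj (s : PSL2 K) : Fam ((MulAut.conj s).toMonoidHom.comp π) where
  ι := F.ι
  fin := F.fin
  n := F.n
  ρ := F.ρ
  irr := F.irr
  ν := F.ν
  ν1 := F.ν1
  scal := fun z hz => F.scal z (by simpa using hz)
  orth := fun g h => by
    have e : ((MulAut.conj s).toMonoidHom.comp π).ker = π.ker := by
      ext z; simp [MonoidHom.mem_ker]
    rw [F.orth g h, e]
    congr 1
    refine sum_congr rfl fun x _ => ?_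
    congr 1
    simp

lemma tr4_of_diag {A : SL2 K} (h0 : A 1 0 = 0) (h : A 0 0 ^ 2 = 1) : tra A ^ 2 = 4 := by
  have hd := sl_det A
  rw [h0] at hd
  have : A 1 1 = A 0 0 := by linear_combination A 0 0 * hd - A 1 1 * h
  rw [tra, this]; linear_combination 4 * h

lemma B_conj {p : ℕ} [hp : Fact p.Prime] [CharP K p] {e : ℕ} (hpe : p.Coprime e) {a b x : PSL2 K} (ha : a ∈ BS) (hb : b ∈ BS) (hx : x ∈ BS)
    (hab : Commute a b) (hae : a ^ e = 1) (hbe : b ^ e = 1) (h : x⁻¹ * a * x = b) : a = b := by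
  obtain ⟨A, rfl⟩ := mkS_surj a
  obtain ⟨B, rfl⟩ := mkS_surj b
  obtain ⟨Y, rfl⟩ := mkS_surj x
  rw [mem_BS] at ha hb hx
  have h1 : mkS (A * Y) = mkS (Y * B) := by rw [map_mul, map_mul, ← h]; group
  have hY : Y 0 0 ≠ 0 := by
    intro h0
    have := sl_det Y
    rw [h0, hx] at this; simp at this
  have h3 : A 0 0 ^ 2 = B 0 0 ^ 2 := by
    rcases mkS_eq.1 h1 with h | h
    · have := congrArg (fun Z : SL2 K => Z 0 0) h
      simp only [sl_mul, hx, hb] at this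
      have : B 0 0 = A 0 0 := mul_left_cancel₀ hY (by linear_combination this)
      rw [this]
    · have := congrArg (fun Z : SL2 K => Z 0 0) h
      simp only [sl_neg, sl_mul, hx, hb] at this
      have : B 0 0 = - A 0 0 := mul_left_cancel₀ hY (by linear_combination this)
      rw [this]; ring
  have hB := sl_det B
  rw [hb] at hB
  have h4 : tra (A * B⁻¹) ^ 2 = 4 := by
    obtain ⟨i1, i2, i3, i4⟩ := sl_inv B
    apply tr4_of_diag
    · rw [sl_mul, i1, i3, ha, hb]; ring
    · rw [sl_mul, i1, i3, hb]
      linear_combination (B 1 1) ^ 2 * h3 + (B 0 0 * B 1 1 + 1) * hB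
  have h5 : (mkS A * (mkS B)⁻¹) ^ p = 1 := by
    rw [← map_inv, ← map_mul]
    exact unip_pow p (by rw [trsq_mk, h4])
  have h6 : (mkS A * (mkS B)⁻¹) ^ e = 1 := by
    rw [(hab.inv_right).mul_pow, hae, inv_pow, hbe]; simp
  have := Nat.dvd_gcd (orderOf_dvd_of_pow_eq_one h5) (orderOf_dvd_of_pow_eq_one h6)
  rw [hpe.gcd_eq_one] at this
  exact mul_inv_eq_one.1 (orderOf_eq_one_iff.1 (Nat.dvd_one.1 this))

lemma borel {p : ℕ} [hp : Fact p.Prime] [CharP K p] (hpq : p ∣ NC K) (hq : Odd (NC K)) (h2 : (2 : K) ≠ 0)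
    (hU : ∀ a : K, mkS (uu a) ∈ π.range) (hB : π.range ≤ BS)
    (hu : ∀ a : K, a ≠ 0 → ∀ g, π g = mkS (uu a) → F.Good g)
    {x : ℕ} (hx : x.Prime) (hx2 : x ≠ 2) (hxd : x ∣ NC K - 1)
    (hnx : ∀ i, ¬ x ∣ F.n i) (hxI : ¬ x ∣ π.range.index) : False := by
  classical
  obtain ⟨s, hs, hsr⟩ := exists_ord hx h2 hx2 (inl hxd) hxI
  obtain ⟨X, w, c, T, h3, h4⟩ := reg_tor hq h2 hx hx2 (ne_char hpq (inl rfl) hxd) (inl rfl) hxd hs hsr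
  have := ofFinite (PSL2 K)
  have hpc : p.Coprime c := by
    rw [hp.out.coprime_iff_not_dvd]
    intro h
    have : p ∣ NC K - 1 := (h.trans h4).trans (Nat.div_dvd_of_dvd (by
      obtain ⟨m, hm⟩ := hq; exact ⟨m, by omega⟩))
    exact ne_char hpq (inl rfl) this rfl
  let Z : Finset (PSL2 K) := univ.filter fun a => a ∈ zpowers (π w)
  have hZ : Z.card = c := by
    rw [← T.ht.1, ← card_zpowers, card_eq_fintype_card, Fintype.card_subtype]
  have hZm : ∀ a, a ∈ Z ↔ a ∈ zpowers (π w) := by simp [Z]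
  have hZr : ∀ a ∈ Z, a ∈ π.range ∧ a ^ c = 1 := by
    intro a ha
    rw [hZm] at ha
    have h := orderOf_dvd_of_mem_zpowers ha
    rw [T.ht.1] at h
    rw [T.hz] at ha
    exact ⟨ha.2, orderOf_dvd_iff_pow_eq_one.1 h⟩
  have hup : mkS (uu (1 : K)) ^ p = 1 := unip_pow p (by rw [trsq_mk, uu_tr]; norm_num)
  have hu1 : mkS (uu (1 : K)) ≠ 1 := by
    intro h
    have : US (Multiplicative.ofAdd (1 : K)) = US 1 := h.trans (map_one US).symm
    have := US_inj h2 this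
    exact one_ne_zero (congrArg Multiplicative.toAdd this)
  have hcop : ∀ a : PSL2 K, a ^ p = 1 → a ^ c = 1 → a = 1 := by
    intro a h h'
    have := Nat.dvd_gcd (orderOf_dvd_of_pow_eq_one h) (orderOf_dvd_of_pow_eq_one h')
    rw [hpc.gcd_eq_one] at this
    exact orderOf_eq_one_iff.1 (Nat.dvd_one.1 this)
  have count : ∀ A ⊆ Z, (∀ a ∈ A, ∃ g, π g = a ∧ F.Good g) → A.card + 1 ≤ Fintype.card F.ι := by
    intro A hA hg
    have hn : mkS (uu (1 : K)) ∉ A := fun h => hu1 (hcop _ hup (hZr _ (hA h)).2)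
    rw [← Finset.card_insert_of_notMem hn]
    apply F.lemKf
    · intro a ha
      rcases Finset.mem_insert.1 ha with rfl | ha
      · obtain ⟨g, hg⟩ := hU 1
        exact ⟨g, hg, hu 1 one_ne_zero g hg⟩
      · exact hg a ha
    · intro a ha b hb hab x hx h
      rcases Finset.mem_insert.1 ha with rfl | ha <;> rcases Finset.mem_insert.1 hb with rfl | hb
      · exact hab rfl
      · have : b = 1 := by
          refine hcop _ ?_ (hZr _ (hA hb)).2
          rw [← h, conj_pow', hup]; group
        rw [this] at h
        exact hu1 (conj_one h)
      · have : mkS (uu (1 : K)) = 1 := by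
          refine hcop _ hup ?_
          rw [← h, conj_pow', (hZr _ (hA ha)).2]; group
        exact hu1 this
      · have h1 := hZr _ (hA ha)
        have h1' := hZr _ (hA hb)
        refine hab (B_conj hpc (hB h1.1) (hB h1'.1) (hB hx) ?_ h1.2 h1'.2 h)
        obtain ⟨m, rfl⟩ := (hZm _).1 (hA ha)
        obtain ⟨m', rfl⟩ := (hZm _).1 (hA hb)
        exact (Commute.refl (π w)).zpow_zpow m m'
  rcases T.up F hx hx2 h3 hnx with ⟨ho, h⟩ | ⟨b, hb, hg, h⟩ | ⟨b, hb, h⟩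
  · have := count Z (Finset.Subset.refl _) (by
      intro a ha
      rcases T.lift F h2 ((hZm a).1 ha) with h | ⟨b, hb, _⟩
      · exact h
      · obtain ⟨m, hm⟩ := ho; omega)
    omega
  · have := count Z (Finset.Subset.refl _) (by
      intro a ha
      rcases T.lift F h2 ((hZm a).1 ha) with h | ⟨b', hb', h⟩
      · exact h
      · have : b = b' := by omega
        subst this
        exact ⟨w ^ b, by rw [h, map_pow], hg⟩)
    omega
  · have h0 : 0 < c := T.ht.1 ▸ orderOf_pos _
    have := count (Z.erase (π w ^ b)) (Finset.erase_subset _ _) (by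
      intro a ha
      rcases T.lift F h2 ((hZm a).1 (Finset.mem_of_mem_erase ha)) with h | ⟨b', hb', h⟩
      · exact h
      · have : b = b' := by omega
        subst this
        exact absurd h (Finset.ne_of_mem_erase ha))
    have h5 := Finset.pred_card_le_card_erase (s := Z) (a := π w ^ b)
    omega

end Fam

namespace Fam

variable {K : Type} [Field K] [Finite K] {Γ : Type} [Group Γ] [Fintype Γ] {π : Γ →* PSL2 K} (F : Fam π)

lemma comp2_ne {τ : K} (h : τ ≠ 0) : mkS (comp2 τ) ^ 2 ≠ 1 := by
  rw [← map_pow, Ne, mkS_one, pow_two]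
  have h0 : (comp2 τ * comp2 τ) 1 0 = τ := by rw [sl_mul]; simp [comp2]
  rintro (h1 | h1) <;> rw [h1] at h0
  · simp at h0; exact h h0.symm
  · rw [sl_neg] at h0; simp at h0; exact h h0.symm

lemma comp2_one (τ : K) : mkS (comp2 τ) ≠ 1 := by
  rw [Ne, mkS_one]
  have h0 : comp2 τ 1 0 = 1 := by simp [comp2]
  rintro (h1 | h1) <;> rw [h1] at h0
  · simp at h0
  · rw [sl_neg] at h0; simp at h0

lemma exists_nonsq (hq : Odd (NC K)) : ∃ δ : K, δ ≠ 0 ∧ ∀ t : K, δ ≠ t ^ 2 := by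
  have := ofFinite K
  have hc : ringChar K ≠ 2 := by
    intro h
    have := FiniteField.even_card_of_char_two h
    rw [card_eq_fintype_card, Nat.odd_iff] at hq
    omega
  obtain ⟨δ, hδ⟩ := FiniteField.exists_nonsquare hc
  refine ⟨δ, ?_, ?_⟩
  · rintro rfl; exact hδ ⟨0, by simp⟩
  · rintro t rfl; exact hδ ⟨t, by ring⟩

lemma lower (hq : Odd (NC K)) (h2 : (2 : K) ≠ 0) (ht : π.range = ⊤)
    (hu : ∀ a : K, a ≠ 0 → ∀ g, π g = mkS (uu a) → F.Good g) (E : Finset (PSL2 K)) (hE : E ⊆ {mkS (comp2 0)})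
    (hEg : ∀ a ∈ E, ∃ g, π g = a ∧ F.Good g) : NC K + 3 + 2 * E.card ≤ 2 * Fintype.card F.ι := by
  classical
  have := ofFinite K
  have h4 : (4 : K) ≠ 0 := by
    rw [show (4 : K) = 2 ^ 2 by norm_num]; exact pow_ne_zero 2 h2
  have hsurj : ∀ s, ∃ g, π g = s := fun s => by
    have : s ∈ π.range := by rw [ht]; trivial
    exact this
  obtain ⟨δ, hδ0, hδ⟩ := exists_nonsq hq
  let V : Finset K := ((univ.erase 0).erase 2).erase (-2)
  have hV : ∀ τ ∈ V, τ ≠ 0 ∧ τ ^ 2 ≠ 4 := by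
    intro τ hτ
    simp only [V, mem_erase, Finset.mem_univ, and_true] at hτ
    refine ⟨hτ.2.2, fun h => ?_⟩
    have : (τ - 2) * (τ + 2) = 0 := by linear_combination h
    rcases mul_eq_zero.1 this with h | h
    · exact hτ.2.1 (by linear_combination h)
    · exact hτ.1 (by linear_combination h)
  have hVc : NC K ≤ V.card + 3 := by
    have e1 := Finset.pred_card_le_card_erase (s := (univ.erase (0 : K)).erase 2) (a := -2)
    have e2 := Finset.pred_card_le_card_erase (s := (univ.erase (0 : K))) (a := 2)
    have e3 := Finset.pred_card_le_card_erase (s := (univ : Finset K)) (a := 0)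
    rw [card_univ] at e3
    rw [card_eq_fintype_card]
    have e4 : V.card = (((univ.erase (0 : K)).erase 2).erase (-2)).card := rfl
    omega
  obtain ⟨A, hA, hi, hAc⟩ := exists_section V (fun τ => τ ^ 2) 2 (by
    intro b hb
    obtain ⟨a, ha, rfl⟩ := Finset.mem_image.1 hb
    refine (Finset.card_le_card (t := {a, -a}) ?_).trans Finset.card_le_two
    intro a' ha'
    simp only [mem_filter] at ha'
    simpa using sq_eq_sq_iff_eq_or_eq_neg.1 ha'.2)
  let A' := A.image fun τ => mkS (comp2 τ)
  have htr : ∀ τ : K, trsq (mkS (comp2 τ)) = τ ^ 2 := fun τ => by rw [trsq_mk, comp2_tr]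
  have hA'c : A'.card = A.card := Finset.card_image_of_injOn fun a ha b hb h => by
    apply hi ha hb
    have := congrArg trsq h
    simpa only [htr] using this
  have hA' : ∀ a ∈ A', trsq a ≠ 0 ∧ trsq a ≠ 4 ∧ ∃ g, π g = a ∧ F.Good g := by
    intro a ha
    obtain ⟨τ, hτ, rfl⟩ := Finset.mem_image.1 ha
    have hv := hV _ (hA hτ)
    simp only [htr]
    refine ⟨pow_ne_zero 2 hv.1, hv.2, ?_⟩
    obtain ⟨w, c, T⟩ := mk_tor (π := π) h2 (X := comp2 τ) (by rw [comp2_tr]; exact hv.2)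
    obtain ⟨g, hg⟩ := hsurj (mkS (comp2 τ))
    exact ⟨g, hg, T.good F h2 (by rw [hg]; exact tor_self _) (by rw [hg]; exact comp2_ne hv.1)⟩
  have hAn : ∀ a ∈ A', ∀ b ∈ A', trsq a = trsq b → a = b := by
    intro a ha b hb h
    obtain ⟨τ, hτ, rfl⟩ := Finset.mem_image.1 ha
    obtain ⟨τ', hτ', rfl⟩ := Finset.mem_image.1 hb
    simp only [htr] at h
    rw [hi hτ hτ' h]
  have hutr : ∀ a : K, trsq (mkS (uu a)) = 4 := fun a => by rw [trsq_mk, uu_tr]; norm_num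
  have hE0 : ∀ a ∈ E, a = mkS (comp2 0) := fun a ha => by simpa using hE ha
  have hEt : ∀ a ∈ E, trsq a = 0 := fun a ha => by rw [hE0 a ha, htr]; simp
  let Uf : Finset K := {0, 1, δ}
  have hUn : ∀ a ∈ Uf, ∀ b ∈ Uf, a ≠ b → ∀ x : PSL2 K, x⁻¹ * mkS (uu a) * x ≠ mkS (uu b) := by
    intro a ha b hb hab x h
    have hu0 : ∀ b : K, mkS (uu b) = 1 → b = 0 := fun b h => by
      have : US (Multiplicative.ofAdd b) = US 1 := h.trans (map_one US).symm
      exact congrArg Multiplicative.toAdd (US_inj h2 this)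
    by_cases ha0 : a = 0
    · rw [ha0, uu_zero, map_one] at h
      exact hab (by rw [ha0, hu0 b (by rw [← h]; group)])
    by_cases hb0 : b = 0
    · rw [hb0, uu_zero, map_one] at h
      exact hab (by rw [hb0, hu0 a (conj_one h)])
    simp only [Uf, Finset.mem_insert, Finset.mem_singleton] at ha hb
    have hl : x⁻¹ * mkS (uu a) * x⁻¹⁻¹ = mkS (uu b) := by rw [inv_inv]; exact h
    have hr : x * mkS (uu b) * x⁻¹ = mkS (uu a) := by rw [← h]; group
    rcases ha with ha | ha | ha <;> rcases hb with hb | hb | hb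
    · exact ha0 ha
    · exact ha0 ha
    · exact ha0 ha
    · exact hb0 hb
    · exact hab (ha.trans hb.symm)
    · obtain ⟨t, ht⟩ := uu_conj h2 ha0 hl
      rw [ha, hb, mul_one] at ht; exact hδ t ht
    · exact hb0 hb
    · obtain ⟨t, ht⟩ := uu_conj h2 hb0 hr
      rw [ha, hb, mul_one] at ht; exact hδ t ht
    · exact hab (ha.trans hb.symm)
  have hUf : Uf.card = 3 := by
    have : (1 : K) ≠ δ := fun h => hδ 1 (by rw [← h]; ring)
    simp only [Uf]
    rw [Finset.card_insert_of_notMem, Finset.card_pair this]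
    simp [hδ0.symm]
  let U' := Uf.image fun a => mkS (uu a)
  have hU'c : U'.card = 3 := by
    rw [← hUf]
    exact Finset.card_image_of_injOn fun a ha b hb h => by
      by_contra hab
      exact hUn a ha b hb hab 1 (by simpa using h)
  have hU't : ∀ a ∈ U', trsq a = 4 := by
    intro a ha
    obtain ⟨b, _, rfl⟩ := Finset.mem_image.1 ha
    exact hutr b
  have d1 : Disjoint A' U' := by
    rw [Finset.disjoint_left]; intro a ha hb; exact (hA' a ha).2.1 (hU't a hb)
  have d2 : Disjoint (A' ∪ U') E := by
    rw [Finset.disjoint_left]; intro a ha hb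
    rcases Finset.mem_union.1 ha with ha | ha
    · exact (hA' a ha).1 (hEt a hb)
    · exact h4 ((hU't a ha).symm.trans (hEt a hb))
  have key := F.lemKf (A' ∪ U' ∪ E) (by
    intro a ha
    rcases Finset.mem_union.1 ha with ha | ha
    · rcases Finset.mem_union.1 ha with ha | ha
      · exact (hA' a ha).2.2
      · obtain ⟨b, _, rfl⟩ := Finset.mem_image.1 ha
        by_cases hb : b = 0
        · exact ⟨1, by rw [hb, uu_zero, map_one, map_one], F.good_one⟩
        · obtain ⟨g, hg⟩ := hsurj (mkS (uu b))
          exact ⟨g, hg, hu b hb g hg⟩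
    · exact hEg a ha) (by
    intro a ha b hb hab x _ h
    have e : trsq a = trsq b := by rw [← h, trsq_conj']
    rcases Finset.mem_union.1 ha with ha | ha <;> rcases Finset.mem_union.1 hb with hb | hb
    · rcases Finset.mem_union.1 ha with ha | ha <;> rcases Finset.mem_union.1 hb with hb | hb
      · exact hab (hAn a ha b hb e)
      · exact (hA' a ha).2.1 (e.trans (hU't b hb))
      · exact (hA' b hb).2.1 (e.symm.trans (hU't a ha))
      · obtain ⟨a', ha', rfl⟩ := Finset.mem_image.1 ha
        obtain ⟨b', hb', rfl⟩ := Finset.mem_image.1 hb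
        exact hUn a' ha' b' hb' (fun h => hab (by rw [h])) x h
    · exact Finset.disjoint_left.1 d2 ha (by
        exfalso
        rcases Finset.mem_union.1 ha with ha | ha
        · exact (hA' a ha).1 (e.trans (hEt b hb))
        · exact h4 ((hU't a ha).symm.trans (e.trans (hEt b hb))))
    · exfalso
      rcases Finset.mem_union.1 hb with hb | hb
      · exact (hA' b hb).1 (e.symm.trans (hEt a ha))
      · exact h4 ((hU't b hb).symm.trans (e.symm.trans (hEt a ha)))
    · exact hab ((hE0 a ha).trans (hE0 b hb).symm))
  rw [Finset.card_union_of_disjoint d2, Finset.card_union_of_disjoint d1, hA'c, hU'c] at key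
  obtain ⟨m, hm⟩ := hq
  omega

lemma cen_card (h2 : (2 : K) ≠ 0) {X : SL2 K} {w : Γ} {c : ℕ} (ht : π.range = ⊤) (T : TD π X w c) :
    NC (cen π (mkS X)) ≤ 2 * c := by
  classical
  have hz : tor X = zpowers (π w) := by rw [T.hz, ht, inf_top_eq]
  have hc : NC (tor X) = c := by rw [hz, card_zpowers, T.ht.1]
  have hsub : ∀ y y', Commute (mkS X) y → Commute (mkS X) y' → y ∉ tor X →
      y' ∉ tor X → y⁻¹ * y' ∈ tor X := by
    intro y y' hy hy' hn hn'
    obtain ⟨Y, rfl⟩ := mkS_surj y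
    obtain ⟨Y', rfl⟩ := mkS_surj y'
    have key : ∀ Y : SL2 K, Commute (mkS X) (mkS Y) → mkS Y ∉ tor X →
        Y * X = - (X * Y) := by
      intro Y hY hn
      have : mkS (X * Y) = mkS (Y * X) := by rw [map_mul, map_mul]; exact hY
      rcases mkS_eq.1 this with h | h
      · exact absurd (mem_tor.2 ⟨Y, h, rfl⟩) hn
      · exact h
    have k1 := key Y hy hn
    have k2 := key Y' hy' hn'
    refine mem_tor.2 ⟨Y⁻¹ * Y', ?_, by rw [map_mul, map_inv]⟩
    have k3 : X * Y = - (Y * X) := by rw [k1, neg_neg]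
    have : Y⁻¹ * Y' * X = Y⁻¹ * (- (X * Y')) := by rw [mul_assoc, k2]
    rw [Commute, SemiconjBy, this]
    have : Y⁻¹ * X = -(X * Y⁻¹) := by
      rw [inv_mul_eq_iff_eq_mul, mul_neg, ← mul_assoc, k1, neg_mul, neg_neg, mul_assoc, mul_inv_cancel, mul_one]
    rw [mul_neg, ← mul_assoc, this, neg_mul, neg_neg, mul_assoc]
  have hle : ∃ y0 : PSL2 K, ((cen π (mkS X) : Set (PSL2 K))) ⊆
      (tor X : Set (PSL2 K)) ∪ (fun z => y0 * z) '' (tor X : Set (PSL2 K)) := by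
    by_cases h : ∃ y0, Commute (mkS X) y0 ∧ y0 ∉ tor X
    · obtain ⟨y0, h0, h1⟩ := h
      refine ⟨y0, fun y hy => ?_⟩
      by_cases hy' : y ∈ tor X
      · exact inl hy'
      · right
        have : Commute (mkS X) y := mem_centralizer_singleton_iff.1 hy.1 |>.symm
        exact ⟨_, hsub y0 y h0 this h1 hy', by simp⟩
    · push Not at h
      refine ⟨1, fun y hy => inl (h y ?_)⟩
      exact mem_centralizer_singleton_iff.1 hy.1 |>.symm
  obtain ⟨y0, h0⟩ := hle
  have e1 := Set.ncard_le_ncard h0 (Set.toFinite _)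
  have e2 := Set.ncard_union_le (tor X : Set (PSL2 K)) ((fun z => y0 * z) '' (tor X : Set (PSL2 K)))
  have e3 := Set.ncard_image_le (f := fun z => y0 * z) (Set.toFinite (tor X : Set (PSL2 K)))
  have e4 : (tor X : Set (PSL2 K)).ncard = NC (tor X) := (Nat.card_coe_set_eq _).symm
  have e5 : (cen π (mkS X) : Set (PSL2 K)).ncard = NC (cen π (mkS X)) := (Nat.card_coe_set_eq _).symm
  omega

lemma full_two (hq : Odd (NC K)) (h2 : (2 : K) ≠ 0) (hq29 : 29 ≤ NC K) (ht : π.range = ⊤)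
    (hu : ∀ a : K, a ≠ 0 → ∀ g, π g = mkS (uu a) → F.Good g) : ∃ i, 2 ∣ F.n i := by
  classical
  by_contra! hn
  have h4 : (4 : K) ≠ 0 := by
    rw [show (4 : K) = 2 ^ 2 by norm_num]; exact pow_ne_zero 2 h2
  have hX : tra (comp2 (0 : K)) ^ 2 ≠ 4 := by rw [comp2_tr]; simpa using h4.symm
  obtain ⟨w, c, T⟩ := mk_tor (π := π) h2 hX
  have hmem : mkS (comp2 (0 : K)) ∈ zpowers (π w) := by
    rw [T.hz, ht]; exact ⟨tor_self _, trivial⟩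
  obtain ⟨b, hb, htw⟩ := T.inv hmem (comp2_one 0) (trsq_one_or (by rw [trsq_mk, comp2_tr]; simp))
  have hc0 : 0 < c := T.ht.1 ▸ orderOf_pos _
  have hcle : 2 * c ≤ NC K + 1 := by
    have hw : π w ∈ tor (comp2 (0 : K)) := by
      have : π w ∈ zpowers (π w) := Subgroup.mem_zpowers _
      rw [T.hz] at this; exact this.1
    obtain ⟨m, hm⟩ := hq
    rcases tor_exp ⟨m, hm⟩ hX with h | h
    · have := le_of_dvd (by omega) (orderOf_dvd_of_pow_eq_one (h _ hw))
      rw [T.ht.1] at this; omega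
    · have := le_of_dvd (by omega) (orderOf_dvd_of_pow_eq_one (h _ hw))
      rw [T.ht.1] at this; omega
  have hone : ∀ i, 1 ≤ ‖F.χ i (w ^ b)‖ ^ 2 := by
    intro i
    obtain ⟨A, B, _, _, h1, h3, _⟩ := F.dft_even i (w ^ b) (b := 1) one_ne_zero (by
      rw [map_pow, ← htw, mul_one]; exact trsq_one_or (by rw [trsq_mk, comp2_tr]; simp))
    rw [pow_one] at h3
    rw [h3]
    have hne : ((A : ℤ) - B) ≠ 0 := by
      intro h
      apply hn i
      exact ⟨A, by omega⟩
    have := Int.one_le_abs hne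
    have h5 : (1 : ℤ) ≤ ((A : ℤ) - B) ^ 2 := by
      rw [← sq_abs]; nlinarith
    exact_mod_cast h5
  have hg : F.Good (w ^ b) := by
    by_contra h
    obtain ⟨i⟩ := (inferInstance : Nonempty F.ι)
    have := hone i
    rw [F.bad h i] at this
    norm_num at this
  have hk := F.lower hq h2 ht hu ∅ (by simp) (by simp)
  have hsum := F.norm_sum hg
  rw [map_pow, ← htw] at hsum
  have hcen : ((NC (cen π (mkS (comp2 (0 : K))))) : ℝ) ≤ 4 * b := by
    have := cen_card h2 ht T
    have : NC (cen π (mkS (comp2 (0 : K)))) ≤ 4 * b := by omega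
    exact_mod_cast this
  have hk1 : Fintype.card F.ι ≤ 4 * b := by
    have : ((Fintype.card F.ι : ℕ) : ℝ) ≤ ∑ i, ‖F.χ i (w ^ b)‖ ^ 2 := by
      have := sum_le_sum fun i (_ : i ∈ (univ : Finset F.ι)) => hone i
      simpa using this
    rw [hsum] at this
    exact_mod_cast this.trans hcen
  by_cases hb3 : b ≤ 3
  · simp only [Finset.card_empty] at hk; omega
  have hT := T.ht
  rw [hb] at hT
  have hex := F.up_even' hT (by omega)
  set P : F.ι → Prop := fun i => (b ∣ F.n i ∧ (¬ 2 ∣ F.n i → (b : ℝ) ^ 2 ≤ ‖F.χ i (w ^ b)‖ ^ 2)) with hP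
  have hj := F.count_le (P := P) (f := fun i => ‖F.χ i (w ^ b)‖ ^ 2) (t := (b : ℝ) ^ 2) (fun i => by positivity)
    (fun i hi => hi.2 (hn i)) (hsum.le.trans hcen)
  have hj' : (univ.filter P).card * b ≤ 4 := by
    have hb0 : (0 : ℝ) < b := by
      have : 0 < b := by omega
      exact_mod_cast this
    have : ((univ.filter P).card : ℝ) * b ≤ 4 := by
      refine le_of_mul_le_mul_right ?_ hb0
      nlinarith
    exact_mod_cast this
  have hs := Finset.card_filter_add_card_filter_not (s := (univ : Finset F.ι)) P
  rw [card_univ] at hs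
  have hex' : (univ.filter fun i => ¬ P i).card ≤ 2 * b := hex
  simp only [Finset.card_empty] at hk
  rcases Nat.lt_or_ge (univ.filter P).card 1 with h | h
  · omega
  · have : b ≤ 4 := le_trans (by nlinarith) hj'
    have : b = 4 := by omega
    subst this
    omega

lemma core1 {p : ℕ} [hp : Fact p.Prime] [CharP K p] (hpq : p ∣ NC K) (hq : Odd (NC K)) (h2 : (2 : K) ≠ 0) (hq29 : 29 ≤ NC K)
    {x y : ℕ} (hx : x.Prime) (hx2 : x ≠ 2) (hxd : x ∣ NC K - 1) (hy : y.Prime) (hy2 : y ≠ 2) (hyd : y ∣ NC K + 1)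
    (hnx : ∀ i, ¬ p * x ∣ π.range.index * F.n i) (hny : ∀ i, ¬ p * y ∣ π.range.index * F.n i)
    (hU : ∀ a : K, mkS (uu a) ∈ π.range)
    {ℓ : ℕ} (hℓ : ℓ.Prime) (hℓd : ℓ ∣ NC K - 1 ∨ ℓ ∣ NC K + 1) : ∃ i, ℓ ∣ π.range.index * F.n i := by
  obtain ⟨i0⟩ := (inferInstance : Nonempty F.ι)
  have cx : p.Coprime x := (Nat.coprime_primes hp.out hx).2 (ne_char hpq (inl rfl) hxd).symm
  have cy : p.Coprime y := (Nat.coprime_primes hp.out hy).2 (ne_char hpq (inr rfl) hyd).symm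
  by_cases hB : π.range ≤ BS
  · have hI : NC K + 1 ∣ π.range.index := by
      rw [← index_BS]; exact Subgroup.index_dvd_of_le hB
    by_cases hℓ1 : ℓ ∣ NC K + 1
    · exact ⟨i0, (hℓ1.trans hI).mul_right _⟩
    have hℓ2 : ℓ ≠ 2 := by
      rintro rfl
      apply hℓ1
      obtain ⟨m, hm⟩ := hq
      exact ⟨m + 1, by omega⟩
    by_contra! hcon
    rcases F.upart (p := p) h2 with hu | hu
    · apply hny i0
      rw [mul_comm]
      exact mul_dvd_mul (hyd.trans hI) (hu i0)
    · exact F.borel hpq hq h2 hU hB hu hℓ hℓ2 (hℓd.resolve_right hℓ1) (fun i h => hcon i (h.mul_left _))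
        (fun h => hcon i0 (h.mul_right _))
  · have ht := gen_top hU hB
    have hI : π.range.index = 1 := by rw [ht, Subgroup.index_top]
    simp only [hI, one_mul] at hnx hny ⊢
    rcases F.upart (p := p) h2 with hu | hu
    · exfalso
      refine F.no_xy hpq hq h2 hx hx2 hxd hy hy2 hyd (fun i h => hnx i (cx.mul_dvd_of_dvd_of_dvd (hu i) h))
        (fun i h => hny i (cy.mul_dvd_of_dvd_of_dvd (hu i) h)) ?_ ?_
      · rw [hI]; exact hx.one_lt.ne' ∘ Nat.dvd_one.1
      · rw [hI]; exact hy.one_lt.ne' ∘ Nat.dvd_one.1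
    · by_cases hℓ2 : ℓ = 2
      · subst hℓ2
        exact F.full_two hq h2 hq29 ht hu
      by_contra! hcon
      obtain ⟨s, hs, hsr⟩ := exists_ord (π := π) hℓ h2 hℓ2 hℓd (by rw [hI]; exact hℓ.one_lt.ne' ∘ Nat.dvd_one.1)
      have hk := F.lower hq h2 ht hu ∅ (by simp) (by simp)
      simp only [Finset.card_empty] at hk
      obtain ⟨m, hm⟩ := hq
      rcases hℓd with hd | hd
      · obtain ⟨X, w, c, T, h3, h4⟩ := reg_tor ⟨m, hm⟩ h2 hℓ hℓ2 (ne_char hpq (inl rfl) hd) (inl rfl) hd hs hsr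
        have := T.up' F hℓ hℓ2 h3 hcon
        have := le_of_dvd (by omega) h4
        omega
      · obtain ⟨X, w, c, T, h3, h4⟩ := reg_tor ⟨m, hm⟩ h2 hℓ hℓ2 (ne_char hpq (inr rfl) hd) (inr rfl) hd hs hsr
        have := T.up' F hℓ hℓ2 h3 hcon
        have := le_of_dvd (by omega) h4
        omega

theorem core {p : ℕ} [hp : Fact p.Prime] [CharP K p] (hpq : p ∣ NC K) (hq : Odd (NC K)) (h2 : (2 : K) ≠ 0) (hq29 : 29 ≤ NC K)
    {x y : ℕ} (hx : x.Prime) (hx2 : x ≠ 2) (hxd : x ∣ NC K - 1) (hy : y.Prime) (hy2 : y ≠ 2) (hyd : y ∣ NC K + 1)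
    (hnx : ∀ i, ¬ p * x ∣ π.range.index * F.n i) (hny : ∀ i, ¬ p * y ∣ π.range.index * F.n i)
    {ℓ : ℕ} (hℓ : ℓ.Prime) (hℓd : ℓ ∣ NC K - 1 ∨ ℓ ∣ NC K + 1) : ∃ i, ℓ ∣ π.range.index * F.n i := by
  obtain ⟨i0⟩ := (inferInstance : Nonempty F.ι)
  have cx : p.Coprime x := (Nat.coprime_primes hp.out hx).2 (ne_char hpq (inl rfl) hxd).symm
  have cy : p.Coprime y := (Nat.coprime_primes hp.out hy).2 (ne_char hpq (inr rfl) hyd).symm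
  by_cases hpI : p ∣ π.range.index
  · exfalso
    exact F.no_xy hpq hq h2 hx hx2 hxd hy hy2 hyd (fun i h => hnx i (mul_dvd_mul hpI h))
      (fun i h => hny i (mul_dvd_mul hpI h)) (fun h => hnx i0 ((cx.mul_dvd_of_dvd_of_dvd hpI h).mul_right _))
      (fun h => hny i0 ((cy.mul_dvd_of_dvd_of_dvd hpI h).mul_right _))
  let act : MulAction (Multiplicative K) (PSL2 K ⧸ π.range) := MulAction.compHom _ US
  have hP : IsPGroup p (Multiplicative K) := fun g => ⟨1, by
    rw [pow_one]
    apply Multiplicative.toAdd.injective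
    rw [toAdd_pow, toAdd_one, nsmul_eq_mul, CharP.cast_eq_zero, zero_mul]⟩
  obtain ⟨z, hz⟩ := hP.nonempty_fixed_point_of_prime_not_dvd_card (PSL2 K ⧸ π.range) hpI
  obtain ⟨s, rfl⟩ := QuotientGroup.mk_surjective z
  have hs : ∀ a : K, s⁻¹ * mkS (uu a) * s ∈ π.range := by
    intro a
    have : ((mkS (uu a) * s : PSL2 K) : PSL2 K ⧸ π.range) = s := hz (Multiplicative.ofAdd a)
    have := QuotientGroup.eq.1 this.symm
    rwa [← mul_assoc] at this
  have hr : ((MulAut.conj s⁻¹⁻¹).toMonoidHom.comp π).range.index = π.range.index := by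
    rw [MonoidHom.range_comp]
    exact Subgroup.index_map_equiv π.range (MulAut.conj s⁻¹⁻¹)
  have := (F.conj s⁻¹⁻¹).core1 hpq hq h2 hq29 hx hx2 hxd hy hy2 hyd (by rw [hr]; exact hnx) (by rw [hr]; exact hny) (by
    intro a
    obtain ⟨g, hg⟩ := hs a
    refine ⟨g, ?_⟩
    simp only [inv_inv, MonoidHom.comp_apply, hg, MulEquiv.coe_toMonoidHom, MulAut.conj_apply]
    group) hℓ hℓd
  rw [hr] at this
  exact this

end Fam

section PS

variable {K : Type} [Field K] [Finite K]

lemma lam_zero (lam : MulChar K ℂ) : lam 0 = 0 := lam.map_nonunit not_isUnit_zero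

lemma exists_lam (hq : Odd (NC K)) : ∃ lam : MulChar K ℂ, ∀ t : K, lam t = 1 ↔ t ^ 2 = 1 := by
  classical
  have := ofFinite K
  have hc1 : 1 < Fintype.card K := Fintype.one_lt_card
  have : NeZero (Fintype.card Kˣ) := ⟨Fintype.card_ne_zero⟩
  obtain ⟨χ, hχ⟩ := MulChar.exists_mulChar_orderOf K (n := Fintype.card Kˣ) (R := ℂ) (by rw [Fintype.card_units])
    (isPrimitiveRoot_exp _ Fintype.card_ne_zero)
  obtain ⟨ζ, hζ⟩ := IsCyclic.exists_generator (α := Kˣ)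
  have hinj : ∀ t : Kˣ, χ (t : K) = 1 → t = 1 := by
    intro t ht
    obtain ⟨m, hm⟩ := mem_powers_iff_mem_zpowers.2 (hζ t)
    simp only at hm
    have : χ ^ m = 1 := by
      ext u
      obtain ⟨l, hl⟩ := mem_powers_iff_mem_zpowers.2 (hζ u)
      simp only at hl
      rw [← hl, MulChar.pow_apply_coe, MulChar.one_apply_coe]
      rw [← hm] at ht
      push_cast at ht ⊢
      rw [map_pow, ← pow_mul, mul_comm, pow_mul, ← map_pow, ht, one_pow]
    have h1 := orderOf_dvd_of_pow_eq_one this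
    rw [hχ] at h1
    rw [← hm]
    have := orderOf_dvd_card (x := ζ)
    exact orderOf_dvd_iff_pow_eq_one.1 (this.trans h1)
  refine ⟨χ ^ 2, fun t => ?_⟩
  by_cases ht : t = 0
  · subst ht
    rw [MulChar.map_nonunit _ not_isUnit_zero]; simp
  · rw [MulChar.pow_apply' _ two_ne_zero, ← map_pow]
    constructor
    · intro h
      have := hinj (Units.mk0 t ht ^ 2) (by simpa using h)
      simpa using congrArg Units.val this
    · intro h; rw [h, map_one]

def TT (g : SL2 K) : (K → K → ℂ) →ₗ[ℂ] (K → K → ℂ) where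
  toFun f a b := f (a * g 0 0 + b * g 1 0) (a * g 0 1 + b * g 1 1)
  map_add' f f' := rfl
  map_smul' c f := rfl

def PV (lam : MulChar K ℂ) : Submodule ℂ (K → K → ℂ) where
  carrier := {f | ∀ t a b, f (t * a) (t * b) = lam t * f a b}
  add_mem' := by intro f f' h h' t a b; simp only [Pi.add_apply, h t a b, h' t a b]; ring
  zero_mem' := by intro t a b; simp
  smul_mem' := by intro c f h t a b; simp only [Pi.smul_apply, h t a b, smul_eq_mul]; ring

lemma TT_mem {lam : MulChar K ℂ} (g : SL2 K) {f} (hf : f ∈ PV lam) : TT g f ∈ PV lam := by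
  intro t a b
  change f _ _ = lam t * f _ _
  rw [← hf t]
  congr 1 <;> ring

def PR0 (lam : MulChar K ℂ) : SL2 K →* EC (PV lam) where
  toFun g := (TT g).restrict fun f hf => TT_mem g hf
  map_one' := by
    ext f a b
    change f.1 _ _ = f.1 a b
    simp
  map_mul' g h := by
    ext f a b
    change f.1 _ _ = f.1 _ _
    simp only [sl_mul]
    congr 1 <;> ring

def PR (lam : MulChar K ℂ) (hl : lam (-1) = 1) : PSL2 K →* EC (PV lam) :=
  QuotientGroup.lift _ (PR0 lam) (by
    intro g hg
    rcases mem_cen.1 hg with rfl | rfl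
    · exact map_one _
    · ext f a b
      change f.1 _ _ = f.1 a b
      have := f.2 (-1) a b
      rw [hl, one_mul] at this
      rw [← this]
      congr 1 <;> simp [sl_neg])

lemma PR_apply (lam : MulChar K ℂ) (hl : lam (-1) = 1) (g : SL2 K) (f : PV lam) (a b : K) :
    (PR lam hl (mkS g) f).1 a b = f.1 (a * g 0 0 + b * g 1 0) (a * g 0 1 + b * g 1 1) := rfl

open Classical in
noncomputable def pv (lam : MulChar K ℂ) (φ : Option K → ℂ) : PV lam :=
  ⟨fun a b => lam a * φ (some (b / a)) + if a = 0 then lam b * φ none else 0, by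
    intro t a b
    by_cases ht : t = 0
    · subst ht; simp [lam_zero]
    by_cases ha : a = 0
    · subst ha; simp [lam_zero]; ring
    · simp [ha, ht, mul_div_mul_left]; ring⟩

lemma pv_ext {lam : MulChar K ℂ} {f f' : PV lam} (h1 : ∀ b, f.1 1 b = f'.1 1 b) (h0 : f.1 0 1 = f'.1 0 1) : f = f' := by
  ext a b
  by_cases ha : a = 0
  · subst ha
    have e := f.2 b 0 1
    have e' := f'.2 b 0 1
    rw [mul_zero, mul_one] at e e'
    rw [e, e', h0]
  · have e := f.2 a 1 (b / a)
    have e' := f'.2 a 1 (b / a)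
    rw [mul_one, mul_div_cancel₀ _ ha] at e e'
    rw [e, e', h1]

lemma pv_one (lam : MulChar K ℂ) (φ) (b : K) : (pv lam φ).1 1 b = φ (some b) := by simp [pv]
lemma pv_zero (lam : MulChar K ℂ) (φ) : (pv lam φ).1 0 1 = φ none := by simp [pv, lam_zero]

noncomputable def pvE (lam : MulChar K ℂ) : PV lam ≃ₗ[ℂ] (Option K → ℂ) where
  toFun f o := match o with
    | some b => f.1 1 b
    | none => f.1 0 1
  map_add' f f' := by ext o; cases o <;> rfl
  map_smul' c f := by ext o; cases o <;> rfl
  invFun φ := pv lam φ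
  left_inv f := pv_ext (fun b => by rw [pv_one]) (by rw [pv_zero])
  right_inv φ := by
    ext o; cases o
    · exact pv_zero lam φ
    · exact pv_one lam φ _

instance (lam : MulChar K ℂ) : FiniteDimensional ℂ (PV lam) := Module.Finite.equiv (pvE lam).symm

lemma pv_rank (lam : MulChar K ℂ) : finrank ℂ (PV lam) = NC K + 1 := by
  have := ofFinite K
  rw [(pvE lam).finrank_eq, Module.finrank_fintype_fun_eq_card, Fintype.card_option, card_eq_fintype_card]

lemma PR_uu (lam : MulChar K ℂ) (hl : lam (-1) = 1) (c : K) (f : PV lam) :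
    (∀ b, (PR lam hl (mkS (uu c)) f).1 1 b = f.1 1 (c + b)) ∧ (PR lam hl (mkS (uu c)) f).1 0 1 = f.1 0 1 := by
  obtain ⟨h1, h2, h3, h4⟩ := uu_e c
  simp [PR_apply, h1, h2, h3, h4]

lemma PR_dg (lam : MulChar K ℂ) (hl : lam (-1) = 1) (t : Kˣ) (f : PV lam) :
    (∀ b, (PR lam hl (mkS (dg t)) f).1 1 b = lam t * f.1 1 (((t⁻¹ : Kˣ) : K) ^ 2 * b)) ∧
      (PR lam hl (mkS (dg t)) f).1 0 1 = lam ((t⁻¹ : Kˣ) : K) * f.1 0 1 := by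
  obtain ⟨h1, h2, h3, h4⟩ := dg_e t
  simp only [PR_apply, h1, h2, h3, h4]
  constructor
  · intro b
    rw [← f.2]
    refine congrArg₂ _ (by ring) ?_
    rw [← mul_assoc, pow_two, ← mul_assoc, Units.mul_inv]; ring
  · rw [← f.2]; exact congrArg₂ _ (by ring) (by ring)

lemma PR_irr (lam : MulChar K ℂ) (hl : lam (-1) = 1) {t : Kˣ} (ht : lam (t : K) ^ 2 ≠ 1) : IrrR (PR lam hl) := by
  classical
  have := ofFinite K
  have hN : Nontrivial (PV lam) := by
    apply nontrivial_of_finrank_pos (R := ℂ)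
    rw [pv_rank]; omega
  refine ⟨hN, fun P hP => ?_⟩
  by_cases h0 : P = ⊥
  · exact inl h0
  right
  obtain ⟨f, hf, hf0⟩ := (ne_bot_iff P).1 h0
  have hJ : ∃ f ∈ P, f.1 0 1 ≠ 0 := by
    by_contra! hcon
    apply hf0
    refine pv_ext (fun b => ?_) (hcon f hf)
    let g : SL2 K := ⟨!![0, -1; 1, b], by simp [det_fin_two]⟩
    have h1 := hcon _ (hP (mkS g) f hf)
    rw [PR_apply lam hl g] at h1
    simpa [g] using h1
  obtain ⟨f, hf, hf0⟩ := hJ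
  let einf : PV lam := pv lam (fun o => if o = none then 1 else 0)
  let s : ℂ := ∑ c, f.1 1 c
  let fb : PV lam := ∑ c : K, PR lam hl (mkS (uu c)) f
  have hfb : fb ∈ P := Submodule.sum_mem _ fun c _ => hP _ _ hf
  have hco : ∀ a b, fb.1 a b = ∑ c : K, (PR lam hl (mkS (uu c)) f).1 a b := by
    intro a b
    simp only [fb, AddSubmonoidClass.coe_finset_sum, Finset.sum_apply]
  have hfb1 : ∀ b, fb.1 1 b = s := by
    intro b
    rw [hco]
    simp only [(PR_uu lam hl _ f).1]
    exact Fintype.sum_equiv (Equiv.addRight b) _ _ (fun c => rfl)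
  have hfb0 : fb.1 0 1 = Fintype.card K * f.1 0 1 := by
    rw [hco]
    simp only [(PR_uu lam hl _ f).2]
    simp
  have hli : lam (t : K) * lam ((t⁻¹ : Kˣ) : K) = 1 := by rw [← map_mul, Units.mul_inv, map_one]
  set k : ℂ := (lam ((t⁻¹ : Kˣ) : K) - lam t) * (Fintype.card K * f.1 0 1) with hk
  have hk0 : k ≠ 0 := by
    refine mul_ne_zero (fun h => ht ?_) (mul_ne_zero (by simp) hf0)
    rw [sub_eq_zero.1 h] at hli
    rw [pow_two, ← hli]
  have heinf : einf ∈ P := by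
    have h1 : PR lam hl (mkS (dg t)) fb - lam (t : K) • fb ∈ P := P.sub_mem (hP _ _ hfb) (P.smul_mem _ hfb)
    have h2 : PR lam hl (mkS (dg t)) fb - lam (t : K) • fb = k • einf := by
      apply pv_ext
      · intro b
        change (PR lam hl (mkS (dg t)) fb).1 1 b - lam (t : K) * fb.1 1 b = k * einf.1 1 b
        rw [(PR_dg lam hl t fb).1, hfb1, hfb1, pv_one]; simp
      · change (PR lam hl (mkS (dg t)) fb).1 0 1 - lam (t : K) * fb.1 0 1 = k * einf.1 0 1
        rw [(PR_dg lam hl t fb).2, hfb0, pv_zero]; simp [k]; ring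
    rw [h2] at h1
    exact (P.smul_mem_iff hk0).1 h1
  have hd : ∀ c : K, pv lam (fun o => if o = some c then 1 else 0) ∈ P := by
    intro c
    let g : SL2 K := ⟨!![-c, -1; 1, 0], by simp [det_fin_two]⟩
    have h1 := hP (mkS g) _ heinf
    convert h1 using 1
    apply pv_ext
    · intro b
      rw [PR_apply lam hl g, pv_one]
      by_cases hb : b = c
      · subst hb
        have := einf.2 (-1) 0 1
        rw [hl, pv_zero] at this
        simpa [g] using this.symm
      · have hb' : b - c ≠ 0 := sub_ne_zero.2 hb
        have := einf.2 (b - c) 1 (-1 / (b - c))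
        rw [pv_one, mul_div_cancel₀ _ hb'] at this
        simp at this
        simp [g, hb, ← this]
        ring_nf
    · rw [PR_apply lam hl g, pv_zero]
      have := pv_one lam (fun o : Option K => if o = none then (1:ℂ) else 0) 0
      simpa [g] using this.symm
  rw [eq_top_iff]
  intro f' _
  have : f' = f'.1 0 1 • einf + ∑ c : K, f'.1 1 c • pv lam (fun o => if o = some c then 1 else 0) := by
    apply pv_ext
    · intro b
      simp only [Submodule.coe_add, Pi.add_apply, AddSubmonoidClass.coe_finset_sum, Finset.sum_apply, Submodule.coe_smul, Pi.smul_apply, einf, pv_one]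
      simp
    · simp only [Submodule.coe_add, Pi.add_apply, AddSubmonoidClass.coe_finset_sum, Finset.sum_apply, Submodule.coe_smul, Pi.smul_apply, einf, pv_zero]
      simp
  rw [this]
  exact P.add_mem (P.smul_mem _ heinf) (P.sum_mem fun c _ => P.smul_mem _ (hd c))

lemma PR_inter (lam : MulChar K ℂ) (hl : lam (-1) = 1) (τ : PSL2 K → PSL2 K) (A : PV lam ≃ₗ[ℂ] PV lam)
    (hA : ∀ s v, A (PR lam hl s v) = PR lam hl (τ s) (A v)) (hU : ∀ b : K, ∃ a, τ (mkS (uu a)) = mkS (uu b))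
    {t t' : Kˣ} (ht : τ (mkS (dg t)) = mkS (dg t')) : lam (t' : K) = lam t ∨ lam ((t'⁻¹ : Kˣ) : K) = lam t := by
  classical
  let e : PV lam := pv lam (fun o => if o = none then 0 else 1)
  have e1 : ∀ b, e.1 1 b = 1 := fun b => by simp [e, pv_one]
  have e0 : e.1 0 1 = 0 := by simp [e, pv_zero]
  have he : e ≠ 0 := by
    intro h
    have := e1 0
    rw [h] at this
    simp at this
  have hu : ∀ c, PR lam hl (mkS (uu c)) e = e := fun c => by
    apply pv_ext
    · intro b; rw [(PR_uu lam hl c e).1, e1, e1]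
    · rw [(PR_uu lam hl c e).2]
  have hd : PR lam hl (mkS (dg t)) e = lam t • e := by
    apply pv_ext
    · intro b; rw [(PR_dg lam hl t e).1, e1]; change _ = lam t * e.1 1 b; rw [e1]
    · rw [(PR_dg lam hl t e).2, e0]; change _ = lam t * e.1 0 1; rw [e0]; simp
  have hf : A e ≠ 0 := by simpa using he
  have hfu : ∀ b, PR lam hl (mkS (uu b)) (A e) = A e := by
    intro b
    obtain ⟨a, ha⟩ := hU b
    rw [← ha, ← hA, hu]
  have hfd : PR lam hl (mkS (dg t')) (A e) = lam t • A e := by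
    rw [← ht, ← hA, hd, map_smul]
  have hc : ∀ b, (A e).1 1 b = (A e).1 1 0 := by
    intro b
    have := (PR_uu lam hl b (A e)).1 0
    rw [hfu, add_zero] at this
    exact this.symm
  have h1 := (PR_dg lam hl t' (A e)).1 0
  have h0 := (PR_dg lam hl t' (A e)).2
  rw [hfd] at h0 h1
  change lam t * (A e).1 1 0 = _ at h1
  change lam t * (A e).1 0 1 = _ at h0
  rw [mul_zero] at h1
  by_cases h : (A e).1 1 0 = 0
  · right
    refine (mul_right_cancel₀ (fun h' => hf ?_) h0).symm
    refine pv_ext (fun b => ?_) h'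
    rw [hc, h]; rfl
  · left; exact (mul_right_cancel₀ h h1).symm

end PS

section AddF
variable {A V : Type} [AddCommGroup A] [Fintype A] [AddCommGroup V] [Module ℂ V] [FiniteDimensional ℂ V]

lemma add_mult (ρ : Multiplicative A →* EC V) : ∃ m : AddChar A ℂ → ℕ, ∀ ψ : AddChar A ℂ,
    (Fintype.card A : ℂ) * m ψ = ∑ u, LinearMap.trace ℂ V (ρ (Multiplicative.ofAdd u)) * ψ (-u) := by
  refine ⟨fun ψ => finrank ℂ (HomR (((algebraMap ℂ (EC ℂ) : ℂ →* EC ℂ)).comp ψ.toMonoidHom) ρ), fun ψ => ?_⟩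
  let σ : Multiplicative A →* EC ℂ := ((algebraMap ℂ (EC ℂ) : ℂ →* EC ℂ)).comp ψ.toMonoidHom
  have hirr : IrrR σ := ⟨inferInstance, fun P _ => eq_bot_or_eq_top P⟩
  have h := eps_trace hirr ρ
  have htr : ∀ x : Multiplicative A, LinearMap.trace ℂ ℂ (σ x⁻¹) = ψ (-x.toAdd) := by
    intro x
    change LinearMap.trace ℂ ℂ (algebraMap ℂ (EC ℂ) (ψ (-x.toAdd))) = _
    rw [Algebra.algebraMap_eq_smul_one, map_smul, trace_one]; simp
  have hc : (Fintype.card A : ℂ) ≠ 0 := by exact_mod_cast Fintype.card_ne_zero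
  have hc' : Fintype.card (Multiplicative A) = Fintype.card A := Fintype.card_congr Multiplicative.toAdd
  rw [epsR, map_smul, map_sum, Module.finrank_self, hc', smul_eq_mul, Nat.cast_one, one_mul, one_div, inv_mul_eq_iff_eq_mul₀ hc] at h
  change (Fintype.card A : ℂ) * (finrank ℂ (HomR σ ρ) : ℂ) = _
  rw [← h]
  refine Fintype.sum_equiv (Multiplicative.toAdd) _ _ fun x => ?_
  rw [map_smul, htr, smul_eq_mul, mul_comm]; rfl

lemma add_pars {f : A → ℂ} {m : AddChar A ℂ → ℕ} (h : ∀ ψ, (Fintype.card A : ℂ) * m ψ = ∑ u, f u * ψ (-u)) :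
    (∑ ψ, (m ψ : ℂ)) = f 0 ∧ (Fintype.card A : ℝ) * ∑ ψ, (m ψ : ℝ) ^ 2 = ∑ u, ‖f u‖ ^ 2 := by
  classical
  have hc : (Fintype.card A : ℂ) ≠ 0 := by exact_mod_cast Fintype.card_ne_zero
  constructor
  · refine mul_left_cancel₀ hc ?_
    rw [mul_sum]
    simp only [h]
    rw [sum_comm]
    simp only [← mul_sum, AddChar.sum_apply_eq_ite, neg_eq_zero]
    simp [mul_comm]
  · have : (Fintype.card A : ℂ) * ∑ ψ, (m ψ : ℂ) ^ 2 = ∑ u, f u * (starRingEnd ℂ) (f u) := by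
      refine mul_left_cancel₀ hc ?_
      have e : ∀ ψ : AddChar A ℂ, ((Fintype.card A : ℂ) * m ψ) ^ 2 = ∑ u, ∑ v, f u * (starRingEnd ℂ) (f v) * ψ (v - u) := by
        intro ψ
        have h2 : (Fintype.card A : ℂ) * m ψ = ∑ v, (starRingEnd ℂ) (f v) * ψ v := by
          have := congrArg (starRingEnd ℂ) (h ψ)
          rw [map_mul, map_sum, conj_natCast, conj_natCast] at this
          rw [this]
          refine sum_congr rfl fun v _ => ?_
          rw [map_mul, ← AddChar.map_neg_eq_conj, neg_neg]
        rw [pow_two]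
        nth_rw 2 [h2]
        rw [h ψ, sum_mul_sum]
        refine sum_congr rfl fun u _ => sum_congr rfl fun v _ => ?_
        rw [sub_eq_neg_add, AddChar.map_add_eq_mul]; ring
      rw [← mul_assoc, ← pow_two, mul_sum]
      simp only [← mul_pow, e]
      rw [sum_comm, mul_sum]
      refine sum_congr rfl fun u _ => ?_
      rw [sum_comm]
      simp only [← mul_sum, AddChar.sum_apply_eq_ite, sub_eq_zero]
      simp [mul_comm]
    simp only [Complex.mul_conj, Complex.normSq_eq_norm_sq] at this
    exact_mod_cast this

end AddF

lemma cus_num {ι : Type} [Fintype ι] [DecidableEq ι] {q c n : ℕ} (hq : q = 2 * c + 1) (h29 : 29 ≤ q) {α β : ℂ} (m : ι → ℕ) (i0 : ι)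
    (hcard : Fintype.card ι = q) (hs : ∑ i, m i = n) (hm0 : (q : ℂ) * m i0 = n + c * (α + β))
    (hp : (q : ℝ) * ∑ i, (m i : ℝ) ^ 2 = n ^ 2 + c * (‖α‖ ^ 2 + ‖β‖ ^ 2)) (hint : IsIntegral ℤ (α + β))
    (hα : ‖α‖ ^ 2 ≤ q) (hβ : ‖β‖ ^ 2 ≤ q) (hn : 2 * n ^ 2 ≤ q ^ 3) (hcn : c ∣ n) (hodd : ¬ 2 ∣ n) :
    (q : ℝ) ≤ ‖α - β‖ ^ 2 := by
  have hc0 : (c : ℂ) ≠ 0 := by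
    have : c ≠ 0 := by omega
    exact_mod_cast this
  have hpar : ‖α + β‖ ^ 2 + ‖α - β‖ ^ 2 = 2 * (‖α‖ ^ 2 + ‖β‖ ^ 2) := by
    have := parallelogram_law_with_norm ℝ α β
    nlinarith
  obtain ⟨z, hz⟩ : ∃ z : ℤ, α + β = z := by
    have e : α + β = algebraMap ℚ ℂ ((q * m i0 - n) / c) := by
      rw [eq_ratCast]; push_cast
      rw [hm0]; field_simp; ring
    rw [e] at hint
    have := (isIntegral_algebraMap_iff (algebraMap ℚ ℂ).injective).1 hint
    obtain ⟨z, hz⟩ := IsIntegrallyClosed.isIntegral_iff.1 this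
    refine ⟨z, ?_⟩
    rw [e, ← hz]; simp
  have hzi : (q : ℤ) * m i0 = n + c * z := by
    rw [hz] at hm0; exact_mod_cast hm0
  have hz4 : (z : ℝ) ^ 2 ≤ 4 * q := by
    have : ‖α + β‖ ^ 2 = (z : ℝ) ^ 2 := by rw [hz, Complex.norm_intCast, sq_abs]
    nlinarith [sq_nonneg ‖α - β‖]
  have hcm : c ∣ m i0 := by
    have h1 : (c : ℤ) ∣ (q : ℤ) * m i0 := by
      rw [hzi]; exact dvd_add (by exact_mod_cast hcn) (dvd_mul_right _ _)
    have h2 : c ∣ q * m i0 := by exact_mod_cast h1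
    refine Coprime.dvd_of_dvd_mul_left ?_ h2
    rw [hq]; simp
  have hm00 : m i0 = 0 := by
    by_contra h
    have hle : c ≤ m i0 := le_of_dvd (by omega) hcm
    have hz5 : 5 * z ≤ 2 * q := by
      by_contra! hcon
      have h4 : z ^ 2 ≤ 4 * (q : ℤ) := by exact_mod_cast hz4
      have h29' : (29 : ℤ) ≤ q := by exact_mod_cast h29
      nlinarith
    have h3 : (q : ℤ) * c ≤ n + c * z := by
      rw [← hzi]; exact mul_le_mul_of_nonneg_left (by exact_mod_cast hle) (by positivity)
    have hq' : (q : ℤ) = 2 * c + 1 := by exact_mod_cast hq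
    have h29' : (29 : ℤ) ≤ q := by exact_mod_cast h29
    have hn' : 2 * (n : ℤ) ^ 2 ≤ q ^ 3 := by exact_mod_cast hn
    have h5 : 3 * (q : ℤ) * c ≤ 5 * n := by nlinarith
    have h6 : 29 * (2 * c : ℤ) ≥ 28 * q := by linarith
    have h7 : 42 * (q : ℤ) ^ 2 ≤ 145 * n := by nlinarith
    have h8 : (42 * (q : ℤ) ^ 2) ^ 2 ≤ (145 * n) ^ 2 := pow_le_pow_left₀ (by positivity) h7 2
    have h9 : 3528 * (q : ℤ) ^ 4 ≤ 21025 * q ^ 3 := by nlinarith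
    have h10 : (0 : ℤ) < q ^ 3 := by positivity
    nlinarith
  obtain ⟨k, hk⟩ := hcn
  have hsum : ∑ i ∈ univ.erase i0, m i = n := by
    rw [← hs, ← add_sum_erase _ m (Finset.mem_univ i0), hm00, zero_add]
  have hsum2 : ∑ i ∈ univ.erase i0, (m i : ℤ) ^ 2 = ∑ i, (m i : ℤ) ^ 2 := by
    rw [← add_sum_erase _ (fun i => (m i : ℤ) ^ 2) (Finset.mem_univ i0), hm00]; simp
  have hcardE : (univ.erase i0).card = 2 * c := by
    rw [card_erase_of_mem (Finset.mem_univ _), card_univ, hcard, hq]; rfl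
  have hkodd : ¬ 2 ∣ k := fun h => hodd (hk ▸ Dvd.dvd.mul_left h c)
  have hv : (2 * c : ℤ) ≤ ∑ i ∈ univ.erase i0, (2 * (m i : ℤ) - k) ^ 2 := by
    have := card_nsmul_le_sum (univ.erase i0) (fun i => (2 * (m i : ℤ) - k) ^ 2) 1 (fun i _ => by
      have : (2 * (m i : ℤ) - k) ≠ 0 := by omega
      have := sq_pos_of_ne_zero this
      linarith)
    rw [hcardE] at this
    simpa using this
  have hv2 : ∑ i ∈ univ.erase i0, (2 * (m i : ℤ) - k) ^ 2 = 4 * ∑ i, (m i : ℤ) ^ 2 - 4 * k * n + 2 * c * k ^ 2 := by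
    have e : ∀ i, (2 * (m i : ℤ) - k) ^ 2 = 4 * (m i : ℤ) ^ 2 - 4 * k * m i + k ^ 2 := fun i => by ring
    simp only [e, sum_add_distrib, sum_sub_distrib, ← mul_sum, hsum2, sum_const, hcardE]
    rw [← hsum]; push_cast; simp
  rw [hv2] at hv
  have hv3 : (2 * c : ℝ) ≤ 4 * ∑ i, (m i : ℝ) ^ 2 - 4 * k * n + 2 * c * k ^ 2 := by exact_mod_cast hv
  have hzk : z = -k := by
    rw [hm00, hk] at hzi
    have : (c : ℤ) * (k + z) = 0 := by push_cast at hzi; linarith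
    rcases mul_eq_zero.1 this with h | h
    · omega
    · linarith
  have hab : ‖α + β‖ ^ 2 = (k : ℝ) ^ 2 := by rw [hz, Complex.norm_intCast, sq_abs, hzk]; push_cast; ring
  have hn' : (n : ℝ) = c * k := by exact_mod_cast hk
  have hq' : (q : ℝ) = 2 * c + 1 := by exact_mod_cast hq
  have hcp : (0 : ℝ) < c := by
    have : 0 < c := by omega
    exact_mod_cast this
  set Sg := ∑ i, (m i : ℝ) ^ 2
  rw [hn'] at hv3 hp
  have h1 : ‖α‖ ^ 2 + ‖β‖ ^ 2 = (k ^ 2 + ‖α - β‖ ^ 2) / 2 := by linarith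
  rw [h1] at hp
  have h2 : c * ((k : ℝ) ^ 2 + 1) ≤ 2 * Sg := by nlinarith
  have h3 : (q : ℝ) * (c * ((k : ℝ) ^ 2 + 1)) ≤ q * (2 * Sg) := mul_le_mul_of_nonneg_left h2 (by positivity)
  have h4 : c * (q * ((k : ℝ) ^ 2 + 1)) ≤ c * (2 * c * k ^ 2 + k ^ 2 + ‖α - β‖ ^ 2) := by nlinarith
  have h5 := le_of_mul_le_mul_left h4 hcp
  rw [hq'] at h5 ⊢
  nlinarith

section DG
variable {K : Type} [Field K]

lemma dg_mul (s t : Kˣ) : (dg (s * t) : SL2 K) = dg s * dg t := by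
  obtain ⟨h1, h2, h3, h4⟩ := dg_e s
  obtain ⟨k1, k2, k3, k4⟩ := dg_e t
  obtain ⟨l1, l2, l3, l4⟩ := dg_e (s * t)
  apply sl_ext <;> simp only [sl_mul, h1, h2, h3, h4, k1, k2, k3, k4, l1, l2, l3, l4] <;> push_cast <;> ring

def DG : Kˣ →* PSL2 K where
  toFun t := mkS (dg t)
  map_one' := by
    have : (dg 1 : SL2 K) = 1 := by
      have := dg_mul (1 : Kˣ) 1
      rw [one_mul] at this
      exact (mul_eq_left.1 this.symm)
    rw [this, map_one]
  map_mul' s t := by rw [dg_mul, map_mul]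

lemma DG_apply (t : Kˣ) : DG t = mkS (dg t) := rfl

lemma DG_one_iff (t : Kˣ) : DG t = 1 ↔ (t : K) ^ 2 = 1 := by
  obtain ⟨k1, k2, k3, k4⟩ := dg_e t
  rw [DG_apply, mkS_one]
  constructor
  · rintro (h | h)
    · rw [h] at k1; simp at k1; rw [← k1]; simp
    · rw [h, sl_neg] at k1; simp at k1; rw [← k1]; simp
  · intro h
    have hi : ((t⁻¹ : Kˣ) : K) = t := by
      rw [Units.val_inv_eq_inv_val]; exact inv_eq_of_mul_eq_one_right (by rw [← pow_two, h])
    rw [← one_pow 2, sq_eq_sq_iff_eq_or_eq_neg] at h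
    rcases h with h' | h'
    · left; apply sl_ext <;> simp [k1, k2, k3, k4, h']
    · right; apply sl_ext <;> simp [k1, k2, k3, k4, sl_neg, h']

lemma dg_uu (t : Kˣ) (a : K) : mkS (dg t) * mkS (uu a) * (mkS (dg t))⁻¹ = mkS (uu ((t : K) ^ 2 * a)) := by
  rw [mul_inv_eq_iff_eq_mul, ← map_mul, ← map_mul]
  congr 1
  obtain ⟨k1, k2, k3, k4⟩ := dg_e t
  obtain ⟨h1, h2, h3, h4⟩ := uu_e a
  obtain ⟨l1, l2, l3, l4⟩ := uu_e ((t : K) ^ 2 * a)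
  apply sl_ext <;> simp only [sl_mul, h1, h2, h3, h4, k1, k2, k3, k4, l1, l2, l3, l4]
  · ring
  · linear_combination (-(t : K) * a) * Units.mul_inv t
  · ring
  · ring

variable [Finite K]

lemma split_td {Γ : Type} [Group Γ] [Fintype Γ] {π : Γ →* PSL2 K} (ht : π.range = ⊤) (hq : Odd (NC K)) (h2 : (2 : K) ≠ 0)
    (hq29 : 29 ≤ NC K) {s : Kˣ} (hX : tra (dg s) ^ 2 ≠ 4) : ∃ w, Fam.TD π (dg s) w ((NC K - 1) / 2) := by
  have := ofFinite K
  obtain ⟨w, c, T⟩ := Fam.mk_tor (π := π) h2 hX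
  obtain ⟨ζ, hζ⟩ := IsCyclic.exists_generator (α := Kˣ)
  have hoz : orderOf ζ = NC K - 1 := by
    rw [orderOf_eq_card_of_forall_mem_zpowers hζ, Nat.card_units]
  obtain ⟨m, hm⟩ := hq
  have hd : (NC K - 1) / 2 ∣ orderOf (DG ζ) := by
    have h1 : (DG ζ) ^ orderOf (DG ζ) = 1 := pow_orderOf_eq_one _
    rw [← map_pow, DG_one_iff] at h1
    have h3 : ζ ^ (orderOf (DG ζ) * 2) = 1 := by
      ext; push_cast; push_cast at h1; rw [pow_mul, h1]
    have := orderOf_dvd_of_pow_eq_one h3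
    rw [hoz] at this
    have h4 : NC K - 1 = (NC K - 1) / 2 * 2 := by omega
    rw [h4] at this
    exact Nat.dvd_of_mul_dvd_mul_right (by norm_num) this
  have hmem : DG ζ ∈ zpowers (π w) := by
    rw [T.hz, ht]
    refine ⟨mem_tor.2 ⟨dg ζ, ?_, rfl⟩, trivial⟩
    rw [Commute, SemiconjBy, ← dg_mul, ← dg_mul, mul_comm]
  have hd2 : (NC K - 1) / 2 ∣ c := by
    refine hd.trans ?_
    rw [← T.ht.1]
    exact orderOf_dvd_of_mem_zpowers hmem
  have hw : π w ∈ tor (dg s) := by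
    have : π w ∈ zpowers (π w) := Subgroup.mem_zpowers _
    rw [T.hz] at this; exact this.1
  have hc : c ∣ (NC K - 1) / 2 := by
    rcases tor_exp ⟨m, hm⟩ hX with h | h
    · rw [← T.ht.1]; exact orderOf_dvd_of_pow_eq_one (h _ hw)
    · exfalso
      have h5 : c ∣ (NC K + 1) / 2 := by rw [← T.ht.1]; exact orderOf_dvd_of_pow_eq_one (h _ hw)
      have h6 := hd2.trans h5
      have h7 : (NC K + 1) / 2 = (NC K - 1) / 2 + 1 := by omega
      rw [h7] at h6
      have := le_of_dvd one_pos ((Nat.dvd_add_right (dvd_refl _)).1 h6)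
      omega
  have := Nat.dvd_antisymm hc hd2
  subst this
  exact ⟨w, T⟩

lemma sum_sq (hq : Odd (NC K)) {δ : K} (hδ0 : δ ≠ 0) (hδ : ∀ t : K, δ ≠ t ^ 2) [Fintype K] {g : K → ℂ}
    (hg : ∀ (t : Kˣ) a, g ((t : K) ^ 2 * a) = g a) :
    ∑ u, g u = g 0 + ((NC K - 1 : ℕ) / 2 : ℂ) * (g 1 + g δ) := by
  classical
  have hch : ringChar K ≠ 2 := by
    intro h
    rw [card_eq_fintype_card] at hq
    have := FiniteField.even_card_iff_char_two.1 h
    have := Nat.odd_iff.1 hq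
    omega
  have key : ∀ u, g u = (g 1 + g δ) / 2 + (quadraticChar K u : ℂ) * ((g 1 - g δ) / 2) + if u = 0 then g 0 - (g 1 + g δ) / 2 else 0 := by
    intro u
    by_cases hu : u = 0
    · subst hu; simp
    by_cases hs : IsSquare u
    · rw [(quadraticChar_one_iff_isSquare hu).2 hs]
      obtain ⟨t, rfl⟩ := hs
      have ht : t ≠ 0 := by rintro rfl; simp at hu
      have := hg (Units.mk0 t ht) 1
      simp only [Units.val_mk0, mul_one, pow_two] at this
      rw [this, if_neg hu]; push_cast; ring
    · have h1 := (quadraticChar_neg_one_iff_not_isSquare (F := K)).2 hs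
      have hsδ : ¬ IsSquare δ := by rintro ⟨t, ht⟩; exact hδ t (by rw [ht]; ring)
      have h2 := (quadraticChar_neg_one_iff_not_isSquare (F := K)).2 hsδ
      rw [h1, if_neg hu]
      have h3 : quadraticChar K (u * δ) = 1 := by rw [map_mul, h1, h2]; norm_num
      obtain ⟨t, ht⟩ := (quadraticChar_one_iff_isSquare (mul_ne_zero hu hδ0)).1 h3
      have ht0 : t ≠ 0 := by rintro rfl; simp [hu, hδ0] at ht
      have := hg (Units.mk0 (t / δ) (div_ne_zero ht0 hδ0)) δ
      simp only [Units.val_mk0] at this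
      rw [← this, show (t / δ) ^ 2 * δ = u by rw [div_pow, pow_two t, ← ht]; field_simp]
      push_cast; ring
  rw [sum_congr rfl fun u _ => key u]
  simp only [sum_add_distrib, ← sum_mul]
  have h0 : (∑ u : K, (quadraticChar K u : ℂ)) = 0 := by exact_mod_cast quadraticChar_sum_zero hch
  rw [h0]
  simp only [sum_const, Finset.sum_ite_eq', Finset.mem_univ, if_true, card_univ, nsmul_eq_mul]
  have : ((NC K - 1 : ℕ) : ℂ) = Fintype.card K - 1 := by
    rw [cast_sub (Nat.card_pos), card_eq_fintype_card]; simp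
  rw [this]; ring

end DG

section Cusp
variable {K : Type} [Field K] [Finite K]

lemma cen_uu [Fintype (PSL2 K)] (h2 : (2 : K) ≠ 0) {a : K} (ha : a ≠ 0) :
    NC (Fam.cen (MonoidHom.id (PSL2 K)) (mkS (uu a))) ≤ NC K := by
  have h : Fam.cen (MonoidHom.id (PSL2 K)) (mkS (uu a)) ≤ (US : Multiplicative K →* PSL2 K).range := by
    intro y hy
    have : Commute (mkS (uu a)) y := mem_centralizer_singleton_iff.1 hy.1 |>.symm
    obtain ⟨b, rfl⟩ := uu_cent h2 ha this
    exact ⟨Multiplicative.ofAdd b, rfl⟩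
  refine (Subgroup.card_le_of_le h).trans ?_
  have : NC (Multiplicative K) = NC K := rfl
  rw [← this]
  exact Nat.card_le_card_of_surjective (US : Multiplicative K →* PSL2 K).rangeRestrict (MonoidHom.rangeRestrict_surjective _)

lemma cus_bound [Fintype (PSL2 K)] (F : Fam (MonoidHom.id (PSL2 K))) (hgood : ∀ g, F.Good g) (hq : Odd (NC K)) (h2 : (2 : K) ≠ 0)
    (hq29 : 29 ≤ NC K) {δ : K} (hδ0 : δ ≠ 0) (hδ : ∀ t : K, δ ≠ t ^ 2) (i : F.ι) (hc : (NC K - 1) / 2 ∣ F.n i)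
    (hodd : ¬ 2 ∣ F.n i) : (NC K : ℝ) ≤ ‖F.χ i (mkS (uu 1)) - F.χ i (mkS (uu δ))‖ ^ 2 := by
  classical
  have := ofFinite K
  obtain ⟨k, hk⟩ := hq
  obtain ⟨m, hm⟩ := add_mult ((F.ρ i).comp (US : Multiplicative K →* PSL2 K))
  have hm' : ∀ ψ : AddChar K ℂ, (Fintype.card K : ℂ) * m ψ = ∑ u, F.χ i (mkS (uu u)) * ψ (-u) := hm
  obtain ⟨p1, p2⟩ := add_pars hm'
  have f0 : F.χ i (mkS (uu 0)) = F.n i := by rw [uu_zero, map_one, F.χ_one]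
  have hconj : ∀ (t : Kˣ) a, F.χ i (mkS (uu ((t : K) ^ 2 * a))) = F.χ i (mkS (uu a)) := by
    intro t a
    rw [← dg_uu, ← F.χ_conj i _ (mkS (dg t))]
    congr 1; group
  have hbd : ∀ a : K, a ≠ 0 → ‖F.χ i (mkS (uu a))‖ ^ 2 ≤ NC K := by
    intro a ha
    have h1 := F.norm_sum (hgood (mkS (uu a)))
    have h3 : ‖F.χ i (mkS (uu a))‖ ^ 2 ≤ ∑ j, ‖F.χ j (mkS (uu a))‖ ^ 2 :=
      Finset.single_le_sum (f := fun j => ‖F.χ j (mkS (uu a))‖ ^ 2) (fun _ _ => by positivity) (Finset.mem_univ i)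
    rw [h1] at h3
    exact h3.trans (by exact_mod_cast cen_uu h2 ha)
  have hcK : NC K = Fintype.card K := card_eq_fintype_card
  have hc2 : ((NC K - 1 : ℕ) : ℂ) / 2 = (((NC K - 1) / 2 : ℕ) : ℂ) := by
    rw [hk]; simp
  refine cus_num (c := (NC K - 1) / 2) (n := F.n i) (by omega) hq29 m 0 (by rw [AddChar.card_eq, hcK]) ?_ ?_ ?_ ?_ (hbd 1 one_ne_zero) (hbd δ hδ0) ?_ hc hodd
  · rw [f0] at p1; exact_mod_cast p1
  · rw [hcK, hm', ← hcK, ← hc2, ← f0, ← sum_sq ⟨k, hk⟩ hδ0 hδ (g := fun u => F.χ i (mkS (uu u))) hconj]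
    simp
  · rw [hcK, p2, ← hcK]
    have e := sum_sq ⟨k, hk⟩ hδ0 hδ (g := fun u => ((‖F.χ i (mkS (uu u))‖ ^ 2 : ℝ) : ℂ)) (fun t a => by simp only [hconj])
    rw [hc2] at e
    simp only [f0, Complex.norm_natCast] at e
    exact_mod_cast e
  · exact (tr_integral (F.ρ i) _).add (tr_integral (F.ρ i) _)
  · have h1 := F.norm_sum (hgood 1)
    have h3 : ‖F.χ i 1‖ ^ 2 ≤ ∑ j, ‖F.χ j 1‖ ^ 2 :=
      Finset.single_le_sum (f := fun j => ‖F.χ j 1‖ ^ 2) (fun _ _ => by positivity) (Finset.mem_univ i)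
    rw [h1, F.χ_one, Complex.norm_natCast] at h3
    have h4 : F.n i ^ 2 ≤ NC (PSL2 K) := by
      have h5 : F.n i ^ 2 ≤ NC (Fam.cen (MonoidHom.id (PSL2 K)) (MonoidHom.id (PSL2 K) 1)) := by exact_mod_cast h3
      exact h5.trans (Subgroup.card_le_card_group _)
    have h6 := card_PSL (F := K) h2
    have h7 : NC K * (NC K - 1) * (NC K + 1) ≤ NC K ^ 3 := by
      rw [hk]; simp only [Nat.add_sub_cancel]; nlinarith
    omega

lemma exists_not_filter {ι : Type} [Fintype ι] (P : ι → Prop) [DecidablePred P] {n : ℕ} (h : (univ.filter fun i => ¬ P i).card ≤ n) :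
    Fintype.card ι ≤ n + (univ.filter P).card := by
  have := Finset.card_filter_add_card_filter_not (s := (univ : Finset ι)) P
  rw [card_univ] at this
  omega

theorem cusp (hq : Odd (NC K)) (h2 : (2 : K) ≠ 0) (hq29 : 29 ≤ NC K) :
    ∃ n ∈ charDegrees (PSL2 K), ∀ ℓ : ℕ, ℓ.Prime → ℓ ∣ NC K - 1 → ℓ ∣ n := by
  classical
  have := ofFinite K
  have := ofFinite (PSL2 K)
  obtain ⟨F, hν⟩ := exists_fam (MonoidHom.id (PSL2 K)) (fun _ => 1) rfl (by simp) (by simp)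
  have hgood : ∀ g, F.Good g := fun g x _ => by rw [hν]
  have ht : (MonoidHom.id (PSL2 K)).range = ⊤ := MonoidHom.range_eq_top.2 fun x => ⟨x, rfl⟩
  have hlow := F.lower hq h2 ht (fun a _ g _ => hgood g) {mkS (comp2 0)} subset_rfl (fun a _ => ⟨a, rfl, hgood a⟩)
  rw [Finset.card_singleton] at hlow
  have hdeg : ∀ i, F.n i ∈ charDegrees (PSL2 K) := fun i => by
    have := charDegrees_of_irrR (F.ρ i) (F.irr i)
    simpa using this
  obtain ⟨k, hk⟩ := hq
  have hq : Odd (NC K) := ⟨k, hk⟩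
  have hkc : (NC K - 1) / 2 = k := by omega
  rcases Nat.even_or_odd' k with ⟨b, hb | hb⟩
  · have hsq : IsSquare (-1 : K) := by
      rw [FiniteField.isSquare_neg_one_iff, ← card_eq_fintype_card]; omega
    obtain ⟨i, hi⟩ := hsq
    have hi0 : i ≠ 0 := by rintro rfl; simp at hi
    let s : Kˣ := Units.mk0 i hi0
    have hs2 : (s : K) ^ 2 = -1 := by rw [pow_two]; exact hi.symm
    have htr : tra (dg s) = 0 := by
      obtain ⟨h1, _, _, h4⟩ := dg_e s
      rw [tra, h1, h4]
      have : ((s⁻¹ : Kˣ) : K) = -s := by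
        rw [Units.val_inv_eq_inv_val]; exact inv_eq_of_mul_eq_one_right (by rw [mul_neg, ← pow_two, hs2, neg_neg])
      rw [this]; ring
    have h4 : (4 : K) ≠ 0 := by
      rw [show (4 : K) = 2 ^ 2 by norm_num]; exact pow_ne_zero 2 h2
    obtain ⟨w, T⟩ := split_td ht hq h2 hq29 (s := s) (by rw [htr]; simpa using h4.symm)
    rw [hkc, hb] at T
    have hne : mkS (dg s) ≠ 1 := by
      rw [← DG_apply, Ne, DG_one_iff, hs2]
      intro h; apply h2; linear_combination -h
    have hsq1 : mkS (dg s) ^ 2 = 1 := sq_one_of_tr0 htr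
    obtain ⟨b', hb', hw⟩ := T.inv (h := mkS (dg s)) (by rw [T.hz, ht]; exact ⟨tor_self _, trivial⟩) hne hsq1
    have : b' = b := by omega
    subst this
    have hup := exists_not_filter _ (F.up_even' T.ht (by omega))
    obtain ⟨j, hj⟩ : (univ.filter fun i => (b' ∣ F.n i ∧ (¬ 2 ∣ F.n i → (b' : ℝ) ^ 2 ≤ ‖F.χ i (w ^ b')‖ ^ 2))).Nonempty := by
      rw [← Finset.card_pos]; omega
    obtain ⟨hj1, hj2⟩ := (mem_filter.1 hj).2
    have hev : 2 ∣ F.n j := by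
      by_contra hcon
      have h1 := F.norm_sum (hgood (w ^ b'))
      have h3 : ‖F.χ j (w ^ b')‖ ^ 2 ≤ ∑ l, ‖F.χ l (w ^ b')‖ ^ 2 :=
        Finset.single_le_sum (f := fun l => ‖F.χ l (w ^ b')‖ ^ 2) (fun _ _ => by positivity) (Finset.mem_univ j)
      have h5 := Fam.cen_card h2 ht T
      rw [hw] at h5
      rw [h1, map_pow] at h3
      have h6 : (b' : ℝ) ^ 2 ≤ (2 * (2 * b') : ℕ) := (hj2 hcon).trans (h3.trans (by exact_mod_cast h5))
      have h7 : b' ^ 2 ≤ 2 * (2 * b') := by exact_mod_cast h6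
      have h8 : 7 ≤ b' := by omega
      nlinarith
    refine ⟨_, hdeg j, fun ℓ hℓ hd => ?_⟩
    have h9 : NC K - 1 = 2 * (2 * b') := by omega
    rw [h9] at hd
    rcases (Nat.Prime.dvd_mul hℓ).1 hd with h | h
    · exact h.trans hev
    rcases (Nat.Prime.dvd_mul hℓ).1 h with h | h
    · exact h.trans hev
    · exact h.trans hj1
  · obtain ⟨ζ, hζ⟩ := IsCyclic.exists_generator (α := Kˣ)
    have hoz : orderOf ζ = NC K - 1 := by
      rw [orderOf_eq_card_of_forall_mem_zpowers hζ, Nat.card_units]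
    have hX : tra (dg ζ) ^ 2 ≠ 4 := by
      obtain ⟨h1, _, _, h4⟩ := dg_e ζ
      rw [tra, h1, h4]
      intro h
      have h5 : ((ζ : K) - (ζ⁻¹ : Kˣ)) ^ 2 = 0 := by linear_combination h - 4 * Units.mul_inv ζ
      have h6 : (ζ : K) = (ζ⁻¹ : Kˣ) := sub_eq_zero.1 (pow_eq_zero_iff two_ne_zero |>.1 h5)
      have h7 : ζ ^ 2 = 1 := by rw [pow_two]; nth_rw 2 [Units.ext h6]; simp
      have := le_of_dvd (by norm_num) (orderOf_dvd_of_pow_eq_one h7)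
      omega
    obtain ⟨w, T⟩ := split_td ht hq h2 hq29 hX
    rw [hkc] at T
    have hup := exists_not_filter _ (F.up_odd T.ht ⟨b, hb⟩ (by omega))
    obtain ⟨δ, hδ0, hδ⟩ := Fam.exists_nonsq hq
    have hS : ∑ i, ‖F.χ i (mkS (uu 1)) - F.χ i (mkS (uu δ))‖ ^ 2 ≤ 2 * NC K := by
      have h1 := F.norm_sum (hgood (mkS (uu 1)))
      have h3 := F.norm_sum (hgood (mkS (uu δ)))
      have h4 := F.orth' (mkS (uu 1)) (mkS (uu δ)) (fun x hx => by
        obtain ⟨t, ht⟩ := uu_conj h2 one_ne_zero (a := (1 : K)) (b := δ) (x := x⁻¹) (by rw [inv_inv]; exact hx)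
        exact hδ t (by rw [ht, mul_one]))
      have h5 : ∀ i, F.χ i (mkS (uu δ))⁻¹ = (starRingEnd ℂ) (F.χ i (mkS (uu δ))) := fun i => tr_inv_conj (F.ρ i) _
      have h6 : ∀ i, ‖F.χ i (mkS (uu 1)) - F.χ i (mkS (uu δ))‖ ^ 2 = ‖F.χ i (mkS (uu 1))‖ ^ 2 + ‖F.χ i (mkS (uu δ))‖ ^ 2
          - 2 * (F.χ i (mkS (uu 1)) * F.χ i (mkS (uu δ))⁻¹).re := by
        intro i
        rw [h5, ← Complex.normSq_eq_norm_sq, ← Complex.normSq_eq_norm_sq, ← Complex.normSq_eq_norm_sq, Complex.normSq_sub]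
      simp only [h6, sum_sub_distrib, sum_add_distrib, ← mul_sum]
      rw [← Complex.re_sum, h4, h1, h3]
      have c1 : (NC (Fam.cen (MonoidHom.id (PSL2 K)) (mkS (uu 1))) : ℝ) ≤ NC K := by exact_mod_cast cen_uu h2 one_ne_zero
      have c2 : (NC (Fam.cen (MonoidHom.id (PSL2 K)) (mkS (uu δ))) : ℝ) ≤ NC K := by exact_mod_cast cen_uu h2 hδ0
      simp only [MonoidHom.id_apply, Complex.zero_re]
      linarith
    by_contra! hcon
    have hall : ∀ i ∈ univ.filter (fun i => k ∣ F.n i), (NC K : ℝ) ≤ ‖F.χ i (mkS (uu 1)) - F.χ i (mkS (uu δ))‖ ^ 2 := by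
      intro i hi
      have hi' := (mem_filter.1 hi).2
      refine cus_bound F hgood hq h2 hq29 hδ0 hδ i (by rw [hkc]; exact hi') fun hev => ?_
      obtain ⟨ℓ, hℓ, hd, hn⟩ := hcon _ (hdeg i)
      have h9 : NC K - 1 = 2 * k := by omega
      rw [h9] at hd
      rcases (Nat.Prime.dvd_mul hℓ).1 hd with h | h
      · exact hn (h.trans hev)
      · exact hn (h.trans hi')
    have h1 := card_nsmul_le_sum _ _ _ hall
    have h3 := sum_le_sum_of_subset_of_nonneg (filter_subset (fun i => k ∣ F.n i) univ)
      (f := fun i => ‖F.χ i (mkS (uu 1)) - F.χ i (mkS (uu δ))‖ ^ 2) (fun _ _ _ => by positivity)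
    have h4 : (3 : ℝ) ≤ (univ.filter fun i => k ∣ F.n i).card := by
      have : 3 ≤ (univ.filter fun i => k ∣ F.n i).card := by omega
      exact_mod_cast this
    rw [nsmul_eq_mul] at h1
    have h5 : (29 : ℝ) ≤ NC K := by exact_mod_cast hq29
    nlinarith

end Cusp

section Aut
variable {K : Type} [Field K]

def UR : Subgroup (PSL2 K) := US.range

lemma mem_UR {s : PSL2 K} : s ∈ UR ↔ ∃ a : K, s = mkS (uu a) :=
  ⟨fun ⟨a, h⟩ => ⟨a.toAdd, h.symm⟩, fun ⟨a, h⟩ => ⟨Multiplicative.ofAdd a, h.symm⟩⟩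

lemma uu_UR (a : K) : mkS (uu a) ∈ UR := mem_UR.2 ⟨a, rfl⟩

lemma UR_BS {s : PSL2 K} (h : s ∈ UR) : s ∈ BS := by
  obtain ⟨a, rfl⟩ := mem_UR.1 h
  exact mem_BS.2 (uu_e a).2.2.1

lemma norm_BS {s : PSL2 K} (h : s * mkS (uu 1) * s⁻¹ ∈ UR) : s ∈ BS := by
  obtain ⟨A, rfl⟩ := mkS_surj s
  rw [← map_inv, ← map_mul, ← map_mul] at h
  have := mem_BS.1 (UR_BS h)
  obtain ⟨h1, h2, h3, h4⟩ := uu_e (1 : K)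
  obtain ⟨i1, i2, i3, i4⟩ := sl_inv A
  simp only [sl_mul, h1, h2, h3, h4, i1, i2, i3, i4] at this
  apply mem_BS.2
  have : A 1 0 ^ 2 = 0 := by linear_combination -this
  exact pow_eq_zero_iff (two_ne_zero) |>.1 this

lemma BS_norm {s u : PSL2 K} (h : s ∈ BS) (hu : u ∈ UR) : s * u * s⁻¹ ∈ UR := by
  obtain ⟨A, rfl⟩ := mkS_surj s
  obtain ⟨a, rfl⟩ := mem_UR.1 hu
  have hA := mem_BS.1 h
  have hd := sl_det A
  obtain ⟨h1, h2, h3, h4⟩ := uu_e a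
  obtain ⟨i1, i2, i3, i4⟩ := sl_inv A
  refine mem_UR.2 ⟨A 0 0 ^ 2 * a, ?_⟩
  rw [← map_inv, ← map_mul, ← map_mul]
  congr 1
  obtain ⟨j1, j2, j3, j4⟩ := uu_e (A 0 0 ^ 2 * a)
  rw [hA] at hd
  apply sl_ext <;> simp only [sl_mul, h1, h2, h3, h4, i1, i2, i3, i4, j1, j2, j3, j4, hA]
  · linear_combination hd
  · ring
  · ring
  · linear_combination hd

lemma w_sq : (mkS (comp2 (0 : K))) * mkS (comp2 0) = 1 := by
  rw [← map_mul, mkS_one]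
  right
  exact sl_sq _ (by simp [tra, comp2])

lemma w_conj (A : SL2 K) : mkS (comp2 (0 : K)) * mkS A * mkS (comp2 0) ∈ BS ↔ A 0 1 = 0 := by
  rw [← map_mul, ← map_mul, mem_BS, sl_mul, sl_mul, sl_mul]
  simp [comp2]

lemma diag_of {s : PSL2 K} (h1 : s ∈ BS) (h2 : mkS (comp2 (0 : K)) * s * mkS (comp2 0) ∈ BS) :
    ∃ t, s = DG t := by
  obtain ⟨A, rfl⟩ := mkS_surj s
  have h1 := mem_BS.1 h1
  have h2 := (w_conj A).1 h2
  have hd := sl_det A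
  rw [h1, h2] at hd
  have hd : A 0 0 * A 1 1 = 1 := by linear_combination hd
  refine ⟨⟨A 0 0, A 1 1, hd, by rw [mul_comm, hd]⟩, ?_⟩
  rw [DG_apply]
  congr 1
  apply sl_ext <;> simp [dg, h1, h2]

lemma fix_of {S : Type} [Group S] [Finite S] {τ : MulAut S} {n : ℕ} (hn : τ ^ n = 1) (hc : n.Coprime (NC S))
    {x c : S} (h : τ x = x * c) (h1 : τ c = c) : c = 1 := by
  have : ∀ m : ℕ, (τ ^ m) x = x * c ^ m := by
    intro m
    induction m with
    | zero => simp
    | succ m ih => rw [pow_succ', MulAut.mul_apply, ih, map_mul, map_pow, h, h1, mul_assoc, ← pow_succ']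
  have h2 := this n
  rw [hn, MulAut.one_apply, left_eq_mul] at h2
  have h3 : c ^ NC S = 1 := pow_card_eq_one'
  have := Nat.dvd_gcd (orderOf_dvd_of_pow_eq_one h2) (orderOf_dvd_of_pow_eq_one h3)
  rw [hc, Nat.dvd_one] at this
  exact orderOf_eq_one_iff.1 this

variable [Finite K]

lemma aut_norm (h2 : (2 : K) ≠ 0) (lam : MulChar K ℂ) (hl : lam (-1) = 1) (hlam : ∀ t, lam t = 1 ↔ t ^ 2 = 1)
    {τ : MulAut (PSL2 K)} {n : ℕ} (hn : τ ^ n = 1) (hc : n.Coprime (NC (PSL2 K))) (hq : Odd (NC K))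
    (hodd : Odd n)
    (A : PV lam ≃ₗ[ℂ] PV lam)
    (hA : ∀ s v, A (PR lam hl s v) = PR lam hl (τ s) (A v)) (hU : ∀ s, τ s ∈ UR ↔ s ∈ UR)
    (hV : ∀ s, mkS (comp2 (0 : K)) * τ s * mkS (comp2 0) ∈ UR ↔ mkS (comp2 (0 : K)) * s * mkS (comp2 0) ∈ UR) :
    τ = 1 := by
  set w := mkS (comp2 (0 : K)) with hw
  have ww : w * w = 1 := w_sq
  have wi : w⁻¹ = w := inv_eq_of_mul_eq_one_left ww
  have hB : ∀ s, s ∈ BS → τ s ∈ BS := by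
    intro s hs
    obtain ⟨u, hu⟩ := τ.surjective (mkS (uu 1))
    apply norm_BS
    rw [← hu, ← map_inv, ← map_mul, ← map_mul, hU]
    exact BS_norm hs ((hU u).1 (hu ▸ uu_UR 1))
  have hB' : ∀ s, w * s * w ∈ BS → w * τ s * w ∈ BS := by
    intro s hs
    obtain ⟨u, hu⟩ := τ.surjective (w * mkS (uu 1) * w)
    apply norm_BS
    have e1 : w * τ s * w * mkS (uu 1) * (w * τ s * w)⁻¹ = w * τ (s * u * s⁻¹) * w := by
      simp only [map_mul, map_inv, hu, mul_inv_rev, wi]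
      simp only [mul_assoc]
    rw [e1, hV]
    have e2 : w * (s * u * s⁻¹) * w = (w * s * w) * (w * u * w) * (w * s * w)⁻¹ := by
      simp only [mul_inv_rev, wi, mul_assoc]
      simp only [← mul_assoc w w, ww, one_mul]
    rw [e2]
    refine BS_norm hs ((hV u).1 ?_)
    rw [hu]
    have : w * (w * mkS (uu 1) * w) * w = mkS (uu 1) := by
      simp only [mul_assoc, ww, mul_one]; simp only [← mul_assoc, ww, one_mul]
    rw [this]; exact uu_UR 1
  have hDB : ∀ t : Kˣ, DG t ∈ BS ∧ w * DG t * w ∈ BS := fun t =>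
    ⟨mem_BS.2 (by simp [dg]), (w_conj _).2 (by simp [dg])⟩
  have hD : ∀ t : Kˣ, ∃ t', τ (DG t) = DG t' := fun t => diag_of (hB _ (hDB t).1) (hB' _ (hDB t).2)
  have hUs : ∀ b : K, ∃ a, τ (mkS (uu a)) = mkS (uu b) := by
    intro b
    obtain ⟨u, hu⟩ := τ.surjective (mkS (uu b))
    obtain ⟨a, rfl⟩ := mem_UR.1 ((hU u).1 (hu ▸ uu_UR b))
    exact ⟨a, hu⟩
  have hfD : ∀ t : Kˣ, τ (DG t) = DG t := by
    intro t
    obtain ⟨t', ht⟩ := hD t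
    have key : ∀ x y : Kˣ, lam (x : K) = lam y → DG x = DG y := by
      intro x y h
      have hy : lam ((y⁻¹ : Kˣ) : K) * lam (y : K) = 1 := by rw [← map_mul]; simp
      have : DG (y⁻¹ * x) = 1 := by
        rw [DG_one_iff, ← hlam, val_mul, map_mul, h, hy]
      rw [map_mul, map_inv, inv_mul_eq_one] at this
      exact this.symm
    rcases PR_inter lam hl τ A hA hUs ht with h | h
    · rw [ht, key _ _ h]
    · have h' := key _ _ h
      rw [map_inv] at h'
      have h1 : τ (DG t) = (DG t)⁻¹ := by rw [ht, ← h', inv_inv]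
      have hm : ∀ m : ℕ, (τ ^ (2 * m)) (DG t) = DG t := by
        intro m
        induction m with
        | zero => simp
        | succ m ih => rw [show 2 * (m + 1) = 2 * m + 1 + 1 by ring, pow_succ, pow_succ, MulAut.mul_apply, MulAut.mul_apply, h1,
            map_inv, h1, inv_inv, ih]
      obtain ⟨m, rfl⟩ := hodd
      have h3 := hm (m + 1)
      rw [show 2 * (m + 1) = (2 * m + 1) + 1 by ring, pow_succ, hn, one_mul] at h3
      exact h3
  have hf : ∀ a : K, ∃ b, τ (mkS (uu a)) = mkS (uu b) := fun a => mem_UR.1 ((hU _).2 (uu_UR a))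
  choose f hf using hf
  have uinj : ∀ a b : K, mkS (uu a) = mkS (uu b) → a = b := fun a b h =>
    Multiplicative.ofAdd.injective (US_inj h2 (a₁ := Multiplicative.ofAdd a) (a₂ := Multiplicative.ofAdd b) h)
  have fadd : ∀ a b, f (a + b) = f a + f b := by
    intro a b
    apply uinj
    rw [← hf, uu_add, uu_add, map_mul, map_mul, map_mul, hf, hf]
  have f0 : f 0 = 0 := by have := fadd 0 0; rw [add_zero] at this; exact left_eq_add.1 this
  have fsq : ∀ t a, f (t ^ 2 * a) = t ^ 2 * f a := by
    intro t a
    by_cases ht : t = 0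
    · subst ht; simp [f0]
    obtain ⟨u, rfl⟩ : ∃ u : Kˣ, (u : K) = t := ⟨Units.mk0 t ht, rfl⟩
    apply uinj
    rw [← hf, ← dg_uu, ← dg_uu, ← DG_apply, map_mul, map_mul, map_inv, hfD, hf]
  have flin : ∀ a, f a = f 1 * a := by
    intro a
    have h1 := fadd a (((a - 1) / 2) ^ 2 * 1)
    rw [fsq, show a + ((a - 1) / 2) ^ 2 * 1 = ((a + 1) / 2) ^ 2 * 1 by field_simp; ring, fsq] at h1
    have h3 : ((a + 1) / 2) ^ 2 - ((a - 1) / 2) ^ 2 = a := by field_simp; ring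
    linear_combination -h1 + f 1 * h3
  have fpow : ∀ m a, (τ ^ m) (mkS (uu a)) = mkS (uu (f 1 ^ m * a)) := by
    intro m
    induction m with
    | zero => simp
    | succ m ih => intro a; rw [pow_succ', MulAut.mul_apply, ih, hf, flin]; congr 2; ring
  have hη : f 1 ^ n = 1 := by
    have := fpow n 1
    rw [hn, MulAut.one_apply, mul_one] at this
    exact (uinj _ _ this).symm
  have hη1 : f 1 = 1 := by
    have hn0 : n ≠ 0 := by rintro rfl; simp at hodd
    have h0 : f 1 ≠ 0 := by intro h; rw [h, zero_pow hn0] at hη; exact zero_ne_one hη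
    have h3 : f 1 ^ (NC K - 1) = 1 := by
      have := ofFinite K
      rw [card_eq_fintype_card]
      exact FiniteField.pow_card_sub_one_eq_one _ h0
    have hc2 : n.Coprime (NC K - 1) := by
      have hcn : n.Coprime (2 * NC (PSL2 K)) := Coprime.mul_right (coprime_two_right.2 hodd) hc
      rw [card_PSL h2] at hcn
      exact hcn.coprime_dvd_right ⟨NC K * (NC K + 1), by ring⟩
    have := Nat.dvd_gcd (orderOf_dvd_of_pow_eq_one hη) (orderOf_dvd_of_pow_eq_one h3)
    rw [hc2, Nat.dvd_one] at this
    exact orderOf_eq_one_iff.1 this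
  have hUf : ∀ a, τ (mkS (uu a)) = mkS (uu a) := by
    intro a; rw [hf, flin, hη1, one_mul]
  have hwf : τ w = w := by
    have hw0 : w * (w * mkS (uu 1) * w) * w = mkS (uu 1) := by
      simp only [mul_assoc, ww, mul_one]; simp only [← mul_assoc, ww, one_mul]
    have tww : τ w * τ w = 1 := by rw [← map_mul, ww, map_one]
    have twi : (τ w)⁻¹ = τ w := inv_eq_of_mul_eq_one_left tww
    have c1 : w * τ w ∈ BS := by
      apply norm_BS
      have : w * τ w * mkS (uu 1) * (w * τ w)⁻¹ = w * τ (w * mkS (uu 1) * w) * w := by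
        simp only [map_mul, hUf, mul_inv_rev, twi, wi, mul_assoc]
      rw [this, hV, hw0]
      exact uu_UR 1
    have c2 : w * (w * τ w) * w ∈ BS := by
      have e : w * (w * τ w) * w = τ w * w := by rw [← mul_assoc w w, ww, one_mul]
      rw [e]
      apply norm_BS
      obtain ⟨u, hu⟩ := τ.surjective (w * mkS (uu 1) * w)
      have : τ w * w * mkS (uu 1) * (τ w * w)⁻¹ = τ (w * u * w) := by
        simp only [map_mul, hu, mul_inv_rev, twi, wi, mul_assoc]
      rw [this, hU, ← hV, hu, hw0]
      exact uu_UR 1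
    obtain ⟨t, ht⟩ := diag_of c1 c2
    have e1 : τ w = w * DG t := by rw [← ht, ← mul_assoc, ww, one_mul]
    have := fix_of hn hc e1 (hfD t)
    rw [e1, this, mul_one]
  have : (MonoidHom.eqLocus τ.toMonoidHom (MonoidHom.id _)) = ⊤ := by
    apply gen_top
    · intro a; exact hUf a
    · intro h
      have h1 : w ∈ BS := h (show τ w = w from hwf)
      have := mem_BS.1 h1
      simp [comp2] at this
  ext s
  have : s ∈ (MonoidHom.eqLocus τ.toMonoidHom (MonoidHom.id _)) := by rw [this]; trivial
  exact this
end Aut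

section Aut2
variable {K : Type} [Field K] [Finite K] {p : ℕ} [hp : Fact p.Prime] [CharP K p]

lemma norm_UR : Subgroup.normalizer ((UR : Subgroup (PSL2 K)) : Set (PSL2 K)) = BS := by
  ext s
  rw [Subgroup.mem_normalizer_iff]
  constructor
  · intro h
    exact norm_BS ((h _).1 (uu_UR 1))
  · intro hs u
    refine ⟨fun h => BS_norm hs h, fun h => ?_⟩
    have := BS_norm (BS.inv_mem hs) h
    simpa [mul_assoc] using this

lemma UR_syl (h2 : (2 : K) ≠ 0) (hpq : p ∣ NC K) : ∃ P : Sylow p (PSL2 K), (P : Subgroup (PSL2 K)) = UR := by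
  have hcard : NC (UR : Subgroup (PSL2 K)) = NC K := by
    have := Nat.card_congr (MonoidHom.ofInjective (US_inj h2)).toEquiv
    exact this.symm.trans (Nat.card_congr Multiplicative.toAdd)
  have hP : IsPGroup p (UR : Subgroup (PSL2 K)) := by
    rintro ⟨s, hs⟩
    obtain ⟨a, rfl⟩ := mem_UR.1 hs
    refine ⟨1, ?_⟩
    ext
    rw [pow_one]
    refine unip_pow p ?_
    change trsq (mkS (uu a)) = 4
    rw [trsq_mk, uu_tr]; norm_num
  have hi : ¬ p ∣ (UR : Subgroup (PSL2 K)).index := by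
    intro hd
    have h1 := (UR : Subgroup (PSL2 K)).card_mul_index
    have h3 := card_PSL h2
    rw [← h1, hcard] at h3
    have hq0 : 0 < NC K := Nat.card_pos
    have h4 : 2 * (UR : Subgroup (PSL2 K)).index = (NC K - 1) * (NC K + 1) := by
      apply eq_of_mul_eq_mul_left hq0
      rw [← mul_assoc (NC K) (NC K - 1), ← h3]; ring
    have h5 : p ∣ (NC K - 1) * (NC K + 1) := h4 ▸ dvd_mul_of_dvd_right hd 2
    rcases hp.out.dvd_mul.1 h5 with h | h
    · have := (Nat.dvd_sub hpq h)
      rw [Nat.sub_sub_self hq0] at this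
      exact hp.out.one_lt.ne' (Nat.dvd_one.1 this)
    · have := (Nat.dvd_add_right hpq).1 h
      exact hp.out.one_lt.ne' (Nat.dvd_one.1 this)
  exact ⟨hP.toSylow hi, rfl⟩

open scoped Pointwise in
lemma aut_triv (h2 : (2 : K) ≠ 0) (hpq : p ∣ NC K) (lam : MulChar K ℂ) (hl : lam (-1) = 1) (hlam : ∀ t, lam t = 1 ↔ t ^ 2 = 1)
    {τ : MulAut (PSL2 K)} {r m : ℕ} (hr : r.Prime) (hn : τ ^ (r ^ m) = 1) (hc : ¬ r ∣ NC (PSL2 K))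
    (hq : Odd (NC K)) (hr2 : r ≠ 2)
    (A : PV lam ≃ₗ[ℂ] PV lam)
    (hA : ∀ s v, A (PR lam hl s v) = PR lam hl (τ s) (A v)) : τ = 1 := by
  obtain ⟨U, hUU⟩ := UR_syl (K := K) (p := p) h2 hpq
  have hr' : Fact r.Prime := ⟨hr⟩
  have hS : NC (Sylow p (PSL2 K)) = NC K + 1 := by
    rw [Sylow.card_eq_index_normalizer U, ← index_BS, ← norm_UR]
    change (Subgroup.normalizer ((U : Subgroup (PSL2 K)) : Set (PSL2 K))).index = _
    rw [hUU]
  have hPG : IsPGroup r (zpowers τ) := by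
    rintro ⟨x, hx⟩
    obtain ⟨j, rfl⟩ := Subgroup.mem_zpowers_iff.1 hx
    refine ⟨m, ?_⟩
    ext1
    change (τ ^ j) ^ (r ^ m) = 1
    rw [← zpow_natCast, zpow_comm, zpow_natCast, hn, one_zpow]
  have hmod := hPG.card_modEq_card_fixedPoints (Sylow p (PSL2 K))
  have hrq : ∀ d, d ∣ NC K * (NC K - 1) * (NC K + 1) → ¬ r ∣ d := by
    intro d hd hrd
    have := hrd.trans hd
    rw [← card_PSL h2] at this
    rcases hr.dvd_mul.1 this with h | h
    · exact hr2 ((Nat.prime_dvd_prime_iff_eq hr Nat.prime_two).1 h)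
    · exact hc h
  have hnt : 1 < NC (MulAction.fixedPoints (zpowers τ) (Sylow p (PSL2 K))) := by
    by_contra hlt
    rw [hS] at hmod
    have : NC (MulAction.fixedPoints (zpowers τ) (Sylow p (PSL2 K))) = 0 ∨
      NC (MulAction.fixedPoints (zpowers τ) (Sylow p (PSL2 K))) = 1 := by omega
    rcases this with h | h <;> rw [h] at hmod
    · exact hrq _ (dvd_mul_left _ _) ((Nat.modEq_zero_iff_dvd).1 hmod)
    · have := (Nat.modEq_iff_dvd' (by omega)).1 hmod.symm
      rw [Nat.add_sub_cancel] at this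
      exact hrq _ ((dvd_mul_right _ _).mul_right _) this
  rw [Finite.one_lt_card_iff_nontrivial] at hnt
  obtain ⟨⟨P, hP⟩, ⟨Q, hQ⟩, hPQ⟩ := hnt.exists_pair_ne
  have hPQ : P ≠ Q := fun h => hPQ (Subtype.ext h)
  have hP : τ • P = P := hP ⟨τ, Subgroup.mem_zpowers τ⟩
  have hQ : τ • Q = Q := hQ ⟨τ, Subgroup.mem_zpowers τ⟩
  obtain ⟨s, hs⟩ := MulAction.exists_smul_eq (PSL2 K) P U
  obtain ⟨b, hb⟩ := MulAction.exists_smul_eq (PSL2 K) U (s • Q)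
  have hbB : b ∉ BS := by
    intro h
    apply hPQ
    have : b • U = U := by
      rw [Sylow.smul_eq_iff_mem_normalizer]
      change b ∈ (Subgroup.normalizer ((U : Subgroup (PSL2 K)) : Set (PSL2 K)))
      rw [hUU, norm_UR]; exact h
    rw [this, ← hs] at hb
    exact smul_left_cancel _ hb
  obtain ⟨B, rfl⟩ := mkS_surj b
  have hB : B 1 0 ≠ 0 := fun h => hbB (mem_BS.2 h)
  set w := mkS (comp2 (0 : K)) with hw
  have ww : w * w = 1 := w_sq
  have wi : w⁻¹ = w := inv_eq_of_mul_eq_one_left ww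
  set z := mkS (uu (B 0 0 / B 1 0)) with hz
  have hdec : w * z⁻¹ * mkS B ∈ BS := by
    rw [hw, hz, ← map_inv, ← map_mul, ← map_mul, mem_BS]
    have := sl_inv (uu (B 0 0 / B 1 0))
    rw [sl_mul, sl_mul, sl_mul, this.1, this.2.1, this.2.2.1, this.2.2.2]
    simp [comp2, uu]
    field_simp
    ring
  have hzU : z⁻¹ • U = U := by
    rw [Sylow.smul_eq_iff_mem_normalizer]
    change _ ∈ (Subgroup.normalizer ((U : Subgroup (PSL2 K)) : Set (PSL2 K)))
    rw [hUU, norm_UR]; exact BS.inv_mem (UR_BS (uu_UR _))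
  have h1 : (z⁻¹ * s) • P = U := by rw [mul_smul, hs, hzU]
  have h3 : (w * (z⁻¹ * s)) • Q = U := by
    rw [mul_smul, mul_smul, ← hb, ← mul_smul, ← mul_smul, Sylow.smul_eq_iff_mem_normalizer]
    change _ ∈ (Subgroup.normalizer ((U : Subgroup (PSL2 K)) : Set (PSL2 K)))
    rw [hUU, norm_UR]; exact hdec
  generalize z⁻¹ * s = y at h1 h3
  have tr : ∀ (x : PSL2 K) (T : Sylow p (PSL2 K)), τ • T = T → x • T = U →
      ∀ g, x * τ g * x⁻¹ ∈ UR ↔ x * g * x⁻¹ ∈ UR := by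
    intro x T hT hx g
    have hm : ∀ g, x * g * x⁻¹ ∈ UR ↔ g ∈ (T : Subgroup (PSL2 K)) := by
      intro g
      rw [← hUU, ← hx]
      exact Subgroup.smul_mem_pointwise_smul_iff (a := MulAut.conj x) (S := (T : Subgroup (PSL2 K))) (x := g)
    rw [hm, hm]
    conv_lhs => rw [← hT]
    exact Subgroup.smul_mem_pointwise_smul_iff (a := τ) (S := (T : Subgroup (PSL2 K))) (x := g)
  have t1 := tr y P hP h1
  have t2 := tr (w * y) Q hQ h3
  set τ' : MulAut (PSL2 K) := MulAut.conj y * τ * (MulAut.conj y)⁻¹ with hτ'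
  have hτa : ∀ g, τ' g = y * τ (y⁻¹ * g * y) * y⁻¹ := by
    intro g
    rw [hτ', ← map_inv]
    simp only [MulAut.mul_apply, MulAut.conj_apply, inv_inv]
  have hfin : τ' = 1 := by
    let AA : PV lam ≃ₗ[ℂ] PV lam :=
      LinearEquiv.ofLinear (PR lam hl y ∘ₗ A.toLinearMap ∘ₗ PR lam hl y⁻¹) (PR lam hl y ∘ₗ A.symm.toLinearMap ∘ₗ PR lam hl y⁻¹)
        (by
          ext1 v
          simp only [LinearMap.comp_apply, LinearMap.id_apply, ← Module.End.mul_apply (PR lam hl y⁻¹), ← map_mul, inv_mul_cancel, map_one,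
            Module.End.one_apply, coe_coe, LinearEquiv.apply_symm_apply]
          rw [← Module.End.mul_apply, ← map_mul, mul_inv_cancel, map_one, Module.End.one_apply])
        (by
          ext1 v
          simp only [LinearMap.comp_apply, LinearMap.id_apply, ← Module.End.mul_apply (PR lam hl y⁻¹), ← map_mul, inv_mul_cancel, map_one,
            Module.End.one_apply, coe_coe, LinearEquiv.symm_apply_apply]
          rw [← Module.End.mul_apply, ← map_mul, mul_inv_cancel, map_one, Module.End.one_apply])
    have hAA : ∀ v, AA v = PR lam hl y (A (PR lam hl y⁻¹ v)) := fun v => rfl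
    refine aut_norm h2 lam hl hlam (n := r ^ m) ?_ ?_ hq ((hr.odd_of_ne_two hr2).pow) AA ?_ ?_ ?_
    · rw [hτ', conj_pow, hn]; simp
    · exact Coprime.pow_left m ((Nat.Prime.coprime_iff_not_dvd hr).2 hc)
    · intro g v
      rw [hAA, hAA, ← Module.End.mul_apply (PR lam hl y⁻¹), ← map_mul, hτa]
      have : y⁻¹ * g = (y⁻¹ * g * y) * y⁻¹ := by group
      rw [this, map_mul (PR lam hl), Module.End.mul_apply, hA, ← Module.End.mul_apply, ← map_mul (PR lam hl),
        ← Module.End.mul_apply (PR lam hl (y * _ * y⁻¹)), ← map_mul (PR lam hl)]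
      rw [inv_mul_cancel_right, mul_inv_cancel_right]
    · intro g
      rw [hτa, t1]
      congr! 1
      group
    · intro g
      have e1 : w * τ' g * w = (w * y) * τ (y⁻¹ * g * y) * (w * y)⁻¹ := by
        rw [hτa, mul_inv_rev, wi]; group
      rw [e1, t2]
      congr! 1
      rw [mul_inv_rev, wi, ← hw]; group
  have : τ = (MulAut.conj y)⁻¹ * τ' * MulAut.conj y := by rw [hτ']; group
  rw [this, hfin]; group
end Aut2

lemma IrrR.comp_surj {G H V : Type*} [Group G] [Group H] [AddCommGroup V] [Module ℂ V] {ρ : H →* EC V}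
    (h : IrrR ρ) {φ : G →* H} (hφ : Surjective φ) : IrrR (ρ.comp φ) := by
  refine ⟨h.1, fun P hP => h.2 P fun g v hv => ?_⟩
  obtain ⟨x, rfl⟩ := hφ g
  exact hP x v hv

lemma deg_quot {G H : Type} [Group G] [Group H] [Finite G] [Finite H] {φ : G →* H} (hφ : Surjective φ) {n : ℕ}
    (hn : n ∈ charDegrees H) : n ∈ charDegrees G := by
  obtain ⟨V, _, _, _, ρ, hρ, rfl⟩ := irrR_of_charDegrees hn
  exact charDegrees_of_irrR _ (hρ.comp_surj hφ)

section Inert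
variable {G : Type} [Group G] [Fintype G] (M : Subgroup G) [hM : M.Normal] [Fintype M] (R : Subgroup G) [hR : R.Normal]

lemma exists_T {S : Type} [Group S] {φ : M →* S} (hφ : Surjective φ) (hk : ∀ m, φ m = 1 ↔ (m : G) ∈ R) :
    ∃ T : G →* MulAut S, ∀ g m, T g (φ m) = φ (cjN M g m) := by
  have hle : ∀ g, φ.ker ≤ (φ.comp (cjN M g)).ker := by
    intro g m hm
    rw [MonoidHom.mem_ker, hk] at hm
    rw [MonoidHom.mem_ker, MonoidHom.comp_apply, hk, cjN_coe]
    exact hR.conj_mem _ hm g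
  let Φ : G → S →* S := fun g => φ.liftOfSurjective hφ ⟨φ.comp (cjN M g), hle g⟩
  have hΦ : ∀ g m, Φ g (φ m) = φ (cjN M g m) := fun g m =>
    φ.liftOfRightInverse_comp_apply _ (Function.rightInverse_surjInv hφ) ⟨φ.comp (cjN M g), hle g⟩ m
  have hinv : ∀ g s, Φ g (Φ g⁻¹ s) = s := by
    intro g s
    obtain ⟨m, rfl⟩ := hφ s
    rw [hΦ, hΦ, cjN_inv]
  have hinv2 : ∀ g s, Φ g⁻¹ (Φ g s) = s := fun g s => by simpa using hinv g⁻¹ s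
  let E : G → MulAut S := fun g => MulEquiv.mk ⟨Φ g, Φ g⁻¹, hinv2 g, hinv g⟩ (map_mul (Φ g))
  refine ⟨MonoidHom.mk ⟨E, ?_⟩ ?_, hΦ⟩
  · ext s
    obtain ⟨m, rfl⟩ := hφ s
    exact (hΦ 1 m).trans (by rw [cjN_one]; rfl)
  · intro g h
    ext s
    obtain ⟨m, rfl⟩ := hφ s
    refine (hΦ _ m).trans ?_
    rw [cjN_mul]
    change _ = Φ g (Φ h (φ m))
    rw [hΦ, hΦ]

lemma exists_relt {I : Subgroup G} (hI : M ≤ I) {r : ℕ} (hr : r.Prime) (h1 : r ∣ M.index) (h2 : ¬ r ∣ I.index) :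
    ∃ g ∈ I, g ∉ M ∧ ∃ m, g ^ (r ^ m) = 1 := by
  have hr' : Fact r.Prime := ⟨hr⟩
  rw [← relIndex_mul_index hI] at h1
  have h3 : r ∣ (M.subgroupOf I).index := (hr.dvd_mul.1 h1).resolve_right h2
  obtain ⟨x, hx⟩ := exists_prime_orderOf_dvd_card' (G := I ⧸ (M.subgroupOf I)) r h3
  obtain ⟨x, rfl⟩ := QuotientGroup.mk_surjective x
  obtain ⟨m, b, hb, he⟩ := Nat.exists_eq_pow_mul_and_not_dvd (orderOf_pos x).ne' r hr.ne_one
  refine ⟨x ^ b, I.pow_mem x.2 b, ?_, m, ?_⟩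
  · intro h
    apply hb
    rw [← hx]
    apply orderOf_dvd_of_pow_eq_one
    rw [← QuotientGroup.mk_pow, QuotientGroup.eq_one_iff]
    exact h
  · rw [← pow_mul, mul_comm, ← he, ← Subgroup.coe_pow, pow_orderOf_eq_one, Subgroup.coe_one]

variable {K : Type} [Field K] [Finite K] {p : ℕ} [hp : Fact p.Prime] [CharP K p]

theorem deg_inert {φ : M →* PSL2 K} (hφ : Surjective φ) (hk : ∀ m, φ m = 1 ↔ (m : G) ∈ R) (hRM : R ≤ M)
    (hc : ∀ g : G, (∀ m ∈ M, g * m * g⁻¹ * m⁻¹ ∈ R) → g ∈ R)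
    (h2 : (2 : K) ≠ 0) (hpq : p ∣ NC K) (hq : Odd (NC K)) (hq29 : 29 ≤ NC K) :
    ∃ n ∈ charDegrees G, NC K + 1 ∣ n ∧
      ∀ r : ℕ, r.Prime → r ≠ 2 → ¬ r ∣ NC (PSL2 K) → r ∣ M.index → r ∣ n := by
  obtain ⟨lam, hlam⟩ := exists_lam hq
  have hl : lam (-1) = 1 := (hlam _).2 (by norm_num)
  obtain ⟨t, ht⟩ : ∃ t : Kˣ, lam (t : K) ^ 2 ≠ 1 := by
    obtain ⟨t, ht⟩ := IsCyclic.exists_ofOrder_eq_natCard (α := Kˣ)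
    refine ⟨t, fun h => ?_⟩
    rw [← map_pow, hlam, ← pow_mul] at h
    have : t ^ (2 * 2) = 1 := by ext; simpa using h
    have := le_of_dvd (by norm_num) (orderOf_dvd_of_pow_eq_one this)
    rw [ht, Nat.card_units] at this
    omega
  have hirr := (PR_irr lam hl ht).comp_surj hφ
  obtain ⟨n, hn, hd⟩ := deg_up_irr M hirr
  refine ⟨n, hn, ?_, fun r hr hr2 hrS hrM => ?_⟩
  · rw [← pv_rank lam]; exact (dvd_mul_left _ _).trans hd
  by_contra hrn
  have hri : ¬ r ∣ (inertR M ((PR lam hl).comp φ)).index := fun h => hrn (h.trans ((dvd_mul_right _ _).trans hd))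
  obtain ⟨g, ⟨A, hA⟩, hgM, m, hgm⟩ := exists_relt M (le_inertR M _) hr hrM hri
  obtain ⟨T, hT⟩ := exists_T M R hφ hk
  have : T g = 1 := by
    refine aut_triv (p := p) h2 hpq lam hl hlam hr (m := m) ?_ hrS hq hr2 A ?_
    · rw [← map_pow, hgm, map_one]
    · intro s v
      obtain ⟨x, rfl⟩ := hφ s
      rw [hT]
      exact hA x v
  apply hgM
  apply hRM
  apply hc
  intro x hx
  have h3 := hT g ⟨x, hx⟩
  rw [this, MulAut.one_apply] at h3
  have h4 : φ (cjN M g ⟨x, hx⟩ * (⟨x, hx⟩ : M)⁻¹) = 1 := by rw [map_mul, ← h3, map_inv, mul_inv_cancel]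
  rw [hk] at h4
  simpa [cjN_coe] using h4
end Inert

lemma gam_fam {M S : Type} [Group M] [Fintype M] [Group S] (φ : M →* S) (hφ : Surjective φ) {d : ℕ}
    (hd : d ∈ charDegrees φ.ker) :
    ∃ (Γ : Type) (_ : Group Γ) (_ : Fintype Γ) (π : Γ →* S) (F : Fam π),
      ∀ j, π.range.index * F.n j * d ∈ charDegrees M := by
  classical
  have := ofFinite φ.ker
  obtain ⟨W, _, _, _, σ, hσ, rfl⟩ := irrR_of_charDegrees hd
  obtain ⟨Γ, _, _, a, b, i, hb, ha, hai, hbi, hab⟩ := exists_Gamma φ.ker hσ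
  have hun : ∀ (n : φ.ker) (c c' : ℂ), c • σ n = c' • σ n → c = c' := by
    intro n c c' h
    have h1 : (c • σ n) * σ n⁻¹ = (c' • σ n) * σ n⁻¹ := by rw [h]
    rw [smul_mul_assoc, smul_mul_assoc, ← map_mul, mul_inv_cancel, map_one] at h1
    have := hσ.1
    obtain ⟨v, hv⟩ := exists_ne (0 : W)
    have h2 := congrArg (fun f : EC W => f v) h1
    exact smul_left_injective ℂ hv h2
  have hκ : ∀ z, ∃ c : ℂ, ∀ h : a z ∈ φ.ker, b z = c • σ ⟨a z, h⟩ := by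
    intro z
    by_cases h : a z ∈ φ.ker
    · obtain ⟨c, hc⟩ := hab (z * (i ⟨a z, h⟩)⁻¹) (by rw [map_mul, map_inv, hai]; simp)
      refine ⟨c, fun _ => ?_⟩
      have : z = (z * (i ⟨a z, h⟩)⁻¹) * i ⟨a z, h⟩ := by group
      conv_lhs => rw [this, map_mul, hc, hbi, smul_mul_assoc, one_mul]
    · exact ⟨0, fun h' => (h h').elim⟩
  choose κ hκ using hκ
  let π : Γ →* S := φ.comp a
  have hπ : ∀ z, π z = 1 → a z ∈ φ.ker := fun z h => h
  have κ1 : κ 1 = 1 := by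
    have h1 := hκ 1 (by rw [map_one]; exact one_mem _)
    refine hun 1 _ _ ?_
    have e : (⟨a 1, by rw [map_one]; exact one_mem _⟩ : φ.ker) = 1 := Subtype.ext (map_one a)
    rw [e, map_one] at h1
    rw [one_smul, ← h1, map_one]
  have κm : ∀ z w, π z = 1 → π w = 1 → κ (z * w) = κ z * κ w := by
    intro z w hz hw
    have h1 := hκ (z * w) (by rw [map_mul]; exact mul_mem (hπ z hz) (hπ w hw))
    refine hun (⟨a z, hπ z hz⟩ * ⟨a w, hπ w hw⟩) _ _ ?_
    have e : (⟨a (z * w), by rw [map_mul]; exact mul_mem (hπ z hz) (hπ w hw)⟩ : φ.ker) = ⟨a z, hπ z hz⟩ * ⟨a w, hπ w hw⟩ :=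
      Subtype.ext (map_mul a z w)
    rw [e] at h1
    rw [← h1, map_mul, hκ z (hπ z hz), hκ w (hπ w hw), map_mul, smul_mul_smul_comm]
  have κc : ∀ g z, π z = 1 → κ (g * z * g⁻¹) = κ z := by
    intro g z hz
    have hm : a (g * z * g⁻¹) ∈ φ.ker := by
      rw [map_mul, map_mul, map_inv]; exact φ.normal_ker.conj_mem _ (hπ z hz) _
    have h1 := hκ (g * z * g⁻¹) hm
    refine hun ⟨_, hm⟩ _ _ ?_
    rw [← h1]
    ext w
    rw [map_mul, map_mul, hκ z (hπ z hz), Module.End.mul_apply, Module.End.mul_apply, LinearMap.smul_apply, map_smul, hb,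
      ← Module.End.mul_apply (b g), ← map_mul, mul_inv_cancel, map_one, LinearMap.smul_apply, Module.End.one_apply]
    congr 3
    ext
    rw [cjN_coe]; simp
  have κi : ∀ n, κ (i n) = 1 := by
    intro n
    have hm : a (i n) ∈ φ.ker := by rw [hai]; exact n.2
    refine hun n _ _ ?_
    have e : (⟨a (i n), hm⟩ : φ.ker) = n := Subtype.ext (hai n)
    have := hκ (i n) hm
    rw [e, hbi] at this
    rw [← this, one_smul]
  have κ0 : ∀ z, π z = 1 → κ z ≠ 0 := by
    intro z hz h
    have := κm z z⁻¹ hz (by rw [map_inv, hz, inv_one])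
    rw [mul_inv_cancel, κ1, h, zero_mul] at this
    exact one_ne_zero this
  obtain ⟨F, hF⟩ := exists_fam π (fun z => (κ z)⁻¹) (by rw [κ1, inv_one])
    (fun z w hz hw => by rw [κm z w hz hw, mul_inv]) (fun g z hz => by rw [κc g z hz])
  refine ⟨Γ, _, _, π, F, fun j => ?_⟩
  have hidx : π.range.index = (inertR φ.ker σ).index := by
    have e : a.range = inertR φ.ker σ := by
      ext g
      rw [ha]; rfl
    rw [MonoidHom.range_comp, e, Subgroup.index_map, sup_of_le_left (le_inertR φ.ker σ), MonoidHom.range_eq_top.2 hφ,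
      Subgroup.index_top, mul_one]
  have key := clif_exists φ.ker hσ a b hb (fun g hg => (ha g).1 hg) i hai hbi (F.ρ j) (F.irr j) (fun n => by
      have : π (i n) = 1 := by change φ (a (i n)) = 1; rw [hai]; exact n.2
      rw [F.scal _ this, hF]
      simp only [κi, inv_one, one_smul]) (fun γ hγ => by
      have h1 : π γ = 1 := by change φ (a γ) = 1; rw [hγ, map_one]
      have e : (⟨a γ, h1⟩ : φ.ker) = 1 := Subtype.ext hγ
      have h2 := hκ γ h1
      rw [e, map_one] at h2
      rw [F.scal _ h1, hF, h2]
      simp only [map_smul_left, TensorProduct.map_smul_right, smul_smul]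
      rw [inv_mul_cancel₀ (κ0 γ h1), one_smul, TensorProduct.map_one])
  rw [Module.finrank_fin_fun, ← hidx] at key
  convert key using 1
  ring

theorem gam_core {K : Type} [Field K] [Finite K] {p : ℕ} [hp : Fact p.Prime] [CharP K p] (hpq : p ∣ NC K)
    (hq : Odd (NC K)) (h2 : (2 : K) ≠ 0) (hq29 : 29 ≤ NC K)
    {M : Type} [Group M] [Fintype M] (φ : M →* PSL2 K) (hφ : Surjective φ) {d : ℕ} (hd : d ∈ charDegrees φ.ker)
    {x y : ℕ} (hx : x.Prime) (hx2 : x ≠ 2) (hxd : x ∣ NC K - 1) (hy : y.Prime) (hy2 : y ≠ 2) (hyd : y ∣ NC K + 1)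
    (hnx : ∀ n ∈ charDegrees M, ¬ p * x ∣ n) (hny : ∀ n ∈ charDegrees M, ¬ p * y ∣ n)
    {ℓ : ℕ} (hℓ : ℓ.Prime) (hℓd : ℓ ∣ NC K - 1 ∨ ℓ ∣ NC K + 1) : ∃ n ∈ charDegrees M, ℓ * d ∣ n := by
  obtain ⟨Γ, _, _, π, F, hF⟩ := gam_fam φ hφ hd
  obtain ⟨i, hi⟩ := F.core hpq hq h2 hq29 hx hx2 hxd hy hy2 hyd (fun i h => hnx _ (hF i) (h.mul_right _))
    (fun i h => hny _ (hF i) (h.mul_right _)) hℓ hℓd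
  exact ⟨_, hF i, mul_dvd_mul_right hi d⟩

lemma small_q {q : ℕ} (hq : Odd q) (h : 3 ≤ ((q - 1).primeFactors.erase 2).card + ((q + 1).primeFactors.erase 2).card) :
    29 ≤ q := by
  by_contra hlt
  have key : ∀ q < 29, Odd q → ((q - 1).primeFactors.erase 2).card + ((q + 1).primeFactors.erase 2).card < 3 := by
    decide +kernel
  exact absurd h (by have := key q (by omega) hq; omega)

def AdjN (G : Type) [Group G] (a b : ℕ) : Prop := ∃ n ∈ charDegrees G, a * b ∣ n

lemma AdjN.symm {G : Type} [Group G] {a b : ℕ} (h : AdjN G a b) : AdjN G b a := by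
  obtain ⟨n, hn, h⟩ := h; exact ⟨n, hn, mul_comm a b ▸ h⟩

lemma adjN_of {G : Type} [Group G] {a b n : ℕ} (hn : n ∈ charDegrees G) (ha : a.Prime) (hb : b.Prime) (hab : a ≠ b)
    (h1 : a ∣ n) (h2 : b ∣ n) : AdjN G a b :=
  ⟨n, hn, ((Nat.coprime_primes ha hb).2 hab).mul_dvd_of_dvd_of_dvd h1 h2⟩

lemma no_clique {G : Type} [Group G] (h4 : (charGraph G).CliqueFree 4) (T : Finset ℕ) (hT : 4 ≤ T.card)
    (hp : ∀ a ∈ T, a.Prime) (h : ∀ a ∈ T, ∀ b ∈ T, a ≠ b → AdjN G a b) : False := by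
  classical
  have hmem : ∀ a ∈ T, a ∈ charPrimes G := by
    intro a ha
    obtain ⟨b, hb, hab⟩ := Finset.exists_mem_ne (by omega : 1 < T.card) a
    obtain ⟨n, hn, hd⟩ := h a ha b hb hab.symm
    exact ⟨hp a ha, n, hn, (dvd_mul_right _ _).trans hd⟩
  refine h4.mono hT (T.subtype (· ∈ charPrimes G)) ?_
  rw [SimpleGraph.isNClique_iff]
  constructor
  · rintro ⟨a, ha⟩ ha' ⟨b, hb⟩ hb' hab
    have hab : a ≠ b := fun e => hab (Subtype.ext e)
    rw [mem_coe, Finset.mem_subtype] at ha' hb'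
    exact ⟨hab, h a ha' b hb' hab⟩
  · rw [Finset.card_subtype, Finset.filter_true_of_mem hmem]

lemma bip {G : Type} [Group G] {N : ℕ} (hbip : ¬ (((charGraph G).induce
      {x : ↥(charPrimes G) | (x : ℕ) ∈ N.primeFactors})ᶜ).Colorable 2) (c : ℕ → Prop)
    (h : ∀ v ∈ N.primeFactors, ∀ w ∈ N.primeFactors, v ≠ w → (c v ↔ c w) → AdjN G v w) : False := by
  classical
  apply hbip
  refine ⟨SimpleGraph.Coloring.mk (fun v => if c v.1.1 then 0 else 1) ?_⟩
  rintro ⟨⟨v, hv⟩, hv'⟩ ⟨⟨w, hw⟩, hw'⟩ hvw he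
  rw [SimpleGraph.compl_adj] at hvw
  obtain ⟨hne, hna⟩ := hvw
  have hne : v ≠ w := fun e => hne (by subst e; rfl)
  apply hna
  refine ⟨hne, h v hv' w hw' hne ?_⟩
  by_cases h1 : c v <;> by_cases h2 : c w <;> simp [h1, h2] at he ⊢

section Main
variable {G : Type} [Group G] [Fintype G] (M : Subgroup G) [hM : M.Normal] [Fintype M] (R : Subgroup G) [hR : R.Normal]
variable {K : Type} [Field K] [Finite K] {p : ℕ} [hp : Fact p.Prime] [CharP K p]

set_option maxHeartbeats 1000000 in
theorem main_abs {φ : M →* PSL2 K} (hφ : Surjective φ) (hk : ∀ m, φ m = 1 ↔ (m : G) ∈ R) (hRM : R ≤ M)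
    (hc : ∀ g : G, (∀ m ∈ M, g * m * g⁻¹ * m⁻¹ ∈ R) → g ∈ R)
    (h2 : (2 : K) ≠ 0) {k : ℕ} (hqp : NC K = p ^ k) (hk0 : 0 < k) (hq : Odd (NC K))
    (h4 : (charGraph G).CliqueFree 4) (h7 : NC ↥(charPrimes G) = 7)
    (hbip : ¬ (((charGraph G).induce
      {x : ↥(charPrimes G) | (x : ℕ) ∈ (NC (PSL2 K)).primeFactors})ᶜ).Colorable 2) :
    ¬ ((((NC K - 1).primeFactors.erase 2).card = 1 ∧ ((NC K + 1).primeFactors.erase 2).card = 2) ∨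
       (((NC K - 1).primeFactors.erase 2).card = 2 ∧ ((NC K + 1).primeFactors.erase 2).card = 1) ∨
       (((NC K - 1).primeFactors.erase 2).card = 2 ∧ ((NC K + 1).primeFactors.erase 2).card = 2)) := by
  classical
  intro hcard
  have hpq : p ∣ NC K := by rw [hqp]; exact dvd_pow_self p hk0.ne'
  have hq29 : 29 ≤ NC K := small_q hq (by omega)
  have hcS := card_PSL h2
  set q := NC K with hqdef
  set Mo := (q - 1).primeFactors.erase 2 with hMo
  set Po := (q + 1).primeFactors.erase 2 with hPo
  have mMo : ∀ v, v ∈ Mo ↔ v ≠ 2 ∧ v.Prime ∧ v ∣ q - 1 := by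
    intro v; rw [hMo, mem_erase, Nat.mem_primeFactors]
    exact ⟨fun h => ⟨h.1, h.2.1, h.2.2.1⟩, fun h => ⟨h.1, h.2.1, h.2.2, by omega⟩⟩
  have mPo : ∀ v, v ∈ Po ↔ v ≠ 2 ∧ v.Prime ∧ v ∣ q + 1 := by
    intro v; rw [hPo, mem_erase, Nat.mem_primeFactors]
    exact ⟨fun h => ⟨h.1, h.2.1, h.2.2.1⟩, fun h => ⟨h.1, h.2.1, h.2.2, by omega⟩⟩
  obtain ⟨u, hu⟩ := hq
  have d2m : 2 ∣ q - 1 := by omega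
  have d2p : 2 ∣ q + 1 := by omega
  have hSp : ∀ v ∈ (NC (PSL2 K)).primeFactors, v = p ∨ v = 2 ∨ v ∈ Mo ∨ v ∈ Po := by
    intro v hv
    have hvp := Nat.prime_of_mem_primeFactors hv
    have hd : v ∣ q * (q - 1) * (q + 1) := hcS ▸ (dvd_mul_of_dvd_right (Nat.dvd_of_mem_primeFactors hv) 2)
    by_cases e : v = 2
    · exact inr (inl e)
    rcases hvp.dvd_mul.1 hd with h | h
    · rcases hvp.dvd_mul.1 h with h | h
      · left
        rw [hqp] at h
        exact (Nat.prime_dvd_prime_iff_eq hvp hp.out).1 (hvp.dvd_of_dvd_pow h)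
      · exact inr (inr (inl ((mMo v).2 ⟨e, hvp, h⟩)))
    · exact inr (inr (inr ((mPo v).2 ⟨e, hvp, h⟩)))
  have h2S : 2 ∣ NC (PSL2 K) := by
    have h1 : 2 * 2 ∣ 2 * NC (PSL2 K) := by
      rw [hcS, mul_assoc]; exact dvd_mul_of_dvd_right (mul_dvd_mul d2m d2p) _
    exact dvd_of_mul_dvd_mul_left (by norm_num) h1
  obtain ⟨n1, hn1, hd1⟩ : ∃ n ∈ charDegrees G, ∀ ℓ : ℕ, ℓ.Prime → ℓ ∣ q - 1 → ℓ ∣ n := by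
    obtain ⟨n, hn, h⟩ := cusp ⟨u, hu⟩ h2 hq29
    obtain ⟨n', hn', hd⟩ := deg_up M (deg_quot hφ hn)
    exact ⟨n', hn', fun ℓ hℓ hd' => (h ℓ hℓ hd').trans hd⟩
  obtain ⟨n2, hn2, hd2, hd2'⟩ := deg_inert M R (p := p) hφ hk hRM hc h2 hpq ⟨u, hu⟩ hq29
  obtain ⟨x, hx, y, hy, hnx, hny⟩ : ∃ x ∈ Mo, ∃ y ∈ Po, ¬ AdjN G p x ∧ ¬ AdjN G p y := by
    by_contra hcon
    push Not at hcon
    have hM2 : ∀ v, v = 2 ∨ v ∈ Mo → v.Prime ∧ v ∣ n1 := by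
      rintro v (rfl | h)
      · exact ⟨Nat.prime_two, hd1 2 Nat.prime_two d2m⟩
      · exact ⟨((mMo v).1 h).2.1, hd1 v ((mMo v).1 h).2.1 ((mMo v).1 h).2.2⟩
    have hP2 : ∀ v, v = 2 ∨ v ∈ Po → v.Prime ∧ v ∣ n2 := by
      rintro v (rfl | h)
      · exact ⟨Nat.prime_two, d2p.trans hd2⟩
      · exact ⟨((mPo v).1 h).2.1, ((mPo v).1 h).2.2.trans hd2⟩
    have fin : ∀ (A B : Finset ℕ) (a b : ℕ), a ∈ charDegrees G → b ∈ charDegrees G →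
        (∀ v, v = 2 ∨ v ∈ A → v.Prime ∧ v ∣ a) → (∀ v, v = 2 ∨ v ∈ B → v.Prime ∧ v ∣ b) →
        (∀ v ∈ (NC (PSL2 K)).primeFactors, v = p ∨ v = 2 ∨ v ∈ A ∨ v ∈ B) → (∀ v ∈ A, AdjN G p v) → False := by
      intro A B a b ha hb hA hB hAB hpA
      refine bip hbip (fun v => v = p ∨ v ∈ A) ?_
      intro v hv w hw hvw hcol
      by_cases hvA : v = p ∨ v ∈ A
      · rcases hvA with rfl | hvA
        · rcases hcol.1 (inl rfl) with rfl | hw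
          · exact (hvw rfl).elim
          · exact hpA w hw
        · rcases hcol.1 (inr hvA) with rfl | hw
          · exact (hpA v hvA).symm
          · exact adjN_of ha (hA v (inr hvA)).1 (hA w (inr hw)).1 hvw (hA v (inr hvA)).2 (hA w (inr hw)).2
      · have hwA : ¬ (w = p ∨ w ∈ A) := fun h => hvA (hcol.2 h)
        have hv' : v = 2 ∨ v ∈ B := by
          rcases hAB v hv with h | h | h | h
          · exact (hvA (inl h)).elim
          · exact inl h
          · exact (hvA (inr h)).elim
          · exact inr h
        have hw' : w = 2 ∨ w ∈ B := by
          rcases hAB w hw with h | h | h | h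
          · exact (hwA (inl h)).elim
          · exact inl h
          · exact (hwA (inr h)).elim
          · exact inr h
        exact adjN_of hb (hB v hv').1 (hB w hw').1 hvw (hB v hv').2 (hB w hw').2
    by_cases hall : ∀ v ∈ Mo, AdjN G p v
    · exact fin Mo Po n1 n2 hn1 hn2 hM2 hP2 hSp hall
    · push Not at hall
      obtain ⟨x, hx, hnx⟩ := hall
      exact fin Po Mo n2 n1 hn2 hn1 hP2 hM2 (fun v hv => (hSp v hv).imp_right (Or.imp_right Or.symm)) (fun y hy => hcon x hx y hy hnx)
  have hfin : (charPrimes G).Finite := Set.finite_coe_iff.1 (Nat.finite_of_card_ne_zero (by omega))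
  set C : Finset ℕ := hfin.toFinset with hC
  have hCc : C.card = 7 := by rw [hC, ← h7, Nat.card_coe_set_eq, Set.ncard_eq_toFinset_card _ hfin]
  set D := C \ (NC (PSL2 K)).primeFactors with hD
  have hDc : 7 ≤ D.card + (Mo.card + Po.card + 2) := by
    have h1 : (NC (PSL2 K)).primeFactors ⊆ (Mo ∪ Po) ∪ {p, 2} := by
      intro v hv
      rw [Finset.mem_union, Finset.mem_union, Finset.mem_insert, Finset.mem_singleton]
      rcases hSp v hv with h | h | h | h
      · exact inr (inl h)
      · exact inr (inr h)
      · exact inl (inl h)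
      · exact inl (inr h)
    have h3 := Finset.card_le_card h1
    have h5 := Finset.card_union_le (Mo ∪ Po) {p, 2}
    have h6 := Finset.card_union_le Mo Po
    have h8 := Finset.card_le_two (a := p) (b := 2)
    have h9 : C.card - (NC (PSL2 K)).primeFactors.card ≤ D.card := Finset.le_card_sdiff (NC (PSL2 K)).primeFactors C
    omega
  have mD : ∀ r ∈ D, r.Prime ∧ (∃ n ∈ charDegrees G, r ∣ n) ∧ ¬ r ∣ NC (PSL2 K) := by
    intro r hr
    rw [hD, Finset.mem_sdiff, hC, Set.Finite.mem_toFinset] at hr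
    refine ⟨hr.1.1, hr.1.2, fun h => hr.2 ?_⟩
    exact Nat.mem_primeFactors.2 ⟨hr.1.1, h, Nat.card_pos.ne'⟩
  have mD2 : ∀ r ∈ D, r ≠ 2 := by rintro r hr rfl; exact (mD 2 hr).2.2 h2S
  have mDS : ∀ r ∈ D, ¬ r ∣ q - 1 ∧ ¬ r ∣ q + 1 := by
    intro r hr
    have h1 : ∀ d, d ∣ q * (q - 1) * (q + 1) → ¬ r ∣ d := by
      intro d hd h
      have := h.trans hd
      rw [← hcS] at this
      rcases (mD r hr).1.dvd_mul.1 this with h | h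
      · exact mD2 r hr ((Nat.prime_dvd_prime_iff_eq (mD r hr).1 Nat.prime_two).1 h)
      · exact (mD r hr).2.2 h
    exact ⟨h1 _ ((dvd_mul_left _ _).mul_right _), h1 _ (dvd_mul_left _ _)⟩
  by_cases hall : ∀ r ∈ D, r ∣ M.index
  · -- one big degree
    have hall2 : ∀ v ∈ insert 2 (Po ∪ D), v.Prime ∧ v ∣ n2 := by
      intro v hv
      rw [Finset.mem_insert, Finset.mem_union] at hv
      rcases hv with rfl | h | h
      · exact ⟨Nat.prime_two, d2p.trans hd2⟩
      · exact ⟨((mPo v).1 h).2.1, ((mPo v).1 h).2.2.trans hd2⟩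
      · exact ⟨(mD v h).1, hd2' v (mD v h).1 (mD2 v h) (mD v h).2.2 (hall v h)⟩
    refine no_clique h4 (insert 2 (Po ∪ D)) ?_ (fun a ha => (hall2 a ha).1)
      (fun a ha b hb hab => adjN_of hn2 (hall2 a ha).1 (hall2 b hb).1 hab (hall2 a ha).2 (hall2 b hb).2)
    rw [Finset.card_insert_of_notMem, Finset.card_union_of_disjoint]
    · omega
    · rw [Finset.disjoint_left]
      intro v hv hv'
      exact (mDS v hv').2 ((mPo v).1 hv).2.2
    · rw [Finset.mem_union]
      rintro (h | h)
      · exact ((mPo 2).1 h).1 rfl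
      · exact mD2 2 h rfl
  · push Not at hall
    obtain ⟨r, hr, hrM⟩ := hall
    obtain ⟨hrp, ⟨n, hn, hrn⟩, hrS⟩ := mD r hr
    obtain ⟨d, hd, hrd⟩ := F2 M hrp hrM hn hrn
    have hfk := ofFinite φ.ker
    obtain ⟨d', hd', hrd'⟩ := F2 φ.ker hrp (by
      rw [Subgroup.index_ker, MonoidHom.range_eq_top.2 hφ, Subgroup.card_top]; exact hrS) hd hrd
    have hup : ∀ a, ¬ AdjN G p a → ∀ n ∈ charDegrees M, ¬ p * a ∣ n := by
      intro a ha n hn hdv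
      obtain ⟨n', hn', hd⟩ := deg_up M hn
      exact ha ⟨n', hn', hdv.trans hd⟩
    have hadj : ∀ ℓ : ℕ, ℓ.Prime → ℓ ∣ q - 1 ∨ ℓ ∣ q + 1 → AdjN G ℓ r := by
      intro ℓ hℓ hℓd
      obtain ⟨n, hn, hdv⟩ := gam_core hpq ⟨u, hu⟩ h2 hq29 φ hφ hd' ((mMo x).1 hx).2.1 ((mMo x).1 hx).1 ((mMo x).1 hx).2.2
        ((mPo y).1 hy).2.1 ((mPo y).1 hy).1 ((mPo y).1 hy).2.2 (hup x hnx) (hup y hny) hℓ hℓd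
      obtain ⟨n', hn', hd⟩ := deg_up M hn
      exact ⟨n', hn', (mul_dvd_mul_left ℓ hrd').trans (hdv.trans hd)⟩
    have fin : ∀ (A : Finset ℕ) (a : ℕ), a ∈ charDegrees G → A.card = 2 →
        (∀ v ∈ insert 2 A, v.Prime ∧ v ∣ a ∧ (v ∣ q - 1 ∨ v ∣ q + 1)) → 2 ∉ A → False := by
      intro A a ha hA2 hA h2A
      have hrA : r ∉ insert 2 A := fun h => by
        rcases (hA r h).2.2 with h | h
        · exact (mDS r hr).1 h
        · exact (mDS r hr).2 h
      refine no_clique h4 (insert r (insert 2 A)) ?_ ?_ ?_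
      · rw [Finset.card_insert_of_notMem hrA, Finset.card_insert_of_notMem h2A, hA2]
      · intro v hv
        rcases Finset.mem_insert.1 hv with rfl | hv
        · exact hrp
        · exact (hA v hv).1
      · intro v hv w hw hvw
        rcases Finset.mem_insert.1 hv with e | hv
        · rcases Finset.mem_insert.1 hw with e' | hw
          · exact (hvw (e.trans e'.symm)).elim
          · rw [e]; exact (hadj w (hA w hw).1 (hA w hw).2.2).symm
        · rcases Finset.mem_insert.1 hw with e' | hw
          · rw [e']; exact hadj v (hA v hv).1 (hA v hv).2.2
          · exact adjN_of ha (hA v hv).1 (hA w hw).1 hvw (hA v hv).2.1 (hA w hw).2.1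
    by_cases hP2 : Po.card = 2
    · refine fin Po n2 hn2 hP2 ?_ (fun h => ((mPo 2).1 h).1 rfl)
      intro v hv
      rcases Finset.mem_insert.1 hv with rfl | h
      · exact ⟨Nat.prime_two, d2p.trans hd2, inr d2p⟩
      · exact ⟨((mPo v).1 h).2.1, ((mPo v).1 h).2.2.trans hd2, inr ((mPo v).1 h).2.2⟩
    · refine fin Mo n1 hn1 (by omega) ?_ (fun h => ((mMo 2).1 h).1 rfl)
      intro v hv
      rcases Finset.mem_insert.1 hv with rfl | h
      · exact ⟨Nat.prime_two, hd1 2 Nat.prime_two d2m, inl d2m⟩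
      · exact ⟨((mMo v).1 h).2.1, hd1 v ((mMo v).1 h).2.1 ((mMo v).1 h).2.2, inl ((mMo v).1 h).2.2⟩
end Main

theorem stmt17 (G : Type) [Group G] [Finite G]
    (h4 : (charGraph G).CliqueFree 4)
    (h7 : Nat.card ↥(charPrimes G) = 7)
    (M : Subgroup G) (hM : M.Normal) (hRM : solvableRadical G < M)
    (p k : ℕ) (hp : Fact p.Prime) (hpodd : Odd p) (hk : 0 < k)
    (hS : Nonempty (↥(radicalQuotImage M) ≃* PSL2 (GaloisField p k)))
    (hcent : Subgroup.centralizer ((radicalQuotImage M) : Set (G ⧸ solvableRadical G)) = ⊥)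
    (hbip : ¬ (((charGraph G).induce
      {x : ↥(charPrimes G) | (x : ℕ) ∈ (Nat.card ↥(radicalQuotImage M)).primeFactors})ᶜ).Colorable 2) :
    ¬ ((((p ^ k - 1).primeFactors.erase 2).card = 1 ∧
        ((p ^ k + 1).primeFactors.erase 2).card = 2) ∨
       (((p ^ k - 1).primeFactors.erase 2).card = 2 ∧
        ((p ^ k + 1).primeFactors.erase 2).card = 1) ∨
       (((p ^ k - 1).primeFactors.erase 2).card = 2 ∧
        ((p ^ k + 1).primeFactors.erase 2).card = 2)) := by
  classical
  have : Fintype G := ofFinite G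
  have : Fintype M := ofFinite M
  obtain ⟨e⟩ := hS
  have hcK : NC (GaloisField p k) = p ^ k := GaloisField.card p k hk.ne'
  have hq : Odd (NC (GaloisField p k)) := by rw [hcK]; exact hpodd.pow
  have hp2 : p ≠ 2 := by rintro rfl; exact absurd hpodd (by decide)
  have h2 : (2 : GaloisField p k) ≠ 0 := by
    intro h
    have h1 : ((2 : ℕ) : GaloisField p k) = 0 := by exact_mod_cast h
    rw [CharP.cast_eq_zero_iff (GaloisField p k) p] at h1
    exact hp2 ((Nat.prime_dvd_prime_iff_eq hp.out Nat.prime_two).1 h1)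
  let φ0 : M →* radicalQuotImage M := (mk' (solvableRadical G)).subgroupMap M
  have hφ0 : Surjective φ0 := MonoidHom.subgroupMap_surjective _ M
  let φ : M →* PSL2 (GaloisField p k) := e.toMonoidHom.comp φ0
  have hφ : Surjective φ := e.surjective.comp hφ0
  have hker : ∀ m, φ m = 1 ↔ (m : G) ∈ solvableRadical G := by
    intro m
    change e (φ0 m) = 1 ↔ _
    rw [map_eq_one_iff e e.injective, ← QuotientGroup.eq_one_iff, Subtype.ext_iff]
    exact Iff.rfl
  have hc : ∀ g : G, (∀ m ∈ M, g * m * g⁻¹ * m⁻¹ ∈ solvableRadical G) → g ∈ solvableRadical G := by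
    intro g hg
    have : (g : G ⧸ solvableRadical G) ∈ Subgroup.centralizer ((radicalQuotImage M) : Set (G ⧸ solvableRadical G)) := by
      rw [Subgroup.mem_centralizer_iff]
      rintro _ ⟨m, hm, rfl⟩
      have h1 := (QuotientGroup.eq_one_iff _).2 (hg m hm)
      simp only [QuotientGroup.mk_mul, QuotientGroup.mk_inv] at h1
      rw [mul_inv_eq_one, mul_inv_eq_iff_eq_mul] at h1
      exact h1.symm
    rw [hcent, Subgroup.mem_bot, QuotientGroup.eq_one_iff] at this
    exact this
  rw [Nat.card_congr e.toEquiv] at hbip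
  have key := main_abs (p := p) M (solvableRadical G) hφ hker hRM.le hc h2 hcK hk hq h4 h7 hbip
  rw [hcK] at key
  exact key
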